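/- arXiv:1708.05059 — 4 statements merged into one kernel-verified Lean document; each statement's English description precedes it below -/
import Mathlib

section
/- Let g be a 2n-dimensional real nilpotent Lie algebra with n ≥ 4 endowed with a strongly non-nilpotent complex structure J. Then the center of g satisfies 1 ≤ dim Z(g) ≤ n - 3. -/
/-- The ascending central series of a Lie algebra:
`acs g 0 = 0`, `acs g (k+1) = {X | [X,g] ⊆ acs g k}`. -/
def acs (g : Type*) [LieRing g] [LieAlgebra ℝ g] : ℕ → Submodule ℝ g
  | 0 => ⊥
  | k + 1 =>
    { carrier := {X : g | ∀ Y : g, ⁅X, Y⁆ ∈ acs g k}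
      zero_mem' := by intro Y; simp
      add_mem' := by
        intro a b ha hb Y
        rw [add_lie]; exact (acs g k).add_mem (ha Y) (hb Y)
      smul_mem' := by
        intro c x hx Y
        rw [smul_lie]; exact (acs g k).smul_mem c (hx Y) }

section StronglyNonNilpotent

variable {g : Type*} [LieRing g] [LieAlgebra ℝ g]

theorem mem_acs_one {X : g} : X ∈ acs g 1 ↔ ∀ Y : g, ⁅X, Y⁆ = 0 := Iff.rfl

theorem lie_eq_zero_of_mem_acs_one {X : g} (hX : X ∈ acs g 1) (Y : g) : ⁅Y, X⁆ = 0 := by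
  rw [← lie_skew, mem_acs_one.1 hX, neg_zero]

/-- Engel-type principle: a nilpotent Lie algebra acts nilpotently, so some vector of `S` outside
`R` is moved into `R`. -/
theorem exists_mem_notMem_lie_mem (hnil : ∃ s : ℕ, acs g s = ⊤) (S R : Submodule ℝ g)
    (H : Set g) (hS : ∀ Y ∈ S, ∀ T ∈ H, ⁅Y, T⁆ ∈ S) (h : ¬ S ≤ R) :
    ∃ Y ∈ S, Y ∉ R ∧ ∀ T ∈ H, ⁅Y, T⁆ ∈ R := by
  classical
  have hex : ∃ s : ℕ, ¬ S ⊓ acs g s ≤ R := by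
    obtain ⟨s, hs⟩ := hnil
    exact ⟨s, by simpa [hs] using h⟩
  have hfind := Nat.find_spec hex
  have hmin : ∀ m < Nat.find hex, S ⊓ acs g m ≤ R := fun m hm => not_not.1 (Nat.find_min hex hm)
  generalize Nat.find hex = s at hfind hmin
  cases s with
  | zero => exact absurd (by simp [acs]) hfind
  | succ s =>
    obtain ⟨Y, hY, hYR⟩ := SetLike.not_le_iff_exists.1 hfind
    exact ⟨Y, hY.1, hYR, fun T hT => hmin s s.lt_succ_self ⟨hS Y hY.1 T hT, hY.2 T⟩⟩

section LinearAlgebra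

variable {V : Type*} [AddCommGroup V] [Module ℝ V] {J : V →ₗ[ℝ] V}

theorem mem_sup_map {K L : Submodule ℝ V} {Y : V} :
    Y ∈ K ⊔ L.map J ↔ ∃ x ∈ K, ∃ y ∈ L, Y = x + J y := by
  simp only [Submodule.mem_sup, Submodule.mem_map]
  constructor
  · rintro ⟨x, hx, _, ⟨y, hy, rfl⟩, rfl⟩
    exact ⟨x, hx, y, hy, rfl⟩
  · rintro ⟨x, hx, y, hy, rfl⟩
    exact ⟨x, hx, _, ⟨y, hy, rfl⟩, rfl⟩

theorem mem_sup_span_pair {S : Submodule ℝ V} {v w Y : V} :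
    Y ∈ S ⊔ Submodule.span ℝ {v, w} ↔ ∃ x ∈ S, ∃ c d : ℝ, Y = c • v + d • w + x := by
  simp only [Submodule.mem_sup, Submodule.mem_span_pair]
  constructor
  · rintro ⟨x, hx, _, ⟨c, d, rfl⟩, rfl⟩
    exact ⟨x, hx, c, d, by module⟩
  · rintro ⟨x, hx, c, d, rfl⟩
    exact ⟨x, hx, _, ⟨c, d, rfl⟩, by module⟩

theorem mem_sup_map_sup_span_pair {K L : Submodule ℝ V} {v w Y : V} :
    Y ∈ (K ⊔ L.map J) ⊔ Submodule.span ℝ {v, w} ↔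
      ∃ c d : ℝ, ∃ x ∈ K, ∃ y ∈ L, Y = c • v + d • w + x + J y := by
  rw [mem_sup_span_pair]
  constructor
  · rintro ⟨z, hz, c, d, rfl⟩
    obtain ⟨x, hx, y, hy, rfl⟩ := mem_sup_map.1 hz
    exact ⟨c, d, x, hx, y, hy, by abel⟩
  · rintro ⟨c, d, x, hx, y, hy, rfl⟩
    exact ⟨x + J y, mem_sup_map.2 ⟨x, hx, y, hy, rfl⟩, c, d, by abel⟩

theorem complexStructure_injective (hJ2 : ∀ X, J (J X) = -X) : Function.Injective J := by
  intro x y h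
  have := congrArg J h
  simpa [hJ2] using this

theorem map_mem_sup_map (hJ2 : ∀ X, J (J X) = -X) {K : Submodule ℝ V} {Y : V}
    (hY : Y ∈ K ⊔ K.map J) : J Y ∈ K ⊔ K.map J := by
  obtain ⟨x, hx, y, hy, rfl⟩ := mem_sup_map.1 hY
  exact mem_sup_map.2 ⟨-y, K.neg_mem hy, x, hx, by rw [map_add, hJ2]; abel⟩

theorem map_mem_sup_span_pair (hJ2 : ∀ X, J (J X) = -X) {S : Submodule ℝ V}
    (hS : ∀ Y ∈ S, J Y ∈ S) {v Y : V} (hY : Y ∈ S ⊔ Submodule.span ℝ {v, J v}) :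
    J Y ∈ S ⊔ Submodule.span ℝ {v, J v} := by
  obtain ⟨x, hx, c, d, rfl⟩ := mem_sup_span_pair.1 hY
  refine mem_sup_span_pair.2 ⟨J x, hS x hx, -d, c, ?_⟩
  simp only [map_add, map_smul, hJ2]
  module

theorem eq_zero_of_smul_add_smul_mem (hJ2 : ∀ X, J (J X) = -X) {S : Submodule ℝ V}
    (hS : ∀ Y ∈ S, J Y ∈ S) {v : V} (hv : v ∉ S) {c d : ℝ} (h : c • v + d • J v ∈ S) :
    c = 0 ∧ d = 0 := by
  have h2 : (c ^ 2 + d ^ 2) • v ∈ S := by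
    have := S.sub_mem (S.smul_mem c h) (S.smul_mem d (hS _ h))
    simp only [map_add, map_smul, hJ2] at this
    convert this using 1
    module
  have h3 : c ^ 2 + d ^ 2 = 0 := by
    by_contra hne
    exact hv ((S.smul_mem_iff hne).1 h2)
  constructor <;> nlinarith [sq_nonneg c, sq_nonneg d]

theorem finrank_sup_span_pair [FiniteDimensional ℝ V] (hJ2 : ∀ X, J (J X) = -X)
    {S : Submodule ℝ V} (hS : ∀ Y ∈ S, J Y ∈ S) {v : V} (hv : v ∉ S) :
    Module.finrank ℝ ↥(S ⊔ Submodule.span ℝ {v, J v}) = Module.finrank ℝ S + 2 := by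
  have hdis : S ⊓ Submodule.span ℝ {v, J v} = ⊥ := by
    rw [Submodule.eq_bot_iff]
    rintro x ⟨hx, hx'⟩
    obtain ⟨c, d, rfl⟩ := Submodule.mem_span_pair.1 hx'
    obtain ⟨rfl, rfl⟩ := eq_zero_of_smul_add_smul_mem hJ2 hS hv hx
    simp
  have hind : LinearIndependent ℝ ![v, J v] := by
    rw [LinearIndependent.pair_iff]
    intro c d h
    exact eq_zero_of_smul_add_smul_mem hJ2 hS hv (h ▸ S.zero_mem)
  have hspan : Module.finrank ℝ (Submodule.span ℝ {v, J v}) = 2 := by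
    rw [← Matrix.range_cons_cons_empty v (J v) ![], finrank_span_eq_card hind, Fintype.card_fin]
  have := Submodule.finrank_sup_add_finrank_inf_eq S (Submodule.span ℝ {v, J v})
  rw [hdis, finrank_bot, hspan] at this
  omega

theorem finrank_sup_map [FiniteDimensional ℝ V] (hJ2 : ∀ X, J (J X) = -X)
    {K : Submodule ℝ V} (hK : ∀ X ∈ K, J X ∈ K → X = 0) :
    Module.finrank ℝ ↥(K ⊔ K.map J) = 2 * Module.finrank ℝ K := by
  have hdis : K ⊓ K.map J = ⊥ := by
    rw [Submodule.eq_bot_iff]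
    rintro _ ⟨hx, y, hy, rfl⟩
    rw [hK y hy hx, map_zero]
  have := Submodule.finrank_sup_add_finrank_inf_eq K (K.map J)
  rw [hdis, finrank_bot, ← LinearEquiv.finrank_eq
    (Submodule.equivMapOfInjective J (complexStructure_injective hJ2) K)] at this
  omega

/-- Linear coordinates on `ℝ v + ℝ J v + K + J K` for a map with values in this space. -/
theorem exists_coordinates {K : Submodule ℝ V} {v : V}
    (hind : ∀ c d : ℝ, ∀ x ∈ K, ∀ y ∈ K, c • v + d • J v + x + J y = 0 →
      c = 0 ∧ d = 0 ∧ x = 0 ∧ y = 0)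
    (E : V →ₗ[ℝ] V) (hE : ∀ X ∈ K, ∃ c d : ℝ, ∃ x ∈ K, ∃ y ∈ K,
      E X = c • v + d • J v + x + J y) :
    ∃ (α β : V →ₗ[ℝ] ℝ) (a b : V →ₗ[ℝ] V), (∀ X, a X ∈ K) ∧ (∀ X, b X ∈ K) ∧
      ∀ X ∈ K, E X = α X • v + β X • J v + a X + J (b X) := by
  let T : (ℝ × ℝ) × (K × K) →ₗ[ℝ] V :=
    ((LinearMap.toSpanSingleton ℝ V v).coprod (LinearMap.toSpanSingleton ℝ V (J v))).coprod
      (K.subtype.coprod (J ∘ₗ K.subtype))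
  have hT : ∀ c d : ℝ, ∀ x y : K, T ((c, d), (x, y)) = c • v + d • J v + x + J y := by
    intro c d x y
    simp [T, add_assoc]
  have hker : LinearMap.ker T = ⊥ := by
    rw [LinearMap.ker_eq_bot']
    rintro ⟨⟨c, d⟩, ⟨x, y⟩⟩ h
    rw [hT] at h
    obtain ⟨rfl, rfl, hx, hy⟩ := hind c d x x.2 y y.2 h
    simp_all
  obtain ⟨P, hP⟩ := T.exists_leftInverse_of_injective hker
  refine ⟨LinearMap.fst ℝ ℝ ℝ ∘ₗ LinearMap.fst ℝ _ _ ∘ₗ P ∘ₗ E,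
    LinearMap.snd ℝ ℝ ℝ ∘ₗ LinearMap.fst ℝ _ _ ∘ₗ P ∘ₗ E,
    K.subtype ∘ₗ LinearMap.fst ℝ _ _ ∘ₗ LinearMap.snd ℝ _ _ ∘ₗ P ∘ₗ E,
    K.subtype ∘ₗ LinearMap.snd ℝ _ _ ∘ₗ LinearMap.snd ℝ _ _ ∘ₗ P ∘ₗ E, ?_, ?_, ?_⟩
  · intro X; simp
  · intro X; simp
  · intro X hX
    obtain ⟨c, d, x, hx, y, hy, h⟩ := hE X hX
    have h2 : P (E X) = ((c, d), (⟨x, hx⟩, ⟨y, hy⟩)) := by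
      rw [h, ← hT c d ⟨x, hx⟩ ⟨y, hy⟩]
      exact LinearMap.congr_fun hP _
    change E X = (P (E X)).1.1 • v + (P (E X)).1.2 • J v + ((P (E X)).2.1 : V)
      + J ((P (E X)).2.2 : V)
    rw [h2]
    exact h

end LinearAlgebra

variable {J : g →ₗ[ℝ] g}

/-- The adjoint action of `J X`, for `X` central, is `J`-linear. -/
theorem map_lie_map_of_mem_acs_one
    (hN : ∀ X Y : g, ⁅X, Y⁆ + J ⁅J X, Y⁆ + J ⁅X, J Y⁆ - ⁅J X, J Y⁆ = 0)
    {X : g} (hX : X ∈ acs g 1) (Y : g) : ⁅J X, J Y⁆ = J ⁅J X, Y⁆ := by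
  have := hN X Y
  rw [mem_acs_one.1 hX, mem_acs_one.1 hX, map_zero, zero_add, add_zero, sub_eq_zero] at this
  exact this.symm

theorem lie_map_map_eq_zero
    (hN : ∀ X Y : g, ⁅X, Y⁆ + J ⁅J X, Y⁆ + J ⁅X, J Y⁆ - ⁅J X, J Y⁆ = 0)
    {X Y : g} (hX : X ∈ acs g 1) (hY : Y ∈ acs g 1) : ⁅J X, J Y⁆ = 0 := by
  rw [map_lie_map_of_mem_acs_one hN hX, lie_eq_zero_of_mem_acs_one hY, map_zero]

theorem eq_zero_of_mem_acs_one_of_map_mem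
    (hSnN : ∀ X : g, (∀ Z : g, ⁅X, Z⁆ = 0 ∧ ⁅J X, Z⁆ = 0) → X = 0)
    {X : g} (hX : X ∈ acs g 1) (hJX : J X ∈ acs g 1) : X = 0 :=
  hSnN X fun Z => ⟨hX Z, hJX Z⟩

/-- If `[J X, g]` lies in a totally real subspace and `X` is central, then `X = 0`. -/
theorem eq_zero_of_lie_map_mem_totally_real
    (hN : ∀ X Y : g, ⁅X, Y⁆ + J ⁅J X, Y⁆ + J ⁅X, J Y⁆ - ⁅J X, J Y⁆ = 0)
    (hSnN : ∀ X : g, (∀ Z : g, ⁅X, Z⁆ = 0 ∧ ⁅J X, Z⁆ = 0) → X = 0)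
    {R : Submodule ℝ g} (hR : ∀ Y ∈ R, J Y ∈ R → Y = 0)
    {X : g} (hX : X ∈ acs g 1) (h : ∀ Y, ⁅J X, Y⁆ ∈ R) : X = 0 :=
  hSnN X fun Y => ⟨hX Y, hR _ (h Y) (map_lie_map_of_mem_acs_one hN hX Y ▸ h (J Y))⟩

/-- `K + J K` is never an ideal for a nonzero central subspace `K`. -/
theorem eq_bot_of_sup_map_ideal (hnil : ∃ s : ℕ, acs g s = ⊤)
    (hN : ∀ X Y : g, ⁅X, Y⁆ + J ⁅J X, Y⁆ + J ⁅X, J Y⁆ - ⁅J X, J Y⁆ = 0)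
    (hSnN : ∀ X : g, (∀ Z : g, ⁅X, Z⁆ = 0 ∧ ⁅J X, Z⁆ = 0) → X = 0)
    {K : Submodule ℝ g} (hK : K ≤ acs g 1)
    (hid : ∀ X ∈ K, ∀ T, ⁅J X, T⁆ ∈ K ⊔ K.map J) : K = ⊥ := by
  have hle : K ⊔ K.map J ≤ acs g 1 := by
    by_contra hcon
    obtain ⟨Y, hY, hYZ, hY2⟩ := exists_mem_notMem_lie_mem hnil _ _ Set.univ (by
      intro Y hY T _
      obtain ⟨x, hx, y, hy, rfl⟩ := mem_sup_map.1 hY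
      rw [add_lie, mem_acs_one.1 (hK hx), zero_add]
      exact hid y hy T) hcon
    obtain ⟨x, hx, y, hy, rfl⟩ := mem_sup_map.1 hY
    have : y = 0 := by
      refine eq_zero_of_lie_map_mem_totally_real hN hSnN
        (fun X => eq_zero_of_mem_acs_one_of_map_mem hSnN) (hK hy) fun T => ?_
      have := hY2 T trivial
      rwa [add_lie, mem_acs_one.1 (hK hx), zero_add] at this
    subst this
    exact hYZ (by simpa using hK hx)
  rw [Submodule.eq_bot_iff]
  intro X hX
  exact eq_zero_of_mem_acs_one_of_map_mem hSnN (hK hX)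
    (hle (mem_sup_map.2 ⟨0, K.zero_mem, X, hX, by simp⟩))

/-- Components of the Jacobi identity for `J X`, `w`, `J w`, with `X` central. -/
theorem jacobi_components (hJ2 : ∀ X : g, J (J X) = -X)
    (hN : ∀ X Y : g, ⁅X, Y⁆ + J ⁅J X, Y⁆ + J ⁅X, J Y⁆ - ⁅J X, J Y⁆ = 0) {v w : g}
    (hind : ∀ c d : ℝ, ∀ x ∈ acs g 1, ∀ y ∈ acs g 1, c • v + d • J v + x + J y = 0 →
      c = 0 ∧ d = 0 ∧ x = 0 ∧ y = 0)
    (hw : ∃ c d : ℝ, ∃ x ∈ acs g 1, ∃ y ∈ acs g 1, ⁅w, J w⁆ = c • v + d • J v + x + J y)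
    {α β : g →ₗ[ℝ] ℝ} {a b : g →ₗ[ℝ] g} (ha : ∀ X, a X ∈ acs g 1) (hb : ∀ X, b X ∈ acs g 1)
    (hab : ∀ X ∈ acs g 1, ⁅J X, w⁆ = α X • v + β X • J v + a X + J (b X))
    {X : g} (hX : X ∈ acs g 1) (hXv : ⁅J X, v⁆ = 0)
    (hmem : α X • (⁅v, J w⁆ - ⁅J v, w⁆) + β X • (⁅J v, J w⁆ + ⁅v, w⁆) ∈ acs g 1) :
    α (a X) = -β (b X) ∧ β (a X) = α (b X) ∧
      a (a X) + b (b X) = α X • (⁅v, J w⁆ - ⁅J v, w⁆) + β X • (⁅J v, J w⁆ + ⁅v, w⁆) := by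
  have h0 : ⁅J X, ⁅w, J w⁆⁆ = 0 := by
    obtain ⟨c, d, x, hx, y, hy, h⟩ := hw
    rw [h]
    simp only [lie_add, lie_smul, hXv, map_lie_map_of_mem_acs_one hN hX v, map_zero, smul_zero,
      lie_eq_zero_of_mem_acs_one hx, lie_map_map_eq_zero hN hX hy, add_zero]
  rw [leibniz_lie, map_lie_map_of_mem_acs_one hN hX, hab X hX] at h0
  simp only [map_add, map_smul, hJ2, add_lie, smul_lie, lie_add, lie_smul, lie_neg,
    mem_acs_one.1 (ha X), lie_eq_zero_of_mem_acs_one (hb X),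
    map_lie_map_of_mem_acs_one hN (hb X)] at h0
  rw [← lie_skew w (J (a X)), ← lie_skew w (J v), ← lie_skew w v, hab _ (ha X),
    hab _ (hb X)] at h0
  simp only [map_add, map_smul, hJ2] at h0
  have h1 := hind (-(α (a X) + β (b X))) (α (b X) - β (a X))
    (-(a (a X) + b (b X)) + (α X • (⁅v, J w⁆ - ⁅J v, w⁆) + β X • (⁅J v, J w⁆ + ⁅v, w⁆)))
    ((acs g 1).add_mem ((acs g 1).neg_mem ((acs g 1).add_mem (ha _) (hb _))) hmem)
    (a (b X) - b (a X)) ((acs g 1).sub_mem (ha _) (hb _))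
    (by
      rw [← h0, map_sub]
      module)
  obtain ⟨h1, h2, h3, -⟩ := h1
  refine ⟨by linarith, by linarith, ?_⟩
  rw [neg_add_eq_zero] at h3
  exact h3

/-- If the `v`-components of `[J X, w]` span at most a real line, they determine `X`. -/
theorem eq_zero_of_components_proportional (hnil : ∃ s : ℕ, acs g s = ⊤)
    (hJ2 : ∀ X : g, J (J X) = -X)
    (hN : ∀ X Y : g, ⁅X, Y⁆ + J ⁅J X, Y⁆ + J ⁅X, J Y⁆ - ⁅J X, J Y⁆ = 0)
    (hSnN : ∀ X : g, (∀ Z : g, ⁅X, Z⁆ = 0 ∧ ⁅J X, Z⁆ = 0) → X = 0) {v w : g}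
    (hind : ∀ c d : ℝ, ∀ x ∈ acs g 1, ∀ y ∈ acs g 1, c • v + d • J v + x + J y = 0 →
      c = 0 ∧ d = 0 ∧ x = 0 ∧ y = 0)
    (htop : ∀ T : g, ∃ c d c' d' : ℝ, ∃ x ∈ acs g 1, ∃ y ∈ acs g 1,
      T = c • w + d • J w + (c' • v + d' • J v + x + J y))
    (hw : ∃ c d : ℝ, ∃ x ∈ acs g 1, ∃ y ∈ acs g 1, ⁅w, J w⁆ = c • v + d • J v + x + J y)
    {α β : g →ₗ[ℝ] ℝ} {a b : g →ₗ[ℝ] g} (ha : ∀ X, a X ∈ acs g 1) (hb : ∀ X, b X ∈ acs g 1)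
    (hab : ∀ X ∈ acs g 1, ⁅J X, w⁆ = α X • v + β X • J v + a X + J (b X))
    (hprop : ∀ X ∈ acs g 1, ∀ Y ∈ acs g 1, α X * β Y = α Y * β X)
    (hKv : ∀ X ∈ acs g 1, α X = 0 → β X = 0 → ⁅J X, v⁆ = 0)
    {X : g} (hX : X ∈ acs g 1) (hα : α X = 0) (hβ : β X = 0) : X = 0 := by
  have hbot := eq_bot_of_sup_map_ideal hnil hN hSnN
    (K := acs g 1 ⊓ (LinearMap.ker α ⊓ LinearMap.ker β)) inf_le_left (by
    rintro X ⟨hX, hα, hβ⟩ T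
    rw [SetLike.mem_coe, LinearMap.mem_ker] at hα hβ
    have hXv := hKv X hX hα hβ
    obtain ⟨h1, h2, -⟩ := jacobi_components hJ2 hN hind hw ha hb hab hX hXv
      (by simp [hα, hβ])
    have h3 := hprop _ (ha X) _ (hb X)
    have h4 : α (a X) = 0 ∧ α (b X) = 0 := by
      rw [h2, ← neg_eq_iff_eq_neg.2 h1] at h3
      constructor <;> nlinarith [sq_nonneg (α (a X)), sq_nonneg (α (b X))]
    have hmem : ⁅J X, w⁆ ∈ (acs g 1 ⊓ (LinearMap.ker α ⊓ LinearMap.ker β)) ⊔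
        (acs g 1 ⊓ (LinearMap.ker α ⊓ LinearMap.ker β)).map J :=
      mem_sup_map.2 ⟨a X, ⟨ha X, h4.1, by simp [h2, h4.2]⟩, b X,
        ⟨hb X, h4.2, by simp [← neg_eq_iff_eq_neg.2 h1, h4.1]⟩,
        by rw [hab X hX, hα, hβ]; module⟩
    obtain ⟨c, d, c', d', x, hx, y, hy, rfl⟩ := htop T
    simp only [lie_add, lie_smul, map_lie_map_of_mem_acs_one hN hX v,
      map_lie_map_of_mem_acs_one hN hX w, hXv, lie_eq_zero_of_mem_acs_one hx,
      lie_map_map_eq_zero hN hX hy, map_zero, smul_zero, add_zero]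
    exact Submodule.add_mem _ (Submodule.smul_mem _ _ hmem)
      (Submodule.smul_mem _ _ (map_mem_sup_map hJ2 hmem)))
  have : X ∈ acs g 1 ⊓ (LinearMap.ker α ⊓ LinearMap.ker β) := ⟨hX, hα, hβ⟩
  rwa [hbot, Submodule.mem_bot] at this

/-- If `v` and `J v` both lie in the second center, the `v`-components of `[J X, w]` cannot span
a real plane. -/
theorem components_proportional_of_second_center (hnil : ∃ s : ℕ, acs g s = ⊤)
    (hJ2 : ∀ X : g, J (J X) = -X)
    (hN : ∀ X Y : g, ⁅X, Y⁆ + J ⁅J X, Y⁆ + J ⁅X, J Y⁆ - ⁅J X, J Y⁆ = 0)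
    (hSnN : ∀ X : g, (∀ Z : g, ⁅X, Z⁆ = 0 ∧ ⁅J X, Z⁆ = 0) → X = 0) {v w : g}
    (hv : ∀ T, ⁅v, T⁆ ∈ acs g 1) (hJv : ∀ T, ⁅J v, T⁆ ∈ acs g 1)
    (hind : ∀ c d : ℝ, ∀ x ∈ acs g 1, ∀ y ∈ acs g 1, c • v + d • J v + x + J y = 0 →
      c = 0 ∧ d = 0 ∧ x = 0 ∧ y = 0)
    (htop : ∀ T : g, ∃ c d c' d' : ℝ, ∃ x ∈ acs g 1, ∃ y ∈ acs g 1,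
      T = c • w + d • J w + (c' • v + d' • J v + x + J y))
    (hwU : ∀ T, ∃ c d : ℝ, ∃ x ∈ acs g 1, ∃ y ∈ acs g 1, ⁅w, T⁆ = c • v + d • J v + x + J y)
    {α β : g →ₗ[ℝ] ℝ} {a b : g →ₗ[ℝ] g} (ha : ∀ X, a X ∈ acs g 1) (hb : ∀ X, b X ∈ acs g 1)
    (hab : ∀ X ∈ acs g 1, ⁅J X, w⁆ = α X • v + β X • J v + a X + J (b X))
    (hDv : ∀ X ∈ acs g 1, ⁅J X, v⁆ = 0) (hvJv : ⁅v, J v⁆ = 0)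
    (hs : ⁅J v, w⁆ = -⁅v, J w⁆) (ht : ⁅J v, J w⁆ = ⁅v, w⁆)
    {X Y : g} (hX : X ∈ acs g 1) (hY : Y ∈ acs g 1) : α X * β Y = α Y * β X := by
  have hcomp : ∀ X ∈ acs g 1, α (a X) = -β (b X) ∧ β (a X) = α (b X) ∧
      a (a X) + b (b X) = α X • (2 : ℝ) • ⁅v, J w⁆ + β X • (2 : ℝ) • ⁅v, w⁆ := by
    intro X hX
    obtain ⟨h1, h2, h3⟩ := jacobi_components hJ2 hN hind (hwU _) ha hb hab hX (hDv X hX)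
      (Submodule.add_mem _ (Submodule.smul_mem _ _ (Submodule.sub_mem _ (hv _) (hJv _)))
        (Submodule.smul_mem _ _ (Submodule.add_mem _ (hJv _) (hv _))))
    refine ⟨h1, h2, ?_⟩
    rw [h3, hs, ht]
    module
  have hqr : ¬ (⁅v, w⁆ = 0 ∧ ⁅v, J w⁆ = 0) := by
    rintro ⟨hq, hr⟩
    have hvZ : v ∈ acs g 1 := by
      refine mem_acs_one.2 fun T => ?_
      obtain ⟨c, d, c', d', x, hx, y, hy, rfl⟩ := htop T
      simp only [lie_add, lie_smul, hq, hr, hvJv, lie_self, lie_eq_zero_of_mem_acs_one hx,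
        smul_zero, add_zero, zero_add]
      rw [← lie_skew, hDv y hy, neg_zero]
    have := (hind 1 0 (-v) (neg_mem hvZ) 0 (zero_mem _) (by simp)).1
    exact one_ne_zero this
  set M : Submodule ℝ g := acs g 1 ⊓ (LinearMap.ker a ⊓ LinearMap.ker b) with hM
  have hMeq : ∀ X ∈ M, α X • ⁅v, J w⁆ + β X • ⁅v, w⁆ = 0 := by
    rintro X ⟨hX, hXa, hXb⟩
    rw [SetLike.mem_coe, LinearMap.mem_ker] at hXa hXb
    obtain ⟨-, -, h⟩ := hcomp X hX
    rw [hXa, hXb, map_zero, map_zero, add_zero] at h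
    linear_combination (norm := module) (-(1 / 2 : ℝ)) • h
  have hDw : ∀ X ∈ acs g 1, ⁅J X, w⁆ = 0 → X = 0 := by
    intro X hX h
    refine eq_zero_of_mem_acs_one_of_map_mem hSnN hX (mem_acs_one.2 fun T => ?_)
    obtain ⟨c, d, c', d', x, hx, y, hy, rfl⟩ := htop T
    simp only [lie_add, lie_smul, map_lie_map_of_mem_acs_one hN hX v,
      map_lie_map_of_mem_acs_one hN hX w, hDv X hX, h, lie_eq_zero_of_mem_acs_one hx,
      lie_map_map_eq_zero hN hX hy, map_zero, smul_zero, add_zero]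
  have hle : acs g 1 ≤ M := by
    by_contra hcon
    have hS : ¬ (acs g 1 ⊔ (acs g 1).map J) ⊔ Submodule.span ℝ {v, J v} ≤
        (acs g 1 ⊔ M.map J) ⊔ Submodule.span ℝ {v, J v} := by
      intro hle
      apply hcon
      intro X hX
      obtain ⟨c, d, x, hx, y, hy, h⟩ := mem_sup_map_sup_span_pair.1 (hle
        (mem_sup_map_sup_span_pair.2 ⟨0, 0, 0, zero_mem _, X, hX, rfl⟩))
      have := (hind c d x hx (y - X) (sub_mem hy.1 hX) (by
        rw [map_sub]; linear_combination (norm := module) (-1 : ℝ) • h)).2.2.2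
      rwa [← sub_eq_zero.1 this]
    obtain ⟨Y, hY, hYR, hYg⟩ := exists_mem_notMem_lie_mem hnil _ _ Set.univ (by
      intro Y hY T _
      obtain ⟨c, d, x, hx, y, hy, rfl⟩ := mem_sup_map_sup_span_pair.1 hY
      have hw : ⁅J y, w⁆ ∈ (acs g 1 ⊔ (acs g 1).map J) ⊔ Submodule.span ℝ {v, J v} := by
        rw [hab y hy]
        exact mem_sup_map_sup_span_pair.2 ⟨_, _, _, ha y, _, hb y, rfl⟩
      have hin : ⁅J y, T⁆ ∈ (acs g 1 ⊔ (acs g 1).map J) ⊔ Submodule.span ℝ {v, J v} := by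
        obtain ⟨c, d, c', d', x, hx, z, hz, rfl⟩ := htop T
        simp only [lie_add, lie_smul, map_lie_map_of_mem_acs_one hN hy v,
          map_lie_map_of_mem_acs_one hN hy w, hDv y hy, lie_eq_zero_of_mem_acs_one hx,
          lie_map_map_eq_zero hN hy hz, map_zero, smul_zero, add_zero]
        exact add_mem (Submodule.smul_mem _ _ hw) (Submodule.smul_mem _ _
          (map_mem_sup_span_pair hJ2 (fun _ => map_mem_sup_map hJ2) hw))
      rw [add_lie, add_lie, add_lie, smul_lie, smul_lie, mem_acs_one.1 hx, add_zero]
      exact add_mem (Submodule.mem_sup_left (Submodule.mem_sup_left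
        (add_mem (Submodule.smul_mem _ _ (hv T)) (Submodule.smul_mem _ _ (hJv T))))) hin) hS
    obtain ⟨c, d, x, hx, y, hy, rfl⟩ := mem_sup_map_sup_span_pair.1 hY
    have hyg : ∀ T, ⁅J y, T⁆ ∈ (acs g 1 ⊔ M.map J) ⊔ Submodule.span ℝ {v, J v} := by
      intro T
      have := hYg T trivial
      rw [add_lie, add_lie, add_lie, smul_lie, smul_lie, mem_acs_one.1 hx, add_zero] at this
      exact (Submodule.add_mem_iff_right _ (Submodule.mem_sup_left (Submodule.mem_sup_left
        (add_mem (Submodule.smul_mem _ _ (hv T)) (Submodule.smul_mem _ _ (hJv T)))))).1 this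
    have hbM : b y ∈ M := by
      obtain ⟨c, d, x, hx, z, hz, h⟩ := mem_sup_map_sup_span_pair.1 (hyg w)
      rw [hab y hy] at h
      have := (hind (α y - c) (β y - d) (a y - x) (sub_mem (ha y) hx) (b y - z)
        (sub_mem (hb y) hz.1) (by rw [map_sub]; linear_combination (norm := module) (1 : ℝ) • h)).2.2.2
      rwa [sub_eq_zero.1 this]
    have haM : a y ∈ M := by
      obtain ⟨c, d, x, hx, z, hz, h⟩ := mem_sup_map_sup_span_pair.1 (hyg (J w))
      rw [map_lie_map_of_mem_acs_one hN hy, hab y hy] at h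
      simp only [map_add, map_smul, hJ2] at h
      have := (hind (-β y - c) (α y - d) (-b y - x) (sub_mem (neg_mem (hb y)) hx) (a y - z)
        (sub_mem (ha y) hz.1) (by rw [map_sub]; linear_combination (norm := module) (1 : ℝ) • h)).2.2.2
      rwa [sub_eq_zero.1 this]
    obtain ⟨h1, h2, -⟩ := hcomp y hy
    have h3 := hMeq _ haM
    have h4 := hMeq _ hbM
    rw [h1, h2] at h3
    have hsq : α (b y) ^ 2 + β (b y) ^ 2 = 0 := by
      by_contra hne
      refine hqr ⟨?_, ?_⟩
      · refine (smul_eq_zero.1 (?_ : (α (b y) ^ 2 + β (b y) ^ 2) • ⁅v, w⁆ = 0)).resolve_left hne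
        linear_combination (norm := module) (α (b y)) • h3 + (β (b y)) • h4
      · refine (smul_eq_zero.1 (?_ : (α (b y) ^ 2 + β (b y) ^ 2) • ⁅v, J w⁆ = 0)).resolve_left hne
        linear_combination (norm := module) (-β (b y)) • h3 + (α (b y)) • h4
    have h5 : α (b y) = 0 := by nlinarith [sq_nonneg (α (b y)), sq_nonneg (β (b y))]
    have h6 : β (b y) = 0 := by nlinarith [sq_nonneg (α (b y)), sq_nonneg (β (b y))]
    have hzero : ∀ z ∈ M, α z = 0 → β z = 0 → z = 0 := by
      rintro z ⟨hz, hza, hzb⟩ hzα hzβ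
      rw [SetLike.mem_coe, LinearMap.mem_ker] at hza hzb
      exact hDw z hz (by simp [hab z hz, hza, hzb, hzα, hzβ])
    exact hYR (mem_sup_map_sup_span_pair.2 ⟨c, d, x, hx, y,
      ⟨hy, hzero _ haM (by rw [h1, h6, neg_zero]) (by rw [h2, h5]), hzero _ hbM h5 h6⟩, rfl⟩)
  by_contra hne
  have h1 := hMeq X (hle hX)
  have h2 := hMeq Y (hle hY)
  have hne' : α X * β Y - α Y * β X ≠ 0 := sub_ne_zero.2 hne
  refine hqr ⟨?_, ?_⟩
  · refine (smul_eq_zero.1 (?_ : (α X * β Y - α Y * β X) • ⁅v, w⁆ = 0)).resolve_left hne'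
    linear_combination (norm := module) (α X) • h2 - (α Y) • h1
  · refine (smul_eq_zero.1 (?_ : (α X * β Y - α Y * β X) • ⁅v, J w⁆ = 0)).resolve_left hne'
    linear_combination (norm := module) (β Y) • h1 - (β X) • h2

/-- If `v` lies in the second center and the abelian ideal `Z + J Z + ⟨v, J v⟩` contains `[w, g]`,
the `v`-components of `[J X, w]` cannot span a real plane. -/
theorem components_proportional (hnil : ∃ s : ℕ, acs g s = ⊤)
    (hJ2 : ∀ X : g, J (J X) = -X)
    (hN : ∀ X Y : g, ⁅X, Y⁆ + J ⁅J X, Y⁆ + J ⁅X, J Y⁆ - ⁅J X, J Y⁆ = 0)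
    (hSnN : ∀ X : g, (∀ Z : g, ⁅X, Z⁆ = 0 ∧ ⁅J X, Z⁆ = 0) → X = 0) {v w : g}
    (hv : ∀ T, ⁅v, T⁆ ∈ acs g 1)
    (hind : ∀ c d : ℝ, ∀ x ∈ acs g 1, ∀ y ∈ acs g 1, c • v + d • J v + x + J y = 0 →
      c = 0 ∧ d = 0 ∧ x = 0 ∧ y = 0)
    (htop : ∀ T : g, ∃ c d c' d' : ℝ, ∃ x ∈ acs g 1, ∃ y ∈ acs g 1,
      T = c • w + d • J w + (c' • v + d' • J v + x + J y))
    (hwU : ∀ T, ∃ c d : ℝ, ∃ x ∈ acs g 1, ∃ y ∈ acs g 1, ⁅w, T⁆ = c • v + d • J v + x + J y)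
    (hU : ∀ Y ∈ (acs g 1 ⊔ (acs g 1).map J) ⊔ Submodule.span ℝ {v, J v}, ∀ T,
      ⁅Y, T⁆ ∈ (acs g 1 ⊔ (acs g 1).map J) ⊔ Submodule.span ℝ {v, J v})
    {α β : g →ₗ[ℝ] ℝ} {a b : g →ₗ[ℝ] g} (ha : ∀ X, a X ∈ acs g 1) (hb : ∀ X, b X ∈ acs g 1)
    (hab : ∀ X ∈ acs g 1, ⁅J X, w⁆ = α X • v + β X • J v + a X + J (b X))
    (hDv : ∀ X ∈ acs g 1, ⁅J X, v⁆ = 0) (hvJv : ⁅v, J v⁆ = 0)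
    {X Y : g} (hX : X ∈ acs g 1) (hY : Y ∈ acs g 1) : α X * β Y = α Y * β X := by
  have hR : ∀ Y ∈ acs g 1 ⊔ Submodule.span ℝ {v, (0 : g)},
      J Y ∈ acs g 1 ⊔ Submodule.span ℝ {v, (0 : g)} → Y = 0 := by
    intro Y hY hJY
    obtain ⟨x, hx, c, _, rfl⟩ := mem_sup_span_pair.1 hY
    obtain ⟨x', hx', c', _, h⟩ := mem_sup_span_pair.1 hJY
    simp only [smul_zero, add_zero, map_add, map_smul] at h ⊢
    obtain ⟨-, rfl, -, rfl⟩ := hind (-c') c (-x') (neg_mem hx') x hx (by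
      linear_combination (norm := module) (1 : ℝ) • h)
    simp
  have hS : ¬ (acs g 1 ⊔ (acs g 1).map J) ⊔ Submodule.span ℝ {v, J v} ≤
      acs g 1 ⊔ Submodule.span ℝ {v, (0 : g)} := by
    intro hle
    have h1 : v ∈ acs g 1 ⊔ Submodule.span ℝ {v, (0 : g)} :=
      mem_sup_span_pair.2 ⟨0, zero_mem _, 1, 0, by simp⟩
    have h2 : J v ∈ (acs g 1 ⊔ (acs g 1).map J) ⊔ Submodule.span ℝ {v, J v} :=
      mem_sup_span_pair.2 ⟨0, zero_mem _, 0, 1, by simp⟩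
    exact one_ne_zero (hind 1 0 0 (zero_mem _) 0 (zero_mem _)
      (by simp [hR v h1 (hle h2)])).1
  obtain ⟨Y₀, hY₀, hYR, hYg⟩ := exists_mem_notMem_lie_mem hnil _ _ Set.univ
    (fun Y hY T _ => hU Y hY T) hS
  obtain ⟨c, d, x, hx, y, hy, rfl⟩ := mem_sup_map_sup_span_pair.1 hY₀
  have hJ : ∀ T, d • ⁅J v, T⁆ + ⁅J y, T⁆ ∈ acs g 1 ⊔ Submodule.span ℝ {v, (0 : g)} := by
    intro T
    have h1 := hYg T trivial
    have h2 : c • ⁅v, T⁆ ∈ acs g 1 ⊔ Submodule.span ℝ {v, (0 : g)} :=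
      Submodule.mem_sup_left (Submodule.smul_mem _ _ (hv T))
    rw [add_lie, add_lie, add_lie, smul_lie, smul_lie, mem_acs_one.1 hx] at h1
    convert sub_mem h1 h2 using 1
    abel
  have hd : d ≠ 0 := by
    rintro rfl
    have hy0 : y = 0 := eq_zero_of_lie_map_mem_totally_real hN hSnN hR hy fun T => by
      simpa using hJ T
    subst hy0
    exact hYR (mem_sup_span_pair.2 ⟨x, hx, c, 0, by simp⟩)
  set X₀ := d⁻¹ • y with hX₀
  have hX₀Z : X₀ ∈ acs g 1 := Submodule.smul_mem _ _ hy
  have hv' : ∀ T : g, ⁅v + X₀, T⁆ = ⁅v, T⁆ := fun T => by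
    rw [add_lie, mem_acs_one.1 hX₀Z, add_zero]
  have hJ' : ∀ T : g, ⁅J (v + X₀), T⁆ ∈ acs g 1 ⊔ Submodule.span ℝ {v, (0 : g)} := by
    intro T
    convert Submodule.smul_mem _ d⁻¹ (hJ T) using 1
    rw [smul_add, smul_smul, inv_mul_cancel₀ hd, one_smul, hX₀, map_add, map_smul, add_lie,
      smul_lie]
  have hvR : ∀ T, ⁅v, T⁆ ∈ acs g 1 ⊔ Submodule.span ℝ {v, (0 : g)} :=
    fun T => Submodule.mem_sup_left (hv T)
  have hs : ⁅J (v + X₀), w⁆ = -⁅v + X₀, J w⁆ := by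
    rw [eq_neg_iff_add_eq_zero, hv']
    refine hR _ (add_mem (hJ' w) (hvR _)) ?_
    have h1 := hN (v + X₀) w
    rw [hv', hv'] at h1
    convert sub_mem (hJ' (J w)) (hvR w) using 1
    rw [map_add]
    linear_combination (norm := module) (1 : ℝ) • h1
  have ht : ⁅J (v + X₀), J w⁆ = ⁅v + X₀, w⁆ := by
    have h1 := hN (v + X₀) w
    rw [hs, map_neg] at h1
    linear_combination (norm := module) (-1 : ℝ) • h1
  have hvJ : ∀ x ∈ acs g 1, ⁅v, J x⁆ = 0 := fun x hx => by
    rw [← lie_skew, hDv x hx, neg_zero]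
  have hJv0 : ⁅J (v + X₀), v⁆ = 0 := by
    rw [map_add, add_lie, hDv _ hX₀Z, add_zero, ← lie_skew, hvJv, neg_zero]
  have hcoord : ∀ c d : ℝ, ∀ x ∈ acs g 1, ∀ y ∈ acs g 1,
      ∃ x' ∈ acs g 1, ∃ y' ∈ acs g 1, c • v + d • J v + x + J y =
        c • (v + X₀) + d • J (v + X₀) + x' + J y' := by
    intro c d x hx y hy
    refine ⟨x - c • X₀, sub_mem hx (Submodule.smul_mem _ _ hX₀Z), y - d • X₀,
      sub_mem hy (Submodule.smul_mem _ _ hX₀Z), ?_⟩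
    simp only [map_add, map_sub, map_smul]
    module
  have htop' : ∀ T : g, ∃ c d c' d' : ℝ, ∃ x ∈ acs g 1, ∃ y ∈ acs g 1,
      T = c • w + d • J w + (c' • (v + X₀) + d' • J (v + X₀) + x + J y) := by
    intro T
    obtain ⟨c, d, c', d', x, hx, y, hy, rfl⟩ := htop T
    obtain ⟨x', hx', y', hy', h⟩ := hcoord c' d' x hx y hy
    exact ⟨c, d, c', d', x', hx', y', hy', by rw [h]⟩
  refine components_proportional_of_second_center (v := v + X₀) (w := w)
    (a := a - α.smulRight X₀) (b := b - β.smulRight X₀) hnil hJ2 hN hSnN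
    (fun T => hv' T ▸ hv T) ?_ ?_ htop' ?_ ?_ ?_ ?_ ?_ ?_ hs ht hX hY
  · intro T
    obtain ⟨c, d, c', d', x, hx, y, hy, rfl⟩ := htop' T
    have h1 : ⁅J (v + X₀), J y⁆ = 0 := by
      rw [map_add, add_lie, lie_map_map_eq_zero hN hX₀Z hy, add_zero, ← lie_skew,
        map_lie_map_of_mem_acs_one hN hy, hDv y hy, map_zero, neg_zero]
    simp only [lie_add, lie_smul, hJv0, hs, ht, lie_self, lie_eq_zero_of_mem_acs_one hx, h1,
      lie_eq_zero_of_mem_acs_one hX₀Z, smul_zero, add_zero, hv']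
    exact add_mem (Submodule.smul_mem _ _ (neg_mem (hv _))) (Submodule.smul_mem _ _ (hv _))
  · intro c d x hx y hy h
    obtain ⟨rfl, rfl, h1, h2⟩ := hind c d (x + c • X₀)
      (add_mem hx (Submodule.smul_mem _ _ hX₀Z)) (y + d • X₀)
      (add_mem hy (Submodule.smul_mem _ _ hX₀Z)) (by
        rw [← h]
        simp only [map_add, map_smul]
        module)
    exact ⟨rfl, rfl, by simpa using h1, by simpa using h2⟩
  · intro T
    obtain ⟨c, d, x, hx, y, hy, h⟩ := hwU T
    obtain ⟨x', hx', y', hy', h'⟩ := hcoord c d x hx y hy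
    exact ⟨c, d, x', hx', y', hy', by rw [h, h']⟩
  · exact fun X => sub_mem (ha X) (Submodule.smul_mem _ _ hX₀Z)
  · exact fun X => sub_mem (hb X) (Submodule.smul_mem _ _ hX₀Z)
  · intro X hX
    simp only [hab X hX, LinearMap.sub_apply, LinearMap.smulRight_apply, map_add, map_sub,
      map_smul]
    module
  · intro X hX
    rw [lie_add, hDv X hX, lie_eq_zero_of_mem_acs_one hX₀Z, add_zero]
  · rw [hv', map_add, lie_add, hvJv, hvJ X₀ hX₀Z, add_zero]

/-- If the center has dimension at least two, its complexification has complex codimension at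
least three. -/
theorem two_mul_finrank_center_add_four_lt [FiniteDimensional ℝ g]
    (hnil : ∃ s : ℕ, acs g s = ⊤)
    (hJ2 : ∀ X : g, J (J X) = -X)
    (hN : ∀ X Y : g, ⁅X, Y⁆ + J ⁅J X, Y⁆ + J ⁅X, J Y⁆ - ⁅J X, J Y⁆ = 0)
    (hSnN : ∀ X : g, (∀ Z : g, ⁅X, Z⁆ = 0 ∧ ⁅J X, Z⁆ = 0) → X = 0)
    (h2 : 2 ≤ Module.finrank ℝ (acs g 1)) :
    2 * Module.finrank ℝ (acs g 1) + 4 < Module.finrank ℝ g := by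
  by_contra! hdim
  have hdis : ∀ X ∈ acs g 1, J X ∈ acs g 1 → X = 0 := fun X =>
    eq_zero_of_mem_acs_one_of_map_mem hSnN
  have hne : acs g 1 ≠ ⊥ := by
    intro h
    rw [h, finrank_bot] at h2
    omega
  set W : Submodule ℝ g := acs g 1 ⊔ (acs g 1).map J with hW
  have hWJ : ∀ Y ∈ W, J Y ∈ W := fun _ => map_mem_sup_map hJ2
  have hZW : acs g 1 ≤ W := le_sup_left
  have hnotid : ¬ ∀ X ∈ acs g 1, ∀ T, ⁅J X, T⁆ ∈ W := fun h =>
    hne (eq_bot_of_sup_map_ideal hnil hN hSnN le_rfl h)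
  obtain ⟨v, -, hvZ, hv⟩ : ∃ v ∈ (⊤ : Submodule ℝ g), v ∉ acs g 1 ∧
      ∀ T ∈ Set.univ, ⁅v, T⁆ ∈ acs g 1 := by
    refine exists_mem_notMem_lie_mem hnil ⊤ _ Set.univ (fun _ _ _ _ => trivial) fun h => hne ?_
    rw [Submodule.eq_bot_iff]
    exact fun X hX => hdis X hX (h trivial)
  replace hv : ∀ T, ⁅v, T⁆ ∈ acs g 1 := fun T => hv T trivial
  have hvW : v ∉ W := by
    intro h
    obtain ⟨x, hx, y, hy, rfl⟩ := mem_sup_map.1 h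
    have hy0 : y = 0 := by
      refine eq_zero_of_lie_map_mem_totally_real hN hSnN hdis hy fun T => ?_
      simpa [mem_acs_one.1 hx] using hv T
    subst hy0
    exact hvZ (by simpa using hx)
  have hind : ∀ c d : ℝ, ∀ x ∈ acs g 1, ∀ y ∈ acs g 1, c • v + d • J v + x + J y = 0 →
      c = 0 ∧ d = 0 ∧ x = 0 ∧ y = 0 := by
    intro c d x hx y hy h
    have hmem : c • v + d • J v ∈ W := by
      have : c • v + d • J v = -(x + J y) := by linear_combination (norm := module) (1 : ℝ) • h
      rw [this]
      exact neg_mem (mem_sup_map.2 ⟨x, hx, y, hy, rfl⟩)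
    obtain ⟨rfl, rfl⟩ := eq_zero_of_smul_add_smul_mem hJ2 hWJ hvW hmem
    rw [zero_smul, zero_smul, add_zero, zero_add] at h
    have hy0 : y = 0 := hdis y hy (by
      rw [← neg_eq_of_add_eq_zero_right h]
      exact neg_mem hx)
    subst hy0
    exact ⟨rfl, rfl, by simpa using h, rfl⟩
  have hvT : ∀ T, ⁅T, v⁆ ∈ acs g 1 := fun T => by
    rw [← lie_skew]
    exact neg_mem (hv T)
  set U : Submodule ℝ g := W ⊔ Submodule.span ℝ {v, J v} with hU
  have hUJ : ∀ Y ∈ U, J Y ∈ U := fun _ => map_mem_sup_span_pair hJ2 hWJ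
  have hWU : W ≤ U := le_sup_left
  have hmemU : ∀ {Y}, Y ∈ U ↔ ∃ c d : ℝ, ∃ x ∈ acs g 1, ∃ y ∈ acs g 1,
      Y = c • v + d • J v + x + J y := mem_sup_map_sup_span_pair
  have hZU : ∀ X ∈ acs g 1, ∀ Y ∈ U, ⁅J X, Y⁆ ∈ W := by
    intro X hX Y hY
    obtain ⟨c, d, x, hx, y, hy, rfl⟩ := hmemU.1 hY
    simp only [lie_add, lie_smul, map_lie_map_of_mem_acs_one hN hX v,
      lie_eq_zero_of_mem_acs_one hx, lie_map_map_eq_zero hN hX hy, add_zero]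
    exact add_mem (Submodule.smul_mem _ _ (hZW (hvT _)))
      (Submodule.smul_mem _ _ (hWJ _ (hZW (hvT _))))
  have hUtop : ¬ ⊤ ≤ U := fun h => hnotid fun X hX T => hZU X hX T (h trivial)
  have hspan : ∀ w ∉ U, ∀ T, ∃ x ∈ U, ∃ c d : ℝ, T = c • w + d • J w + x := by
    intro w hw T
    refine mem_sup_span_pair.1 ?_
    have hfr := finrank_sup_span_pair hJ2 hUJ hw
    rw [finrank_sup_span_pair hJ2 hWJ hvW, finrank_sup_map hJ2 hdis] at hfr
    have hle := Submodule.finrank_le (U ⊔ Submodule.span ℝ {w, J w})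
    rw [Submodule.eq_top_of_finrank_eq (by omega :
      Module.finrank ℝ ↥(U ⊔ Submodule.span ℝ {w, J w}) = Module.finrank ℝ g)]
    trivial
  have hUU : ∀ Y ∈ U, ∀ T ∈ U, ⁅Y, T⁆ ∈ U := by
    intro Y hY T hT
    obtain ⟨c, d, x, hx, y, hy, rfl⟩ := hmemU.1 hY
    have hJv : ⁅J v, T⁆ ∈ U := by
      obtain ⟨c, d, x, hx, y, hy, rfl⟩ := hmemU.1 hT
      simp only [lie_add, lie_smul, lie_self, lie_eq_zero_of_mem_acs_one hx, smul_zero, add_zero]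
      refine add_mem (Submodule.smul_mem _ _ (hWU (hZW (hvT _)))) ?_
      rw [← lie_skew]
      exact neg_mem (hWU (hZU y hy _ (hUJ _ (hmemU.2 ⟨1, 0, 0, zero_mem _, 0, zero_mem _,
        by simp⟩))))
    simp only [add_lie, smul_lie, mem_acs_one.1 hx, add_zero]
    exact add_mem (add_mem (Submodule.smul_mem _ _ (hWU (hZW (hv T))))
      (Submodule.smul_mem _ _ hJv)) (hWU (hZU y hy T hT))
  have hideal : ∀ Y ∈ U, ∀ T, ⁅Y, T⁆ ∈ U := by
    obtain ⟨w, -, hwU, hw⟩ := exists_mem_notMem_lie_mem hnil ⊤ U U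
      (fun _ _ _ _ => trivial) hUtop
    have hvU : v ∈ U := hmemU.2 ⟨1, 0, 0, zero_mem _, 0, zero_mem _, by simp⟩
    have hJw : ∀ Y ∈ U, ⁅J w, Y⁆ ∈ U := by
      intro Y hY
      obtain ⟨c, d, x, hx, y, hy, rfl⟩ := hmemU.1 hY
      have h1 : ⁅J w, J v⁆ ∈ U := by
        rw [← sub_eq_zero.1 (hN w v)]
        exact add_mem (add_mem (hw v hvU) (hUJ _ (hWU (hZW (hvT _)))))
          (hUJ _ (hw _ (hUJ _ hvU)))
      have h3 : ⁅J w, J y⁆ ∈ U := by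
        rw [← lie_skew, map_lie_map_of_mem_acs_one hN hy, ← lie_skew, map_neg, neg_neg]
        exact hUJ _ (hw _ (hUJ _ (hWU (hZW hy))))
      simp only [lie_add, lie_smul, lie_eq_zero_of_mem_acs_one hx, add_zero]
      exact add_mem (add_mem (Submodule.smul_mem _ _ (hWU (hZW (hvT _))))
        (Submodule.smul_mem _ _ h1)) h3
    intro Y hY T
    obtain ⟨x, hx, c, d, rfl⟩ := hspan w hwU T
    rw [← lie_skew]
    simp only [add_lie, smul_lie]
    exact neg_mem (add_mem (add_mem (Submodule.smul_mem _ _ (hw Y hY))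
      (Submodule.smul_mem _ _ (hJw Y hY))) (hUU x hx Y hY))
  obtain ⟨w, -, hwU, hw⟩ := exists_mem_notMem_lie_mem hnil ⊤ U Set.univ
    (fun _ _ _ _ => trivial) hUtop
  have hwU' : ∀ T, ∃ c d : ℝ, ∃ x ∈ acs g 1, ∃ y ∈ acs g 1,
      ⁅w, T⁆ = c • v + d • J v + x + J y := fun T => hmemU.1 (hw T trivial)
  have htop : ∀ T : g, ∃ c d c' d' : ℝ, ∃ x ∈ acs g 1, ∃ y ∈ acs g 1,
      T = c • w + d • J w + (c' • v + d' • J v + x + J y) := by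
    intro T
    obtain ⟨_, hu, c, d, rfl⟩ := hspan w hwU T
    obtain ⟨c', d', x, hx, y, hy, rfl⟩ := hmemU.1 hu
    exact ⟨c, d, c', d', x, hx, y, hy, rfl⟩
  obtain ⟨α, β, a, b, ha, hb, hab⟩ := exists_coordinates hind
    ((-LieAlgebra.ad ℝ g w : Module.End ℝ g) ∘ₗ J) (fun X _ => by
      simpa using hmemU.1 (neg_mem (hw (J X) trivial)))
  replace hab : ∀ X ∈ acs g 1, ⁅J X, w⁆ = α X • v + β X • J v + a X + J (b X) := by
    intro X hX
    rw [← hab X hX]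
    simp
  obtain ⟨X₀, hX₀, hX₀0⟩ : ∃ X ∈ acs g 1, ¬ (α X = 0 ∧ β X = 0) := by
    by_contra! hcon
    refine hnotid fun X hX T => ?_
    have hXw : ⁅J X, w⁆ ∈ W := mem_sup_map.2 ⟨a X, ha X, b X, hb X, by
      rw [hab X hX, (hcon X hX).1, (hcon X hX).2]
      module⟩
    obtain ⟨u, hu, c, d, rfl⟩ := hspan w hwU T
    simp only [lie_add, lie_smul, map_lie_map_of_mem_acs_one hN hX w]
    exact add_mem (add_mem (Submodule.smul_mem _ _ hXw) (Submodule.smul_mem _ _ (hWJ _ hXw)))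
      (hZU X hX u hu)
  have hcomm : ∀ X ∈ acs g 1, ∀ Y ∈ acs g 1,
      α X • ⁅J Y, v⁆ = α Y • ⁅J X, v⁆ ∧ β X • ⁅J Y, v⁆ = β Y • ⁅J X, v⁆ := by
    intro X hX Y hY
    have h1 := leibniz_lie (J X) (J Y) w
    rw [lie_map_map_eq_zero hN hX hY, zero_lie, zero_add, hab X hX, hab Y hY] at h1
    simp only [lie_add, lie_smul, map_lie_map_of_mem_acs_one hN hX v,
      map_lie_map_of_mem_acs_one hN hY v, lie_eq_zero_of_mem_acs_one (ha _),
      lie_map_map_eq_zero hN hX (hb _), lie_map_map_eq_zero hN hY (hb _), add_zero] at h1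
    obtain ⟨-, -, h3, h4⟩ := hind 0 0 (α X • ⁅J Y, v⁆ - α Y • ⁅J X, v⁆)
      (sub_mem (Submodule.smul_mem _ _ (hvT _)) (Submodule.smul_mem _ _ (hvT _)))
      (β X • ⁅J Y, v⁆ - β Y • ⁅J X, v⁆)
      (sub_mem (Submodule.smul_mem _ _ (hvT _)) (Submodule.smul_mem _ _ (hvT _))) (by
        simp only [map_sub, map_smul]
        linear_combination (norm := module) (-1 : ℝ) • h1)
    exact ⟨sub_eq_zero.1 h3, sub_eq_zero.1 h4⟩
  by_cases hprop : ∀ X ∈ acs g 1, ∀ Y ∈ acs g 1, α X * β Y = α Y * β X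
  · have hK : ∀ X ∈ acs g 1, α X = 0 → β X = 0 → X = 0 := by
      intro X hX
      refine eq_zero_of_components_proportional hnil hJ2 hN hSnN hind htop (hwU' _) ha hb hab
        hprop (fun X hX hα hβ => ?_) hX
      obtain ⟨h1, h3⟩ := hcomm X hX X₀ hX₀
      rw [hα, zero_smul, eq_comm, smul_eq_zero] at h1
      rw [hβ, zero_smul, eq_comm, smul_eq_zero] at h3
      tauto
    have hle : acs g 1 ≤ Submodule.span ℝ {X₀} := by
      intro Y hY
      have h1 : ∀ c d : ℝ, c ≠ 0 → c • Y - d • X₀ = 0 → Y ∈ Submodule.span ℝ {X₀} := by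
        intro c d hc h
        refine (Submodule.smul_mem_iff _ hc).1 ?_
        rw [sub_eq_zero.1 h]
        exact Submodule.smul_mem _ _ (Submodule.mem_span_singleton_self X₀)
      have h3 := hprop X₀ hX₀ Y hY
      have h4 : ∀ c d : ℝ, c • Y - d • X₀ ∈ acs g 1 := fun c d =>
        sub_mem (Submodule.smul_mem _ _ hY) (Submodule.smul_mem _ _ hX₀)
      by_cases hα : α X₀ = 0
      · refine h1 (β X₀) (β Y) (fun hβ => hX₀0 ⟨hα, hβ⟩) (hK _ (h4 _ _) ?_ ?_) <;>
          simp only [map_sub, map_smul, smul_eq_mul] <;> linarith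
      · refine h1 (α X₀) (α Y) hα (hK _ (h4 _ _) ?_ ?_) <;>
          simp only [map_sub, map_smul, smul_eq_mul] <;> linarith
    have := (Submodule.finrank_mono hle).trans (finrank_span_le_card ({X₀} : Set g))
    rw [Set.toFinset_singleton, Finset.card_singleton] at this
    omega
  · push Not at hprop
    obtain ⟨X, hX, Y, hY, hXY⟩ := hprop
    have hXv : ∀ X ∈ acs g 1, ∀ Y ∈ acs g 1, α X * β Y ≠ α Y * β X → ⁅J X, v⁆ = 0 := by
      intro X hX Y hY hXY
      obtain ⟨h1, h3⟩ := hcomm X hX Y hY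
      refine (smul_eq_zero.1 (?_ : (α X * β Y - α Y * β X) • ⁅J X, v⁆ = 0)).resolve_left
        (sub_ne_zero.2 hXY)
      linear_combination (norm := module) (β X) • h1 - (α X) • h3
    have hDX := hXv X hX Y hY hXY
    have hDv : ∀ T ∈ acs g 1, ⁅J T, v⁆ = 0 := by
      intro T hT
      obtain ⟨h1, h3⟩ := hcomm X hX T hT
      rw [hDX, smul_zero, smul_eq_zero] at h1 h3
      by_contra hne
      rw [h1.resolve_right hne, h3.resolve_right hne] at hXY
      simp at hXY
    have hp : ∀ X ∈ acs g 1, β X • ⁅v, J v⁆ = 0 := by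
      intro X hX
      have h1 := leibniz_lie (J X) v w
      rw [lie_eq_zero_of_mem_acs_one (hv w), hDv X hX, zero_lie, zero_add, hab X hX] at h1
      simp only [lie_add, lie_smul, lie_self, smul_zero, zero_add,
        lie_eq_zero_of_mem_acs_one (ha X)] at h1
      rw [← lie_skew v (J (b X)), hDv _ (hb X), neg_zero, add_zero, add_zero] at h1
      exact h1.symm
    have hvJv : ⁅v, J v⁆ = 0 := by
      by_contra hne
      rw [(smul_eq_zero.1 (hp X hX)).resolve_right hne,
        (smul_eq_zero.1 (hp Y hY)).resolve_right hne] at hXY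
      simp at hXY
    exact hXY (components_proportional hnil hJ2 hN hSnN hv hind htop hwU' hideal ha hb hab hDv
      hvJv hX hY)

end StronglyNonNilpotent

/-- for a `2n`-dimensional nilpotent Lie algebra with `n ≥ 4`
endowed with a strongly non-nilpotent complex structure,
`1 ≤ dim Z(g) ≤ n - 3` (here `Z(g) = acs g 1`). -/
theorem snn_center_dim_bound (g : Type*) [LieRing g] [LieAlgebra ℝ g]
    [FiniteDimensional ℝ g] (n : ℕ) (hn : 4 ≤ n)
    (hdim : Module.finrank ℝ g = 2 * n)
    (hnil : ∃ s : ℕ, acs g s = ⊤)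
    (J : g →ₗ[ℝ] g) (hJ2 : ∀ X : g, J (J X) = -X)
    (hN : ∀ X Y : g, ⁅X, Y⁆ + J ⁅J X, Y⁆ + J ⁅X, J Y⁆ - ⁅J X, J Y⁆ = 0)
    (hSnN : ∀ X : g, (∀ Z : g, ⁅X, Z⁆ = 0 ∧ ⁅J X, Z⁆ = 0) → X = 0) :
    1 ≤ Module.finrank ℝ (acs g 1) ∧ Module.finrank ℝ (acs g 1) ≤ n - 3 := by
  constructor
  · rw [Nat.one_le_iff_ne_zero, Ne, Submodule.finrank_eq_zero]
    intro h
    obtain ⟨Y, -, hY0, hY⟩ := exists_mem_notMem_lie_mem hnil ⊤ ⊥ Set.univ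
      (fun _ _ _ _ => trivial) (fun hle => by
        have := finrank_top ℝ g
        rw [le_bot_iff.1 hle, finrank_bot] at this
        omega)
    have hYZ : Y ∈ acs g 1 := mem_acs_one.2 fun T => hY T trivial
    rw [h] at hYZ
    exact hY0 hYZ
  · by_contra! hcon
    have := two_mul_finrank_center_add_four_lt hnil hJ2 hN hSnN (by omega)
    omega
end

section
/- Any nilpotent Lie algebra of dimension 8 admitting a strongly non-nilpotent complex structure has a 1-dimensional center. -/
namespace StronglyNonNilpotent

variable {g : Type*} [LieRing g] [LieAlgebra ℝ g]

/-- A strongly non-nilpotent complex structure on a nilpotent Lie algebra. -/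
structure IsSnN (J : g →ₗ[ℝ] g) : Prop where
  nil : ∃ s : ℕ, acs g s = ⊤
  sq : ∀ X : g, J (J X) = -X
  nij : ∀ X Y : g, ⁅X, Y⁆ + J ⁅J X, Y⁆ + J ⁅X, J Y⁆ - ⁅J X, J Y⁆ = 0
  snn : ∀ X : g, (∀ Z : g, ⁅X, Z⁆ = 0 ∧ ⁅J X, Z⁆ = 0) → X = 0

theorem mem_acs_one {X : g} : X ∈ acs g 1 ↔ ∀ Y : g, ⁅X, Y⁆ = 0 := Iff.rfl

theorem mem_acs_two {X : g} : X ∈ acs g 2 ↔ ∀ Y : g, ⁅X, Y⁆ ∈ acs g 1 := Iff.rfl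

theorem acs_one_le_two {X : g} (hX : X ∈ acs g 1) : X ∈ acs g 2 := fun Y => by
  rw [mem_acs_one.1 hX Y]; exact zero_mem _

/-- A form of Engel's theorem for nilpotent Lie algebras: if `V` is stable under bracketing with
`S` and is not contained in `U`, then some element of `V` outside `U` is sent into `U` by every
element of `S`. -/
theorem exists_lie_mem_of_not_subset (hnil : ∃ s : ℕ, acs g s = ⊤) (S V U : Set g)
    (h0 : (0 : g) ∈ U) (hV : ∀ v ∈ V, ∀ s ∈ S, ⁅v, s⁆ ∈ V) (hVU : ∃ v ∈ V, v ∉ U) :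
    ∃ v ∈ V, v ∉ U ∧ ∀ s ∈ S, ⁅v, s⁆ ∈ U := by
  classical
  have hex : ∃ k, ∃ v ∈ V, v ∉ U ∧ v ∈ acs g k := by
    obtain ⟨s, hs⟩ := hnil
    obtain ⟨v, hv, hvU⟩ := hVU
    exact ⟨s, v, hv, hvU, hs ▸ Submodule.mem_top⟩
  obtain ⟨v, hv, hvU, hvk⟩ := Nat.find_spec hex
  refine ⟨v, hv, hvU, fun s hs => ?_⟩
  by_contra hcon
  rcases hk : Nat.find hex with _ | k
  · rw [hk] at hvk
    have : v = 0 := hvk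
    exact hvU (this ▸ h0)
  · rw [hk] at hvk
    exact Nat.find_min hex (m := k) (by omega) ⟨_, hV v hv s hs, hcon, hvk s⟩

/-- The smallest `J`-invariant subspace containing the center and `F`. -/
def hull (J : g →ₗ[ℝ] g) (F : g) : Submodule ℝ g where
  carrier := {v | ∃ a ∈ acs g 1, ∃ b ∈ acs g 1, ∃ p q : ℝ, v = a + J b + p • F + q • J F}
  zero_mem' := ⟨0, zero_mem _, 0, zero_mem _, 0, 0, by simp⟩
  add_mem' := by
    rintro _ _ ⟨a, ha, b, hb, p, q, rfl⟩ ⟨a', ha', b', hb', p', q', rfl⟩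
    exact ⟨a + a', add_mem ha ha', b + b', add_mem hb hb', p + p', q + q', by
      rw [map_add]; module⟩
  smul_mem' := by
    rintro c _ ⟨a, ha, b, hb, p, q, rfl⟩
    exact ⟨c • a, Submodule.smul_mem _ _ ha, c • b, Submodule.smul_mem _ _ hb, c * p, c * q, by
      rw [map_smul]; module⟩

theorem mem_hull {J : g →ₗ[ℝ] g} {F v : g} : v ∈ hull J F ↔
    ∃ a ∈ acs g 1, ∃ b ∈ acs g 1, ∃ p q : ℝ, v = a + J b + p • F + q • J F := Iff.rfl

theorem mem_hull_zero {J : g →ₗ[ℝ] g} {v : g} : v ∈ hull J 0 ↔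
    ∃ a ∈ acs g 1, ∃ b ∈ acs g 1, v = a + J b := by
  simp [mem_hull]

theorem center_le_hull {J : g →ₗ[ℝ] g} {F v : g} (hv : v ∈ acs g 1) : v ∈ hull J F :=
  ⟨v, hv, 0, zero_mem _, 0, 0, by simp⟩

theorem self_mem_hull {J : g →ₗ[ℝ] g} {F : g} : F ∈ hull J F :=
  ⟨0, zero_mem _, 0, zero_mem _, 1, 0, by simp⟩

/-- `F` and `E` span `g` over `ℂ` modulo the smallest `J`-invariant subspace containing the
center, `F` lies in the second center, and brackets with that subspace lower the filtration. -/
structure Adapted (J : g →ₗ[ℝ] g) (F E : g) : Prop where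
  two : F ∈ acs g 2
  notMem : F ∉ hull J 0
  notMem' : E ∉ hull J F
  decomp : ∀ A : g, ∃ v ∈ hull J F, ∃ r s : ℝ, A = v + r • E + s • J E
  lie_mem : ∀ X ∈ acs g 1, ⁅J X, E⁆ ∈ hull J F

namespace IsSnN

variable {J : g →ₗ[ℝ] g} (h : IsSnN J)

include h

theorem lie_J_J {X : g} (hX : X ∈ acs g 1) (A : g) : ⁅J X, J A⁆ = J ⁅J X, A⁆ := by
  have := h.nij X A
  rw [mem_acs_one.1 hX, mem_acs_one.1 hX, map_zero] at this
  linear_combination (norm := module) -this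

theorem eq_zero_of_J_mem {X : g} (hX : X ∈ acs g 1) (hJX : J X ∈ acs g 1) : X = 0 :=
  h.snn X fun Z => ⟨hX Z, hJX Z⟩

theorem J_mem_hull {F v : g} (hv : v ∈ hull J F) : J v ∈ hull J F := by
  obtain ⟨a, ha, b, hb, p, q, rfl⟩ := hv
  exact ⟨-b, neg_mem hb, a, ha, -q, p, by simp only [map_add, map_smul, h.sq]; module⟩

theorem hull_mono {F G : g} (hF : F ∈ hull J G) : hull J F ≤ hull J G := by
  rintro _ ⟨a, ha, b, hb, p, q, rfl⟩
  exact add_mem (add_mem (add_mem (center_le_hull ha) (h.J_mem_hull (center_le_hull hb)))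
    (Submodule.smul_mem _ _ hF)) (Submodule.smul_mem _ _ (h.J_mem_hull hF))

theorem zero_of_smul_mem {K : Submodule ℝ g} (hK : ∀ v ∈ K, J v ∈ K) {F : g} (hF : F ∉ K)
    {p q : ℝ} (hpq : p • F + q • J F ∈ K) : p = 0 ∧ q = 0 := by
  by_contra hne
  have hpos : p ^ 2 + q ^ 2 ≠ 0 := fun h0 => hne ⟨by nlinarith, by nlinarith⟩
  have hmem : (p ^ 2 + q ^ 2) • F ∈ K := by
    have := sub_mem (K.smul_mem p hpq) (K.smul_mem q (hK _ hpq))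
    convert this using 1
    simp only [map_add, map_smul, h.sq]
    module
  exact hF ((K.smul_mem_iff hpos).1 hmem)

theorem eq_zero_of_J_mem_two {X : g} (hX : X ∈ acs g 1) (hJX : J X ∈ acs g 2) : X = 0 := by
  refine h.eq_zero_of_J_mem hX fun A => ?_
  refine h.eq_zero_of_J_mem (hJX A) ?_
  rw [← h.lie_J_J hX]
  exact hJX _

theorem two_inf_hull {v : g} (hv : v ∈ acs g 2) (hW : v ∈ hull J 0) : v ∈ acs g 1 := by
  obtain ⟨a, ha, b, hb, rfl⟩ := mem_hull_zero.1 hW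
  have hb0 : b = 0 := h.eq_zero_of_J_mem_two hb (by
    have := sub_mem hv (acs_one_le_two ha)
    simpa using this)
  simpa [hb0] using ha

theorem exists_lie_notMem_hull_zero {X₀ : g} (hX₀ : X₀ ∈ acs g 1) (hne : X₀ ≠ 0) :
    ∃ X ∈ acs g 1, ∃ A, ⁅J X, A⁆ ∉ hull J 0 := by
  by_contra! hcon
  obtain ⟨v, hv, hvZ, hvl⟩ := exists_lie_mem_of_not_subset h.nil Set.univ (hull J 0) (acs g 1)
    (zero_mem _) (by
      rintro v hv A -
      obtain ⟨a, ha, b, hb, rfl⟩ := mem_hull_zero.1 hv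
      rw [add_lie, mem_acs_one.1 ha, zero_add]
      exact hcon b hb A)
    ⟨J X₀, h.J_mem_hull (center_le_hull hX₀), fun hJ => hne (h.eq_zero_of_J_mem hX₀ hJ)⟩
  exact hvZ (h.two_inf_hull (fun A => hvl A trivial) hv)

theorem lie_J_mem_hull_zero {F X v : g} (hF : F ∈ acs g 2) (hX : X ∈ acs g 1)
    (hv : v ∈ hull J F) : ⁅J X, v⁆ ∈ hull J 0 := by
  obtain ⟨a, ha, b, hb, p, q, rfl⟩ := hv
  have h1 : ⁅J X, F⁆ ∈ acs g 1 := by rw [← lie_skew]; exact neg_mem (hF _)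
  have h2 : ⁅J X, a⁆ = 0 := by rw [← lie_skew, mem_acs_one.1 ha, neg_zero]
  have h3 : ⁅J X, J b⁆ = 0 := by
    rw [h.lie_J_J hX, ← lie_skew, mem_acs_one.1 hb, neg_zero, map_zero]
  rw [lie_add, lie_add, lie_add, h2, h3, lie_smul, lie_smul, h.lie_J_J hX, add_zero, zero_add]
  exact add_mem (Submodule.smul_mem _ _ (center_le_hull h1))
    (Submodule.smul_mem _ _ (h.J_mem_hull (center_le_hull h1)))

theorem decomp_of_finrank [FiniteDimensional ℝ g] (hdim : Module.finrank ℝ g = 8)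
    (hZ : 2 ≤ Module.finrank ℝ (acs g 1)) {F E : g} (hF : F ∉ hull J 0) (hE : E ∉ hull J F)
    (A : g) : ∃ v ∈ hull J F, ∃ r s : ℝ, A = v + r • E + s • J E := by
  let f : (acs g 1 × acs g 1) × (ℝ × ℝ) × (ℝ × ℝ) →ₗ[ℝ] g :=
    { toFun := fun x => x.1.1 + J x.1.2 + x.2.1.1 • F + x.2.1.2 • J F + x.2.2.1 • E + x.2.2.2 • J E
      map_add' := by
        intro x y
        simp only [Prod.fst_add, Prod.snd_add, Submodule.coe_add, map_add]
        module
      map_smul' := by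
        intro c x
        simp only [Prod.smul_fst, Prod.smul_snd, Submodule.coe_smul, map_smul, smul_eq_mul,
          RingHom.id_apply]
        module }
  have hinj : Function.Injective f := by
    rw [injective_iff_map_eq_zero]
    rintro ⟨⟨⟨a, ha⟩, ⟨b, hb⟩⟩, ⟨p, q⟩, ⟨r, s⟩⟩ hx
    replace hx : a + J b + p • F + q • J F + r • E + s • J E = 0 := hx
    obtain ⟨rfl, rfl⟩ : r = 0 ∧ s = 0 := h.zero_of_smul_mem (fun v => h.J_mem_hull) hE
      (mem_hull.2 ⟨-a, neg_mem ha, -b, neg_mem hb, -p, -q, by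
        rw [map_neg]; linear_combination (norm := module) hx⟩)
    obtain ⟨rfl, rfl⟩ : p = 0 ∧ q = 0 := h.zero_of_smul_mem (fun v => h.J_mem_hull) hF
      (mem_hull_zero.2 ⟨-a, neg_mem ha, -b, neg_mem hb, by
        rw [map_neg]; linear_combination (norm := module) hx⟩)
    have hab : J b = -a := by linear_combination (norm := module) hx
    obtain rfl : b = 0 := h.eq_zero_of_J_mem hb (hab ▸ neg_mem ha)
    obtain rfl : a = 0 := by simpa using hab
    rfl
  have hfr : Module.finrank ℝ ((acs g 1 × acs g 1) × (ℝ × ℝ) × (ℝ × ℝ))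
      = 2 * Module.finrank ℝ (acs g 1) + 4 := by
    simp only [Module.finrank_prod, Module.finrank_self]; ring
  have hle := LinearMap.finrank_le_finrank_of_injective hinj
  obtain ⟨⟨⟨⟨a, ha⟩, ⟨b, hb⟩⟩, ⟨p, q⟩, ⟨r, s⟩⟩, hx⟩ :=
    (LinearMap.injective_iff_surjective_of_finrank_eq_finrank (by omega)).1 hinj A
  exact ⟨a + J b + p • F + q • J F, ⟨a, ha, b, hb, p, q, rfl⟩, r, s, hx.symm⟩

theorem exists_adapted [FiniteDimensional ℝ g] (hdim : Module.finrank ℝ g = 8)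
    (hZ : 2 ≤ Module.finrank ℝ (acs g 1)) : ∃ F E, Adapted J F E := by
  obtain ⟨X₀, hX₀, hne⟩ : ∃ X ∈ acs g 1, X ≠ 0 := by
    apply Submodule.exists_mem_ne_zero_of_ne_bot
    rintro hbot
    rw [hbot, finrank_bot] at hZ
    omega
  obtain ⟨X₁, hX₁, A₁, hA₁⟩ := h.exists_lie_notMem_hull_zero hX₀ hne
  obtain ⟨F, -, hFZ, hF⟩ := exists_lie_mem_of_not_subset h.nil Set.univ Set.univ (acs g 1 : Set g)
    (zero_mem _) (fun _ _ _ _ => trivial)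
    ⟨J X₀, trivial, fun hJ => hne (h.eq_zero_of_J_mem hX₀ hJ)⟩
  have hF2 : F ∈ acs g 2 := fun A => hF A trivial
  have hFW : F ∉ hull J 0 := fun hW => hFZ (h.two_inf_hull hF2 hW)
  obtain ⟨E, -, hE, hEX⟩ := exists_lie_mem_of_not_subset h.nil (J '' acs g 1) Set.univ (hull J F)
    (zero_mem _) (fun _ _ _ _ => trivial)
    ⟨A₁, trivial, fun hA => hA₁ (h.lie_J_mem_hull_zero hF2 hX₁ hA)⟩
  refine ⟨F, E, hF2, hFW, hE, h.decomp_of_finrank hdim hZ hFW hE, fun X hX => ?_⟩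
  rw [← lie_skew]
  exact neg_mem (hEX _ ⟨X, hX, rfl⟩)

section Adapted

variable {F E : g} (hA : Adapted J F E)

include hA

theorem adapted_change {G : g} (hG : G ∈ acs g 2) (hG0 : G ∉ hull J 0) (hGF : G ∈ hull J F)
    (hFG : F ∈ hull J G) : Adapted J G E := by
  have heq : hull J G = hull J F := le_antisymm (h.hull_mono hGF) (h.hull_mono hFG)
  exact ⟨hG, hG0, heq ▸ hA.notMem', heq ▸ hA.decomp, heq ▸ hA.lie_mem⟩

theorem lie_J_center_mem {X : g} (hX : X ∈ acs g 1) (A : g) : ⁅J X, A⁆ ∈ hull J F := by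
  obtain ⟨v, hv, r, s, rfl⟩ := hA.decomp A
  rw [lie_add, lie_add, lie_smul, lie_smul, h.lie_J_J hX]
  have hE := hA.lie_mem X hX
  exact add_mem (add_mem (h.hull_mono (zero_mem _) (h.lie_J_mem_hull_zero hA.two hX hv))
    (Submodule.smul_mem _ _ hE)) (Submodule.smul_mem _ _ (h.J_mem_hull hE))

theorem lie_JF_of_mem {v : g} (hv : v ∈ hull J F) : ⁅J F, v⁆ ∈ hull J F := by
  obtain ⟨a, ha, b, hb, p, q, rfl⟩ := hv
  have h1 : ⁅J F, F⁆ ∈ hull J F := by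
    rw [← lie_skew]; exact neg_mem (center_le_hull (hA.two _))
  have h2 : ⁅J F, J b⁆ ∈ hull J F := by
    rw [← lie_skew]; exact neg_mem (h.lie_J_center_mem hA hb _)
  have h3 : ⁅J F, a⁆ = 0 := by rw [← lie_skew, mem_acs_one.1 ha, neg_zero]
  rw [lie_add, lie_add, lie_add, h3, lie_smul, lie_smul, lie_self, smul_zero, add_zero, zero_add]
  exact add_mem h2 (Submodule.smul_mem _ _ h1)

theorem lie_JF_JE_sub : ⁅J F, J E⁆ - J ⁅J F, E⁆ ∈ hull J F := by
  have := h.nij F E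
  have heq : ⁅J F, J E⁆ - J ⁅J F, E⁆ = ⁅F, E⁆ + J ⁅F, J E⁆ := by
    linear_combination (norm := module) -this
  rw [heq]
  exact add_mem (center_le_hull (hA.two _)) (h.J_mem_hull (center_le_hull (hA.two _)))

theorem lie_JF_E_mem : ⁅J F, E⁆ ∈ hull J F := by
  obtain ⟨v, -, hv, hvl⟩ := exists_lie_mem_of_not_subset h.nil {J F} Set.univ (hull J F)
    (zero_mem _) (fun _ _ _ _ => trivial) ⟨E, trivial, hA.notMem'⟩
  by_contra hcon
  obtain ⟨w, hw, r, s, rfl⟩ := hA.decomp v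
  have h1 := hvl (J F) rfl
  have h2 : r • ⁅J F, E⁆ + s • J ⁅J F, E⁆ ∈ hull J F := by
    have := sub_mem (sub_mem (neg_mem h1) (h.lie_JF_of_mem hA hw))
      (Submodule.smul_mem _ s (h.lie_JF_JE_sub hA))
    convert this using 1
    rw [lie_skew, lie_add, lie_add, lie_smul, lie_smul]
    module
  obtain ⟨rfl, rfl⟩ := h.zero_of_smul_mem (fun v => h.J_mem_hull) hcon h2
  exact hv (by simpa using hw)

theorem lie_mem_hull {v : g} (hv : v ∈ hull J F) (A : g) : ⁅v, A⁆ ∈ hull J F := by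
  have hJE : ⁅J F, J E⁆ ∈ hull J F := by
    simpa using add_mem (h.lie_JF_JE_sub hA) (h.J_mem_hull (h.lie_JF_E_mem hA))
  have hJF : ⁅J F, A⁆ ∈ hull J F := by
    obtain ⟨w, hw, r, s, rfl⟩ := hA.decomp A
    rw [lie_add, lie_add, lie_smul, lie_smul]
    exact add_mem (add_mem (h.lie_JF_of_mem hA hw) (Submodule.smul_mem _ _ (h.lie_JF_E_mem hA)))
      (Submodule.smul_mem _ _ hJE)
  obtain ⟨a, ha, b, hb, p, q, rfl⟩ := hv
  rw [add_lie, add_lie, add_lie, mem_acs_one.1 ha, zero_add, smul_lie, smul_lie]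
  exact add_mem (add_mem (h.lie_J_center_mem hA hb A)
    (Submodule.smul_mem _ _ (center_le_hull (hA.two A)))) (Submodule.smul_mem _ _ hJF)

theorem lie_E_JE_mem : ⁅E, J E⁆ ∈ hull J F := by
  obtain ⟨v, -, hv, hvl⟩ := exists_lie_mem_of_not_subset h.nil Set.univ Set.univ (hull J F)
    (zero_mem _) (fun _ _ _ _ => trivial) ⟨E, trivial, hA.notMem'⟩
  by_contra hcon
  obtain ⟨w, hw, r, s, rfl⟩ := hA.decomp v
  have h1 : r • ⁅E, J E⁆ ∈ hull J F := by
    have := sub_mem (hvl (J E) trivial) (h.lie_mem_hull hA hw (J E))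
    simpa [add_lie] using this
  have h2 : s • ⁅E, J E⁆ ∈ hull J F := by
    have := sub_mem (h.lie_mem_hull hA hw E) (hvl E trivial)
    convert this using 1
    rw [← lie_skew E (J E)]
    simp only [add_lie, smul_lie, lie_self]
    module
  have hr : r = 0 := by
    by_contra hr
    exact hcon ((Submodule.smul_mem_iff _ hr).1 h1)
  have hs : s = 0 := by
    by_contra hs
    exact hcon ((Submodule.smul_mem_iff _ hs).1 h2)
  exact hv (by simpa [hr, hs] using hw)

omit hA in
/-- The sum of the center and the line through `F` is totally real. -/
theorem eq_zero_of_mem_and_J_mem (hF : F ∉ hull J 0) {a a' : g} (ha : a ∈ acs g 1)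
    (ha' : a' ∈ acs g 1) {p p' : ℝ} (heq : J (a + p • F) = a' + p' • F) : a + p • F = 0 := by
  rw [map_add, map_smul] at heq
  obtain ⟨hp', hp⟩ : -p' = 0 ∧ p = 0 := h.zero_of_smul_mem (fun v => h.J_mem_hull) hF
    (mem_hull_zero.2 ⟨a', ha', -a, neg_mem ha, by
      rw [map_neg]; linear_combination (norm := module) heq⟩)
  obtain rfl : p' = 0 := by simpa using hp'
  subst hp
  have hJa : J a = a' := by simpa using heq
  simpa using h.eq_zero_of_J_mem ha (hJa ▸ ha')

theorem exists_adapted_J : ∃ G, Adapted J G E ∧ ∀ A, ⁅J G, A⁆ = -⁅G, J A⁆ := by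
  obtain ⟨v, hv, hvU, hvl⟩ := exists_lie_mem_of_not_subset h.nil Set.univ (hull J F)
    {x | ∃ a ∈ acs g 1, ∃ p : ℝ, x = a + p • F} ⟨0, zero_mem _, 0, by simp⟩
    (fun v hv A _ => h.lie_mem_hull hA hv A)
    ⟨J F, h.J_mem_hull self_mem_hull, by
      rintro ⟨a, ha, p, hp⟩
      have h0 : (0 : g) + (1 : ℝ) • F = 0 := h.eq_zero_of_mem_and_J_mem hA.notMem
        (zero_mem _) ha (p' := p) (by simpa using hp)
      apply hA.notMem
      rw [show F = 0 by simpa using h0]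
      exact zero_mem _⟩
  obtain ⟨a, ha, b, hb, p, q, rfl⟩ := hv
  have hl : ∀ A, ∃ a' ∈ acs g 1, ∃ p' : ℝ, ⁅J (q • F + b), A⁆ = a' + p' • F := by
    intro A
    obtain ⟨a', ha', p', hp'⟩ := hvl A trivial
    refine ⟨a' - p • ⁅F, A⁆, sub_mem ha' (Submodule.smul_mem _ _ (hA.two A)), p', ?_⟩
    rw [map_add, map_smul]
    simp only [add_lie, smul_lie, mem_acs_one.1 ha] at hp' ⊢
    linear_combination (norm := module) hp'
  have hq : q ≠ 0 := by
    rintro rfl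
    have hb0 : b = 0 := by
      refine h.eq_zero_of_J_mem hb fun A => ?_
      obtain ⟨a₁, ha₁, p₁, h₁⟩ := hl A
      obtain ⟨a₂, ha₂, p₂, h₂⟩ := hl (J A)
      rw [zero_smul, zero_add] at h₁ h₂
      rw [h.lie_J_J hb, h₁] at h₂
      rw [h₁]
      exact h.eq_zero_of_mem_and_J_mem hA.notMem ha₁ ha₂ h₂
    exact hvU ⟨a, ha, p, by simp [hb0]⟩
  have hF : F = q⁻¹ • ((q • F + b) - b) := by
    rw [add_sub_cancel_right, smul_smul, inv_mul_cancel₀ hq, one_smul]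
  have hG0 : q • F + b ∉ hull J 0 := fun hm => hA.notMem (by
    rw [hF]
    exact Submodule.smul_mem _ _ (sub_mem hm (center_le_hull hb)))
  have hG2 : q • F + b ∈ acs g 2 := add_mem (Submodule.smul_mem _ _ hA.two) (acs_one_le_two hb)
  refine ⟨q • F + b, h.adapted_change hA hG2 hG0
    (add_mem (Submodule.smul_mem _ _ self_mem_hull) (center_le_hull hb)) ?_, fun A => ?_⟩
  · have : q⁻¹ • ((q • F + b) - b) ∈ hull J (q • F + b) :=
      Submodule.smul_mem _ _ (sub_mem self_mem_hull (center_le_hull hb))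
    rwa [← hF] at this
  · obtain ⟨a₁, ha₁, p₁, h₁⟩ := hl A
    obtain ⟨a₂, ha₂, p₂, h₂⟩ := hl (J A)
    have hn := h.nij (q • F + b) A
    have hsum : (a₁ + ⁅q • F + b, J A⁆) + p₁ • F = 0 := by
      refine h.eq_zero_of_mem_and_J_mem hA.notMem (add_mem ha₁ (hG2 _))
        (sub_mem ha₂ (hG2 A)) (p' := p₂) ?_
      rw [h₁, h₂] at hn
      simp only [map_add, map_smul] at hn ⊢
      linear_combination (norm := module) hn
    rw [h₁]
    linear_combination (norm := module) hsum

section J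

variable (hJ : ∀ A, ⁅J F, A⁆ = -⁅F, J A⁆)

include hJ

omit h in
theorem J_mem_two : J F ∈ acs g 2 := fun A => by
  rw [hJ]; exact neg_mem (hA.two _)

theorem lie_JX_F {X : g} (hX : X ∈ acs g 1) : ⁅J X, F⁆ = 0 := by
  refine h.eq_zero_of_J_mem ?_ ?_
  · rw [← lie_skew]; exact neg_mem (hA.two _)
  · rw [← h.lie_J_J hX, ← lie_skew]; exact neg_mem (J_mem_two hA hJ _)

theorem lie_JX_hull {X v : g} (hX : X ∈ acs g 1) (hv : v ∈ hull J F) : ⁅J X, v⁆ = 0 := by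
  obtain ⟨a, ha, b, hb, p, q, rfl⟩ := hv
  have h2 : ⁅J X, a⁆ = 0 := by rw [← lie_skew, mem_acs_one.1 ha, neg_zero]
  have h3 : ⁅J X, b⁆ = 0 := by rw [← lie_skew, mem_acs_one.1 hb, neg_zero]
  simp [h.lie_J_J hX, h2, h3, h.lie_JX_F hA hJ hX]

theorem eq_zero_of_lie_E {X : g} (hX : X ∈ acs g 1) (hE : ⁅J X, E⁆ = 0) : X = 0 := by
  refine h.eq_zero_of_J_mem hX fun A => ?_
  obtain ⟨v, hv, r, s, rfl⟩ := hA.decomp A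
  simp [h.lie_J_J hX, h.lie_JX_hull hA hJ hX hv, hE]

theorem exists_lie_E_eq {X₀ : g} (hX₀ : X₀ ∈ acs g 1) (hne : X₀ ≠ 0) :
    ∃ X ∈ acs g 1, X ≠ 0 ∧ ∃ p q : ℝ, ⁅J X, E⁆ = p • F + q • J F := by
  have hU2 : ∀ a ∈ acs g 1, ∀ p q : ℝ, a + p • F + q • J F ∈ acs g 2 := fun a ha p q =>
    add_mem (add_mem (acs_one_le_two ha) (Submodule.smul_mem _ _ hA.two))
      (Submodule.smul_mem _ _ (J_mem_two hA hJ))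
  obtain ⟨v, hv, hvU, hvl⟩ := exists_lie_mem_of_not_subset h.nil Set.univ (hull J F)
    {x | ∃ a ∈ acs g 1, ∃ p q : ℝ, x = a + p • F + q • J F} ⟨0, zero_mem _, 0, 0, by simp⟩
    (fun v hv A _ => h.lie_mem_hull hA hv A)
    ⟨J X₀, h.J_mem_hull (center_le_hull hX₀), by
      rintro ⟨a, ha, p, q, hp⟩
      exact hne (h.eq_zero_of_J_mem_two hX₀ (hp ▸ hU2 a ha p q))⟩
  obtain ⟨a, ha, b, hb, p, q, rfl⟩ := hv
  have hl : ∀ A, ∃ a' ∈ acs g 1, ∃ p' q' : ℝ, ⁅J b, A⁆ = a' + p' • F + q' • J F := by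
    intro A
    obtain ⟨a', ha', p', q', hp'⟩ := hvl A trivial
    refine ⟨a' - p • ⁅F, A⁆ - q • ⁅J F, A⁆,
      sub_mem (sub_mem ha' (Submodule.smul_mem _ _ (hA.two A)))
        (Submodule.smul_mem _ _ (J_mem_two hA hJ A)), p', q', ?_⟩
    simp only [add_lie, smul_lie, mem_acs_one.1 ha] at hp'
    linear_combination (norm := module) hp'
  refine ⟨b, hb, ?_, ?_⟩
  · rintro rfl
    exact hvU ⟨a, ha, p, q, by simp⟩
  · obtain ⟨a₁, ha₁, p₁, q₁, h₁⟩ := hl E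
    obtain ⟨a₂, ha₂, p₂, q₂, h₂⟩ := hl (J E)
    rw [h.lie_J_J hb, h₁] at h₂
    have ha0 : a₁ = 0 := by
      refine h.eq_zero_of_J_mem_two ha₁ ?_
      have : J a₁ = a₂ + (p₂ + q₁) • F + (q₂ - p₁) • J F := by
        simp only [map_add, map_smul, h.sq] at h₂
        linear_combination (norm := module) h₂
      rw [this]
      exact hU2 _ ha₂ _ _
    exact ⟨p₁, q₁, by rw [h₁, ha0, zero_add]⟩

/-- The vector `F` can be chosen as the bracket of `E` with the image of a central element. -/
theorem exists_adapted_lie_E {X₀ : g} (hX₀ : X₀ ∈ acs g 1) (hne : X₀ ≠ 0) :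
    ∃ X ∈ acs g 1, X ≠ 0 ∧ Adapted J ⁅J X, E⁆ E ∧ ∀ A, ⁅J ⁅J X, E⁆, A⁆ = -⁅⁅J X, E⁆, J A⁆ := by
  obtain ⟨X, hX, hX0, p, q, hpq⟩ := h.exists_lie_E_eq hA hJ hX₀ hne
  have hnz : ¬(p = 0 ∧ q = 0) := by
    rintro ⟨rfl, rfl⟩
    exact hX0 (h.eq_zero_of_lie_E hA hJ hX (by simpa using hpq))
  have hpos : p ^ 2 + q ^ 2 ≠ 0 := fun h0 => hnz ⟨by nlinarith, by nlinarith⟩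
  refine ⟨X, hX, hX0, h.adapted_change hA ?_ ?_ (hA.lie_mem X hX) ?_, fun A => ?_⟩
  · rw [hpq]
    exact add_mem (Submodule.smul_mem _ _ hA.two) (Submodule.smul_mem _ _ (J_mem_two hA hJ))
  · intro hm
    rw [hpq] at hm
    exact hnz (h.zero_of_smul_mem (fun v => h.J_mem_hull) hA.notMem hm)
  · have hm := sub_mem (Submodule.smul_mem _ p (self_mem_hull (J := J) (F := ⁅J X, E⁆)))
      (Submodule.smul_mem _ q (h.J_mem_hull (self_mem_hull (J := J) (F := ⁅J X, E⁆))))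
    refine (Submodule.smul_mem_iff _ hpos).1 ?_
    convert hm using 1
    rw [hpq]
    simp only [map_add, map_smul, h.sq]
    module
  · have hJJ := hJ (J A)
    rw [h.sq, lie_neg, neg_neg] at hJJ
    rw [hpq]
    simp only [map_add, map_smul, h.sq, add_lie, smul_lie, neg_lie, hJ A, hJJ]
    module

end J

end Adapted

theorem false_of_adapted {E X : g} (hX : X ∈ acs g 1)
    (hA : Adapted J ⁅J X, E⁆ E) (hJ : ∀ A, ⁅J ⁅J X, E⁆, A⁆ = -⁅⁅J X, E⁆, J A⁆)
    {Y : g} (hY : Y ∈ acs g 1) (hYX : ∀ r : ℝ, Y ≠ r • X) : False := by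
  set F := ⁅J X, E⁆ with hFdef
  have hX0 : ∀ A : g, ⁅X, A⁆ = 0 := mem_acs_one.1 hX
  have hJF2 := J_mem_two hA hJ
  have hJXE : ⁅J X, J E⁆ = J F := h.lie_J_J hX E
  have hJFJE : ⁅J F, J E⁆ = ⁅F, E⁆ := by rw [hJ, h.sq, lie_neg, neg_neg]
  have hFJF : ⁅F, J F⁆ = 0 := by
    have := leibniz_lie (J X) E (J F)
    rw [h.lie_JX_hull hA hJ hX (h.J_mem_hull self_mem_hull), lie_zero, add_zero, ← hFdef,
      ← lie_skew E (J F), lie_neg, ← lie_skew, mem_acs_one.1 (hJF2 E)] at this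
    simpa using this.symm
  have hFJE : ⁅F, J E⁆ = 0 := by
    have := leibniz_lie (J X) E (J E)
    rw [h.lie_JX_hull hA hJ hX (h.lie_E_JE_mem hA), hJXE, ← hFdef, ← lie_skew E (J F), hJ,
      neg_neg, ← two_smul ℝ] at this
    simpa using this.symm
  have hJFE : ⁅J F, E⁆ = 0 := by rw [hJ, hFJE, neg_zero]
  have hFE : ⁅F, E⁆ ≠ 0 := by
    intro h0
    refine hA.notMem (center_le_hull (mem_acs_one.2 fun A => ?_))
    obtain ⟨_, ⟨a, ha, b, hb, p, q, rfl⟩, r, s, rfl⟩ := hA.decomp A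
    have h1 : ⁅F, a⁆ = 0 := by rw [← lie_skew, mem_acs_one.1 ha, neg_zero]
    have h2 : ⁅F, J b⁆ = 0 := by
      rw [← lie_skew, h.lie_JX_hull hA hJ hb self_mem_hull, neg_zero]
    simp [h0, h1, h2, hFJF, hFJE]
  have hU2 : ∀ a ∈ acs g 1, ∀ p q : ℝ, a + p • F + q • J F ∈ acs g 2 := fun a ha p q =>
    add_mem (add_mem (acs_one_le_two ha) (Submodule.smul_mem _ _ hA.two))
      (Submodule.smul_mem _ _ hJF2)
  obtain ⟨v, hv, hvU, hvl⟩ := exists_lie_mem_of_not_subset h.nil Set.univ (hull J F)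
    {x | ∃ a ∈ acs g 1, ∃ p q r : ℝ, x = a + p • F + q • J F + r • J X}
    ⟨0, zero_mem _, 0, 0, 0, by simp⟩
    (fun v hv A _ => h.lie_mem_hull hA hv A)
    ⟨J Y, h.J_mem_hull (center_le_hull hY), by
      rintro ⟨a, ha, p, q, r, hp⟩
      refine hYX r (sub_eq_zero.1 (h.eq_zero_of_J_mem_two
        (sub_mem hY (Submodule.smul_mem _ r hX)) ?_))
      rw [map_sub, map_smul, hp, add_sub_cancel_right]
      exact hU2 a ha p q⟩
  obtain ⟨a, ha, b, hb, p, q, rfl⟩ := hv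
  have hl : ∀ A, ∃ a' ∈ acs g 1, ∃ p' q' r' : ℝ,
      ⁅J b, A⁆ = a' + p' • F + q' • J F + r' • J X := by
    intro A
    obtain ⟨a', ha', p', q', r', hp'⟩ := hvl A trivial
    refine ⟨a' - p • ⁅F, A⁆ - q • ⁅J F, A⁆,
      sub_mem (sub_mem ha' (Submodule.smul_mem _ _ (hA.two A)))
        (Submodule.smul_mem _ _ (hJF2 A)), p', q', r', ?_⟩
    simp only [add_lie, smul_lie, mem_acs_one.1 ha] at hp'
    linear_combination (norm := module) hp'
  obtain ⟨a₁, ha₁, p₁, q₁, r₁, h₁⟩ := hl E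
  obtain ⟨a₂, ha₂, p₂, q₂, r₂, h₂⟩ := hl (J E)
  have hJbJE := h.lie_J_J hb E
  rw [hJbJE, h₁] at h₂
  obtain rfl : a₁ = r₂ • X := by
    refine sub_eq_zero.1 (h.eq_zero_of_J_mem_two (sub_mem ha₁ (Submodule.smul_mem _ r₂ hX)) ?_)
    have : J (a₁ - r₂ • X) = (a₂ + r₁ • X) + (p₂ + q₁) • F + (q₂ - p₁) • J F := by
      simp only [map_add, map_sub, map_smul, h.sq] at h₂ ⊢
      linear_combination (norm := module) h₂
    rw [this]
    exact hU2 _ (add_mem ha₂ (Submodule.smul_mem _ _ hX)) _ _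
  have hmain : (2 * q₁) • ⁅F, E⁆ + r₁ • J F - r₂ • F = 0 := by
    have := leibniz_lie (J b) E (J E)
    rw [h.lie_JX_hull hA hJ hb (h.lie_E_JE_mem hA), hJbJE, ← lie_skew E, h₁] at this
    simp only [map_add, map_smul, h.sq, add_lie, smul_lie, neg_lie, hX0, hFJE, hJFE, hJFJE,
      hJXE, ← hFdef] at this
    linear_combination (norm := module) -this
  obtain ⟨hr₂, hr₁⟩ : -r₂ = 0 ∧ r₁ = 0 := h.zero_of_smul_mem (fun v => h.J_mem_hull) hA.notMem
    (center_le_hull (J := J) (F := 0) (show -r₂ • F + r₁ • J F ∈ acs g 1 by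
      rw [show -r₂ • F + r₁ • J F = -((2 * q₁) • ⁅F, E⁆) by
        linear_combination (norm := module) hmain]
      exact neg_mem (Submodule.smul_mem _ _ (hA.two E))))
  obtain rfl : r₂ = 0 := by simpa using hr₂
  subst hr₁
  obtain rfl : q₁ = 0 := by simpa [hFE] using hmain
  have hbX : b - p₁ • X = 0 := by
    refine h.eq_zero_of_lie_E hA hJ (sub_mem hb (Submodule.smul_mem _ _ hX)) ?_
    rw [map_sub, map_smul, sub_lie, smul_lie, h₁, ← hFdef]
    module
  rw [sub_eq_zero] at hbX
  exact hvU ⟨a, ha, p, q, p₁, by rw [hbX, map_smul]; module⟩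

theorem finrank_center_le_one [FiniteDimensional ℝ g] (hdim : Module.finrank ℝ g = 8) :
    Module.finrank ℝ (acs g 1) ≤ 1 := by
  by_contra! hZ
  obtain ⟨F, E, hA⟩ := h.exists_adapted hdim hZ
  obtain ⟨G, hG, hJ⟩ := h.exists_adapted_J hA
  obtain ⟨X₀, hX₀, hne⟩ : ∃ X ∈ acs g 1, X ≠ 0 := by
    apply Submodule.exists_mem_ne_zero_of_ne_bot
    rintro hbot
    rw [hbot, finrank_bot] at hZ
    omega
  obtain ⟨X, hX, -, hXA, hXJ⟩ := h.exists_adapted_lie_E hG hJ hX₀ hne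
  refine hZ.not_ge (finrank_le_one (⟨X, hX⟩ : acs g 1) fun Y => ?_)
  by_contra! hY
  exact h.false_of_adapted hX hXA hXJ Y.2 fun r hr => hY r (Subtype.ext hr.symm)

theorem finrank_center_pos [FiniteDimensional ℝ g] (hdim : Module.finrank ℝ g = 8) :
    0 < Module.finrank ℝ (acs g 1) := by
  have : Nontrivial g := Module.nontrivial_of_finrank_pos (R := ℝ) (by omega)
  obtain ⟨x, hx⟩ := exists_ne (0 : g)
  obtain ⟨v, -, hv, hvl⟩ := exists_lie_mem_of_not_subset h.nil Set.univ Set.univ {0}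
    rfl (fun _ _ _ _ => trivial) ⟨x, trivial, hx⟩
  exact Module.finrank_pos_iff_exists_ne_zero.2
    ⟨⟨v, fun A => hvl A trivial⟩, fun h0 => hv (congrArg Subtype.val h0)⟩

end IsSnN

end StronglyNonNilpotent

/-- an 8-dimensional nilpotent Lie algebra admitting a strongly
non-nilpotent complex structure has 1-dimensional center. -/
theorem snn_dim8_center_one (g : Type*) [LieRing g] [LieAlgebra ℝ g]
    [FiniteDimensional ℝ g] (hdim : Module.finrank ℝ g = 8)
    (hnil : ∃ s : ℕ, acs g s = ⊤)
    (J : g →ₗ[ℝ] g) (hJ2 : ∀ X : g, J (J X) = -X)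
    (hN : ∀ X Y : g, ⁅X, Y⁆ + J ⁅J X, Y⁆ + J ⁅X, J Y⁆ - ⁅J X, J Y⁆ = 0)
    (hSnN : ∀ X : g, (∀ Z : g, ⁅X, Z⁆ = 0 ∧ ⁅J X, Z⁆ = 0) → X = 0) :
    Module.finrank ℝ (acs g 1) = 1 := by
  have h : StronglyNonNilpotent.IsSnN J := ⟨hnil, hJ2, hN, hSnN⟩
  exact le_antisymm (h.finrank_center_le_one hdim) (h.finrank_center_pos hdim)
end

section
/- Let g be an 8-dimensional real nilpotent Lie algebra. If J and J' are both complex structures on g, then it cannot happen that J is strongly non-nilpotent while J' is quasi-nilpotent. Equivalently, either all complex structures on g satisfy a₁(J) ≠ {0}, or all satisfy a₁(J) = {0}. -/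
namespace ComplexNilpotent

variable {g : Type*} [LieRing g] [LieAlgebra ℝ g]

lemma mem_acs_one {x : g} : x ∈ acs g 1 ↔ ∀ y : g, ⁅x, y⁆ = 0 := Iff.rfl

lemma mem_acs_two {x : g} : x ∈ acs g 2 ↔ ∀ y : g, ⁅x, y⁆ ∈ acs g 1 := Iff.rfl

/-- A form of Engel's theorem relative to a subspace `A`. -/
lemma exists_mem_notMem_lie_mem (hnil : ∃ s : ℕ, acs g s = ⊤) (S : Set g)
    {A B : Submodule ℝ g} (hB : ∀ b ∈ B, ∀ y ∈ S, ⁅b, y⁆ ∈ B) (hBA : ¬ B ≤ A) :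
    ∃ b ∈ B, b ∉ A ∧ ∀ y ∈ S, ⁅b, y⁆ ∈ A := by
  classical
  obtain ⟨s, hs⟩ := hnil
  have hex : ∃ m, ¬ B ⊓ acs g m ≤ A := ⟨s, by simpa [hs] using hBA⟩
  have hm := Nat.find_spec hex
  have hmin := fun k => Nat.find_min hex (m := k)
  generalize Nat.find hex = m at hm hmin
  cases m with
  | zero => simp [acs] at hm
  | succ k =>
    obtain ⟨b, hb, hbA⟩ := SetLike.not_le_iff_exists.1 hm
    exact ⟨b, hb.1, hbA, fun y hy =>
      not_not.1 (hmin k k.lt_succ_self) ⟨hB b hb.1 y hy, hb.2 y⟩⟩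

/-- A complex structure on a nilpotent Lie algebra such that no nonzero `J`-invariant subspace
is central. -/
structure IsStronglyNonNilpotent (J : g →ₗ[ℝ] g) : Prop where
  nil : ∃ s : ℕ, acs g s = ⊤
  sq : ∀ X : g, J (J X) = -X
  nijenhuis : ∀ X Y : g, ⁅X, Y⁆ + J ⁅J X, Y⁆ + J ⁅X, J Y⁆ - ⁅J X, J Y⁆ = 0
  eq_zero : ∀ X : g, X ∈ acs g 1 → J X ∈ acs g 1 → X = 0

/-- The `J`-invariant subspace generated by the center. -/
def centerHull (J : g →ₗ[ℝ] g) : Submodule ℝ g := acs g 1 ⊔ (acs g 1).map J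

/-- The `J`-invariant subspace generated by the center and the vector `X`. -/
def centerHullAdjoin (J : g →ₗ[ℝ] g) (X : g) : Submodule ℝ g :=
  centerHull J ⊔ Submodule.span ℝ {X, J X}

variable {J : g →ₗ[ℝ] g}

lemma mem_centerHull {x : g} :
    x ∈ centerHull J ↔ ∃ z ∈ acs g 1, ∃ w ∈ acs g 1, x = z + J w := by
  simp only [centerHull, Submodule.mem_sup, Submodule.mem_map]
  constructor
  · rintro ⟨z, hz, _, ⟨w, hw, rfl⟩, rfl⟩
    exact ⟨z, hz, w, hw, rfl⟩
  · rintro ⟨z, hz, w, hw, rfl⟩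
    exact ⟨z, hz, _, ⟨w, hw, rfl⟩, rfl⟩

lemma mem_centerHullAdjoin {X x : g} :
    x ∈ centerHullAdjoin J X ↔ ∃ z ∈ acs g 1, ∃ w ∈ acs g 1, ∃ a b : ℝ,
      x = z + J w + a • X + b • J X := by
  simp only [centerHullAdjoin, Submodule.mem_sup, mem_centerHull, Submodule.mem_span_pair]
  constructor
  · rintro ⟨_, ⟨z, hz, w, hw, rfl⟩, _, ⟨a, b, rfl⟩, rfl⟩
    exact ⟨z, hz, w, hw, a, b, by abel⟩
  · rintro ⟨z, hz, w, hw, a, b, rfl⟩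
    exact ⟨_, ⟨z, hz, w, hw, rfl⟩, _, ⟨a, b, rfl⟩, by abel⟩

lemma center_le_centerHull : acs g 1 ≤ centerHull J := le_sup_left

lemma map_mem_centerHull {z : g} (hz : z ∈ acs g 1) : J z ∈ centerHull J :=
  Submodule.mem_sup_right ⟨z, hz, rfl⟩

lemma centerHull_le_centerHullAdjoin {X : g} : centerHull J ≤ centerHullAdjoin J X := le_sup_left

lemma combination_mem_centerHullAdjoin (X : g) (a b : ℝ) :
    a • X + b • J X ∈ centerHullAdjoin J X :=
  Submodule.mem_sup_right (Submodule.mem_span_pair.2 ⟨a, b, rfl⟩)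

namespace IsStronglyNonNilpotent

lemma map_centerHull (h : IsStronglyNonNilpotent J)
    {x : g} (hx : x ∈ centerHull J) : J x ∈ centerHull J := by
  obtain ⟨z, hz, w, hw, rfl⟩ := mem_centerHull.1 hx
  refine mem_centerHull.2 ⟨-w, neg_mem hw, z, hz, ?_⟩
  rw [map_add, h.sq]; abel

lemma map_centerHullAdjoin (h : IsStronglyNonNilpotent J)
    {X x : g} (hx : x ∈ centerHullAdjoin J X) :
    J x ∈ centerHullAdjoin J X := by
  obtain ⟨z, hz, w, hw, a, b, rfl⟩ := mem_centerHullAdjoin.1 hx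
  refine mem_centerHullAdjoin.2 ⟨-w, neg_mem hw, z, hz, -b, a, ?_⟩
  simp only [map_add, map_smul, h.sq]; module

lemma coeff_eq_zero (h : IsStronglyNonNilpotent J)
    {P : Submodule ℝ g} (hP : ∀ x ∈ P, J x ∈ P) {x : g} (hx : x ∉ P)
    {a b : ℝ} (hab : a • x + b • J x ∈ P) : a = 0 ∧ b = 0 := by
  by_contra hne
  have hpos : a * a + b * b ≠ 0 := by
    intro h0
    exact hne ⟨by nlinarith [sq_nonneg a, sq_nonneg b], by nlinarith [sq_nonneg a, sq_nonneg b]⟩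
  have key : (a * a + b * b) • x ∈ P := by
    have := P.sub_mem (P.smul_mem a hab) (P.smul_mem b (hP _ hab))
    convert this using 1
    simp only [map_add, map_smul, h.sq]; module
  exact hx ((P.smul_mem_iff hpos).1 key)

lemma lie_map_map (h : IsStronglyNonNilpotent J)
    {z : g} (hz : z ∈ acs g 1) (y : g) : ⁅J z, J y⁆ = J ⁅J z, y⁆ := by
  have := h.nijenhuis z y
  rw [mem_acs_one.1 hz, mem_acs_one.1 hz, map_zero] at this
  linear_combination (norm := module) -this

lemma lie_map_center (h : IsStronglyNonNilpotent J)
    {z w : g} (hz : z ∈ acs g 1) (hw : w ∈ acs g 1) : ⁅J z, J w⁆ = 0 := by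
  rw [h.lie_map_map hz, ← lie_skew, mem_acs_one.1 hw, neg_zero, map_zero]

lemma lie_map_centerHull (h : IsStronglyNonNilpotent J)
    {z x : g} (hz : z ∈ acs g 1) (hx : x ∈ centerHull J) : ⁅J z, x⁆ = 0 := by
  obtain ⟨w, hw, w', hw', rfl⟩ := mem_centerHull.1 hx
  rw [lie_add, h.lie_map_center hz hw', ← lie_skew, mem_acs_one.1 hw, neg_zero, add_zero]

lemma eq_zero_of_lie_mem_center (h : IsStronglyNonNilpotent J)
    {z : g} (hz : z ∈ acs g 1) (hc : ∀ y, ⁅J z, y⁆ ∈ acs g 1) :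
    z = 0 :=
  h.eq_zero z hz fun y => h.eq_zero _ (hc y) (by rw [← h.lie_map_map hz]; exact hc _)

lemma eq_zero_of_add_map_eq_zero (h : IsStronglyNonNilpotent J)
    {z w : g} (hz : z ∈ acs g 1) (hw : w ∈ acs g 1)
    (hzw : z + J w = 0) : z = 0 ∧ w = 0 := by
  have : w = 0 := h.eq_zero w hw (by
    rw [show J w = -z by linear_combination (norm := module) hzw]; exact neg_mem hz)
  subst this
  exact ⟨by simpa using hzw, rfl⟩

/-- The operators `ad (J z)`, `z` central, do not all map into the `J`-hull of the center. -/
lemma exists_lie_notMem_centerHull (h : IsStronglyNonNilpotent J) (hZ : ∃ z ∈ acs g 1, z ≠ 0) :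
    ∃ z ∈ acs g 1, ∃ u : g, ⁅J z, u⁆ ∉ centerHull J := by
  by_contra! hcon
  obtain ⟨z₀, hz₀, hne⟩ := hZ
  obtain ⟨b, hb, hbZ, hbl⟩ := exists_mem_notMem_lie_mem h.nil Set.univ (A := acs g 1)
    (B := centerHull J) (by
      intro b hb y _
      obtain ⟨z, hz, w, hw, rfl⟩ := mem_centerHull.1 hb
      rw [add_lie, mem_acs_one.1 hz, zero_add]
      exact hcon w hw y)
    (fun hle => hne (h.eq_zero _ hz₀ (hle (map_mem_centerHull hz₀))))
  obtain ⟨z, hz, w, hw, rfl⟩ := mem_centerHull.1 hb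
  have : w = 0 := h.eq_zero_of_lie_mem_center hw fun y => by
    simpa [mem_acs_one.1 hz] using hbl y trivial
  subst this
  exact hbZ (by simpa using hz)

/-- The second center commutes with the images of the operators `ad (J z)`, `z` central. -/
lemma lie_lie_map_eq_zero {X z : g} (hX : X ∈ acs g 2) (y : g) :
    ⁅X, ⁅J z, y⁆⁆ = 0 := by
  have h1 : ⁅⁅X, J z⁆, y⁆ = 0 := mem_acs_one.1 (mem_acs_two.1 hX _) _
  have h2 : ⁅J z, ⁅X, y⁆⁆ = 0 := by
    rw [← lie_skew, mem_acs_one.1 (mem_acs_two.1 hX _), neg_zero]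
  rw [leibniz_lie, h1, h2, add_zero]

lemma notMem_centerHull (h : IsStronglyNonNilpotent J)
    {X : g} (hX : X ∈ acs g 2) (hX1 : X ∉ acs g 1) : X ∉ centerHull J := by
  intro hXW
  obtain ⟨z, hz, w, hw, rfl⟩ := mem_centerHull.1 hXW
  have : w = 0 := h.eq_zero_of_lie_mem_center hw fun y => by
    simpa [mem_acs_one.1 hz] using mem_acs_two.1 hX y
  subst this
  exact hX1 (by simpa using hz)

lemma lie_map_mem_center {X z : g} (hX : X ∈ acs g 2) : ⁅J z, X⁆ ∈ acs g 1 := by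
  rw [← lie_skew]; exact neg_mem (mem_acs_two.1 hX _)

lemma lie_map_adjoin_mem (h : IsStronglyNonNilpotent J)
    {X z x : g} (hX : X ∈ acs g 2) (hz : z ∈ acs g 1)
    (hx : x ∈ centerHullAdjoin J X) : ⁅J z, x⁆ ∈ centerHull J := by
  obtain ⟨w, hw, w', hw', a, b, rfl⟩ := mem_centerHullAdjoin.1 hx
  have h0 := h.lie_map_centerHull hz (mem_centerHull.2 ⟨w, hw, w', hw', rfl⟩)
  have hXz := center_le_centerHull (J := J) (lie_map_mem_center (J := J) (z := z) hX)
  rw [lie_add, lie_add, h0, zero_add, lie_smul, lie_smul, h.lie_map_map hz]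
  exact add_mem (Submodule.smul_mem _ _ hXz) (Submodule.smul_mem _ _ (h.map_centerHull hXz))

/-- In dimension eight, two independent central vectors force a decomposition of `g`. -/
lemma exists_decomposition (h : IsStronglyNonNilpotent J)
    [FiniteDimensional ℝ g] (hdim : Module.finrank ℝ g = 8)
    {z₁ z₂ X u : g} (hz₁ : z₁ ∈ acs g 1) (hz₂ : z₂ ∈ acs g 1)
    (hli : LinearIndependent ℝ ![z₁, z₂]) (hX : X ∉ centerHull J)
    (hu : u ∉ centerHullAdjoin J X) (y : g) :
    ∃ p ∈ centerHullAdjoin J X, ∃ c d : ℝ, y = p + c • u + d • J u := by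
  have hmem : ∀ a b : ℝ, a • z₁ + b • z₂ ∈ acs g 1 := fun a b =>
    add_mem (Submodule.smul_mem _ _ hz₁) (Submodule.smul_mem _ _ hz₂)
  have hl : LinearIndependent ℝ ![z₁, z₂, J z₁, J z₂, X, J X, u, J u] := by
    rw [Fintype.linearIndependent_iff]
    intro c hc
    simp [Fin.sum_univ_eight] at hc
    have hu' := h.coeff_eq_zero (fun x => h.map_centerHullAdjoin) hu
      (a := c 6) (b := c 7) (mem_centerHullAdjoin.2
        ⟨(-c 0) • z₁ + (-c 1) • z₂, hmem _ _, (-c 2) • z₁ + (-c 3) • z₂, hmem _ _, -c 4, -c 5, by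
          simp only [map_add, map_smul]; linear_combination (norm := module) hc⟩)
    have hX' := h.coeff_eq_zero (fun x => h.map_centerHull) hX
      (a := c 4) (b := c 5) (mem_centerHull.2
        ⟨(-c 0) • z₁ + (-c 1) • z₂, hmem _ _, (-c 2) • z₁ + (-c 3) • z₂, hmem _ _, by
          rw [hu'.1, hu'.2] at hc
          simp only [map_add, map_smul]; linear_combination (norm := module) hc⟩)
    rw [hu'.1, hu'.2, hX'.1, hX'.2] at hc
    have h0 := h.eq_zero_of_add_map_eq_zero (hmem (c 0) (c 1)) (hmem (c 2) (c 3)) (by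
      simp only [map_add, map_smul]; linear_combination (norm := module) hc)
    have h01 := LinearIndependent.pair_iff.1 hli _ _ h0.1
    have h23 := LinearIndependent.pair_iff.1 hli _ _ h0.2
    intro i
    fin_cases i
    exacts [h01.1, h01.2, h23.1, h23.2, hX'.1, hX'.2, hu'.1, hu'.2]
  have hspan := hl.span_eq_top_of_card_eq_finrank (by simp [hdim])
  have hy : y ∈ Submodule.span ℝ (Set.range ![z₁, z₂, J z₁, J z₂, X, J X, u, J u]) := by
    rw [hspan]; trivial
  obtain ⟨c, rfl⟩ := (Submodule.mem_span_range_iff_exists_fun ℝ).1 hy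
  refine ⟨_, mem_centerHullAdjoin.2 ⟨c 0 • z₁ + c 1 • z₂, hmem _ _, c 2 • z₁ + c 3 • z₂,
    hmem _ _, c 4, c 5, rfl⟩, c 6, c 7, ?_⟩
  simp [Fin.sum_univ_eight]
  abel

end IsStronglyNonNilpotent

/-- A vector `X` of the second center, together with a vector `u` complementing the `J`-invariant
subspace spanned by `X` and the center. -/
structure IsAdapted (J : g →ₗ[ℝ] g) (z₀ u X : g) : Prop extends IsStronglyNonNilpotent J where
  mem_acs_two : X ∈ acs g 2
  notMem_centerHull : X ∉ centerHull J
  base_mem : z₀ ∈ acs g 1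
  lie_notMem : ⁅J z₀, u⁆ ∉ centerHull J
  exists_eq : ∀ y : g, ∃ p ∈ centerHullAdjoin J X, ∃ c d : ℝ, y = p + c • u + d • J u

namespace IsAdapted

variable {z₀ u X : g}

lemma coeff_eq_zero_of_mem (h : IsAdapted J z₀ u X) {a b : ℝ}
    (hab : a • X + b • J X ∈ centerHull J) : a = 0 ∧ b = 0 :=
  h.coeff_eq_zero (fun _ => h.map_centerHull) h.notMem_centerHull hab

lemma lie_map_mem (h : IsAdapted J z₀ u X) {z : g} (hz : z ∈ acs g 1) (y : g) :
    ⁅J z, y⁆ ∈ centerHullAdjoin J X := by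
  have hW : ∀ x ∈ centerHullAdjoin J X, ⁅J z, x⁆ ∈ centerHullAdjoin J X := fun x hx =>
    centerHull_le_centerHullAdjoin (h.lie_map_adjoin_mem h.mem_acs_two hz hx)
  have hu : ⁅J z, u⁆ ∈ centerHullAdjoin J X := by
    by_contra hcon
    obtain ⟨b, -, hb, hbl⟩ := exists_mem_notMem_lie_mem h.nil {J z} (A := centerHullAdjoin J X)
      (B := ⊤) (fun _ _ _ _ => trivial) (fun hle => hcon (hle trivial))
    obtain ⟨p, hp, c, d, rfl⟩ := h.exists_eq b
    have h1 := neg_mem (hbl (J z) rfl)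
    rw [lie_skew, lie_add, lie_add, lie_smul, lie_smul, h.lie_map_map hz, add_assoc] at h1
    obtain ⟨rfl, rfl⟩ := h.coeff_eq_zero (fun _ => h.map_centerHullAdjoin) hcon
      ((Submodule.add_mem_iff_right _ (hW p hp)).1 h1)
    exact hb (by simpa using hp)
  obtain ⟨p, hp, c, d, rfl⟩ := h.exists_eq y
  rw [lie_add, lie_add, lie_smul, lie_smul, h.lie_map_map hz]
  exact add_mem (add_mem (hW p hp) (Submodule.smul_mem _ _ hu))
    (Submodule.smul_mem _ _ (h.map_centerHullAdjoin hu))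

lemma base_ne_zero (h : IsAdapted J z₀ u X) : z₀ ≠ 0 := by
  rintro rfl
  exact h.lie_notMem (by simp)

lemma lie_map_eq_zero (h : IsAdapted J z₀ u X) {z : g} (hz : z ∈ acs g 1) : ⁅X, J z⁆ = 0 := by
  by_contra hcon
  let K : Submodule ℝ g := acs g 1 ⊓ LinearMap.ker ((LieAlgebra.ad ℝ g X : g →ₗ[ℝ] g) ∘ₗ J)
  have hK : ∀ {k}, k ∈ K ↔ k ∈ acs g 1 ∧ ⁅X, J k⁆ = 0 := by
    intro k
    simp [K]
  let B : Submodule ℝ g := K ⊔ K.map J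
  have hBmem : ∀ {x}, x ∈ B ↔ ∃ k ∈ K, ∃ l ∈ K, x = k + J l := by
    intro x
    simp only [B, Submodule.mem_sup, Submodule.mem_map]
    constructor
    · rintro ⟨k, hk, _, ⟨l, hl, rfl⟩, rfl⟩
      exact ⟨k, hk, l, hl, rfl⟩
    · rintro ⟨k, hk, l, hl, rfl⟩
      exact ⟨k, hk, _, ⟨l, hl, rfl⟩, rfl⟩
  have hBJ : ∀ x ∈ B, J x ∈ B := by
    intro x hx
    obtain ⟨k, hk, l, hl, rfl⟩ := hBmem.1 hx
    exact hBmem.2 ⟨-l, neg_mem hl, k, hk, by rw [map_add, h.sq]; abel⟩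
  have hkP : ∀ k ∈ K, ∀ p ∈ centerHullAdjoin J X, ⁅J k, p⁆ = 0 := by
    intro k hk p hp
    obtain ⟨w, hw, w', hw', a, b, rfl⟩ := mem_centerHullAdjoin.1 hp
    have h0 := h.lie_map_centerHull (hK.1 hk).1 (mem_centerHull.2 ⟨w, hw, w', hw', rfl⟩)
    have h1 : ⁅J k, X⁆ = 0 := by rw [← lie_skew, (hK.1 hk).2, neg_zero]
    rw [lie_add, lie_add, h0, lie_smul, lie_smul, h.lie_map_map (hK.1 hk).1, h1]
    simp
  have hku : ∀ k ∈ K, ⁅J k, u⁆ ∈ B := by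
    intro k hk
    have hk1 := (hK.1 hk).1
    obtain ⟨w, hw, w', hw', a, b, hD⟩ := mem_centerHullAdjoin.1 (h.lie_map_mem hk1 u)
    have hcomm : ⁅J z, ⁅J k, u⁆⁆ = 0 := by
      rw [leibniz_lie, h.lie_map_center hz hk1, zero_lie, zero_add,
        hkP k hk _ (h.lie_map_mem hz u)]
    have h0 := h.lie_map_centerHull hz (mem_centerHull.2 ⟨w, hw, w', hw', rfl⟩)
    rw [hD, lie_add, lie_add, h0, zero_add, lie_smul, lie_smul, h.lie_map_map hz] at hcomm
    obtain ⟨rfl, rfl⟩ := h.coeff_eq_zero (P := ⊥) (x := ⁅J z, X⁆) (by simp)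
      (by rw [Submodule.mem_bot, ← lie_skew, neg_eq_zero]; exact hcon) (a := a) (b := b)
      (by rw [Submodule.mem_bot]; exact hcomm)
    have hXw : ∀ {w}, w ∈ acs g 1 → ⁅X, w⁆ = 0 := fun {w} hw => by
      rw [← lie_skew, mem_acs_one.1 hw, neg_zero]
    have e1 := IsStronglyNonNilpotent.lie_lie_map_eq_zero (J := J) (z := k) h.mem_acs_two u
    have e2 := IsStronglyNonNilpotent.lie_lie_map_eq_zero (J := J) (z := k) h.mem_acs_two (J u)
    rw [h.lie_map_map hk1] at e2
    simp only [hD, zero_smul, add_zero, map_add, h.sq, lie_add, lie_neg, hXw hw, hXw hw',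
      zero_add, neg_zero] at e1 e2
    exact hBmem.2 ⟨w, hK.2 ⟨hw, e2⟩, w', hK.2 ⟨hw', e1⟩, by simpa using hD⟩
  have hky : ∀ k ∈ K, ∀ y, ⁅J k, y⁆ ∈ B := by
    intro k hk y
    obtain ⟨p, hp, c, d, rfl⟩ := h.exists_eq y
    rw [lie_add, lie_add, lie_smul, lie_smul, h.lie_map_map (hK.1 hk).1, hkP k hk p hp, zero_add]
    exact add_mem (Submodule.smul_mem _ _ (hku k hk))
      (Submodule.smul_mem _ _ (hBJ _ (hku k hk)))
  obtain ⟨k, hk, hk0⟩ : ∃ k ∈ K, k ≠ 0 := by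
    obtain ⟨b, hb, hb0, hbl⟩ := exists_mem_notMem_lie_mem h.nil {J X} (A := ⊥)
      (B := (acs g 1).map J) (by
        rintro _ ⟨w, hw, rfl⟩ _ rfl
        rw [h.lie_map_map hw]
        exact ⟨_, IsStronglyNonNilpotent.lie_map_mem_center h.mem_acs_two, rfl⟩)
      (fun hle => h.base_ne_zero (h.eq_zero _ h.base_mem (by
        rw [(Submodule.mem_bot ℝ).1 (hle ⟨_, h.base_mem, rfl⟩)]; exact zero_mem _)))
    obtain ⟨w, hw, rfl⟩ := hb
    have h1 := hbl (J X) rfl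
    rw [Submodule.mem_bot, h.lie_map_map hw] at h1
    refine ⟨w, hK.2 ⟨hw, ?_⟩, ?_⟩
    · have h2 := congrArg J h1
      rw [h.sq, map_zero, lie_skew] at h2
      exact h2
    · rintro rfl
      exact hb0 (by simp)
  obtain ⟨b, hb, hbZ, hbl⟩ := exists_mem_notMem_lie_mem h.nil Set.univ (A := acs g 1) (B := B) (by
      intro b hb y _
      obtain ⟨k, hk, l, hl, rfl⟩ := hBmem.1 hb
      rw [add_lie, mem_acs_one.1 (hK.1 hk).1, zero_add]
      exact hky l hl y)
    (fun hle => hk0 (h.eq_zero _ (hK.1 hk).1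
      (hle (hBmem.2 ⟨0, zero_mem _, k, hk, (zero_add _).symm⟩))))
  obtain ⟨k, hk, l, hl, rfl⟩ := hBmem.1 hb
  have : l = 0 := h.eq_zero_of_lie_mem_center (hK.1 hl).1 fun y => by
    simpa [mem_acs_one.1 (hK.1 hk).1] using hbl y trivial
  subst this
  exact hbZ (by simpa using (hK.1 hk).1)

lemma lie_map_self (h : IsAdapted J z₀ u X) : ⁅X, J X⁆ = 0 := by
  obtain ⟨w, hw, w', hw', a, b, hD⟩ := mem_centerHullAdjoin.1 (h.lie_map_mem h.base_mem u)
  have hXw : ∀ {w}, w ∈ acs g 1 → ⁅X, w⁆ = 0 := fun {w} hw => by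
    rw [← lie_skew, mem_acs_one.1 hw, neg_zero]
  have e1 := IsStronglyNonNilpotent.lie_lie_map_eq_zero (J := J) (z := z₀) h.mem_acs_two u
  have e2 := IsStronglyNonNilpotent.lie_lie_map_eq_zero (J := J) (z := z₀) h.mem_acs_two (J u)
  rw [h.lie_map_map h.base_mem] at e2
  simp only [hD, map_add, map_smul, h.sq, lie_add, lie_neg, lie_smul, lie_self, hXw hw, hXw hw',
    h.lie_map_eq_zero hw, h.lie_map_eq_zero hw', zero_add, neg_zero, smul_zero, add_zero,
    smul_eq_zero] at e1 e2
  by_contra hne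
  have ha := e2.resolve_right hne
  have hb := e1.resolve_right hne
  exact h.lie_notMem (mem_centerHull.2 ⟨w, hw, w', hw', by simpa [ha, hb] using hD⟩)

/-- The subspace `centerHullAdjoin J X` is abelian. -/
lemma lie_eq_zero (h : IsAdapted J z₀ u X) {p q : g} (hp : p ∈ centerHullAdjoin J X)
    (hq : q ∈ centerHullAdjoin J X) : ⁅p, q⁆ = 0 := by
  obtain ⟨v, hv, v', hv', a, b, rfl⟩ := mem_centerHullAdjoin.1 hp
  obtain ⟨w, hw, w', hw', c, d, rfl⟩ := mem_centerHullAdjoin.1 hq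
  have hc : ∀ {w}, w ∈ acs g 1 → ∀ y, ⁅y, w⁆ = 0 := fun {w} hw y => by
    rw [← lie_skew, mem_acs_one.1 hw, neg_zero]
  have h1 : ∀ {w}, w ∈ acs g 1 → ⁅J w, X⁆ = 0 := fun {w} hw => by
    rw [← lie_skew, h.lie_map_eq_zero hw, neg_zero]
  have h2 : ∀ {w}, w ∈ acs g 1 → ⁅J w, J X⁆ = 0 := fun {w} hw => by
    rw [h.lie_map_map hw, h1 hw, map_zero]
  have h3 : ⁅J X, J w'⁆ = 0 := by rw [← lie_skew, h2 hw', neg_zero]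
  have h4 : ⁅J X, X⁆ = 0 := by rw [← lie_skew, h.lie_map_self, neg_zero]
  simp [mem_acs_one.1 hv, hc hw, h1 hv', h2 hv', h3, h4, h.lie_map_eq_zero hw', h.lie_map_self,
    h.lie_map_center hv' hw']

lemma map_mem {z : g} (hz : z ∈ acs g 1) : J z ∈ centerHullAdjoin J X :=
  centerHull_le_centerHullAdjoin (map_mem_centerHull hz)

lemma self_mem : X ∈ centerHullAdjoin J X := by
  simpa using combination_mem_centerHullAdjoin (J := J) X 1 0

lemma map_self_mem : J X ∈ centerHullAdjoin J X := by
  simpa using combination_mem_centerHullAdjoin (J := J) X 0 1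

lemma lie_mem (h : IsAdapted J z₀ u X) {p : g} (hp : p ∈ centerHullAdjoin J X) (y : g) :
    ⁅p, y⁆ ∈ centerHullAdjoin J X := by
  have h0 : ⁅J z₀, ⁅p, y⁆⁆ = 0 := by
    rw [leibniz_lie, h.lie_eq_zero (map_mem h.base_mem) hp,
      h.lie_eq_zero hp (h.lie_map_mem h.base_mem y), zero_lie, add_zero]
  obtain ⟨q, hq, c, d, hqe⟩ := h.exists_eq ⁅p, y⁆
  rw [hqe, lie_add, lie_add, h.lie_eq_zero (map_mem h.base_mem) hq, zero_add, lie_smul, lie_smul,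
    h.lie_map_map h.base_mem] at h0
  obtain ⟨rfl, rfl⟩ := h.coeff_eq_zero (fun _ => h.map_centerHull) h.lie_notMem (a := c) (b := d)
    (by rw [h0]; exact zero_mem _)
  rw [hqe]
  simpa using hq

lemma notMem_adjoin (h : IsAdapted J z₀ u X) : u ∉ centerHullAdjoin J X := fun hu =>
  h.lie_notMem (h.lie_map_adjoin_mem h.mem_acs_two h.base_mem hu)

lemma lie_map_right_mem (h : IsAdapted J z₀ u X) : ⁅u, J u⁆ ∈ centerHullAdjoin J X := by
  obtain ⟨b, -, hb, hbl⟩ := exists_mem_notMem_lie_mem h.nil Set.univ (A := centerHullAdjoin J X)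
    (B := ⊤) (fun _ _ _ _ => trivial) (fun hle => h.notMem_adjoin (hle trivial))
  obtain ⟨p, hp, c, d, rfl⟩ := h.exists_eq b
  have e1 := hbl (J u) trivial
  have e2 := hbl u trivial
  rw [add_lie, add_lie, smul_lie, smul_lie, lie_self, smul_zero, add_zero,
    Submodule.add_mem_iff_right _ (h.lie_mem hp _)] at e1
  rw [add_lie, add_lie, smul_lie, smul_lie, lie_self, smul_zero, add_zero,
    Submodule.add_mem_iff_right _ (h.lie_mem hp _), ← lie_skew, smul_neg, neg_mem_iff] at e2
  by_contra hcon
  have hc : c = 0 := by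
    by_contra hc
    exact hcon ((Submodule.smul_mem_iff _ hc).1 e1)
  have hd : d = 0 := by
    by_contra hd
    exact hcon ((Submodule.smul_mem_iff _ hd).1 e2)
  exact hb (by simpa [hc, hd] using hp)

lemma lie_lie_comm (h : IsAdapted J z₀ u X) {p : g} (hp : p ∈ centerHullAdjoin J X) :
    ⁅⁅p, u⁆, J u⁆ = ⁅⁅p, J u⁆, u⁆ := by
  have h0 := h.lie_eq_zero hp h.lie_map_right_mem
  rw [leibniz_lie, ← lie_skew u] at h0
  linear_combination (norm := module) h0

lemma mem_center (h : IsAdapted J z₀ u X) {p : g} (hp : p ∈ centerHullAdjoin J X)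
    (h1 : ⁅p, u⁆ = 0) (h2 : ⁅p, J u⁆ = 0) : p ∈ acs g 1 := by
  refine mem_acs_one.2 fun y => ?_
  obtain ⟨q, hq, c, d, rfl⟩ := h.exists_eq y
  simp [h.lie_eq_zero hp hq, h1, h2]

lemma eq_zero_of_lie_eq_zero (h : IsAdapted J z₀ u X) {z : g} (hz : z ∈ acs g 1)
    (h1 : ⁅J z, u⁆ = 0) : z = 0 :=
  h.eq_zero z hz (h.mem_center (map_mem hz) h1 (by rw [h.lie_map_map hz, h1, map_zero]))

/-- After adding a central vector to `X`, both `X` and `J X` lie in the second center. -/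
lemma exists_map_add_mem (h : IsAdapted J z₀ u X) :
    ∃ z ∈ acs g 1, J (X + z) ∈ acs g 2 := by
  have hA : ∀ {x}, x ∈ acs g 1 ⊔ Submodule.span ℝ {X} ↔ ∃ z ∈ acs g 1, ∃ a : ℝ,
      x = z + a • X := by
    intro x
    simp only [Submodule.mem_sup, Submodule.mem_span_singleton]
    constructor
    · rintro ⟨z, hz, _, ⟨a, rfl⟩, rfl⟩
      exact ⟨z, hz, a, rfl⟩
    · rintro ⟨z, hz, a, rfl⟩
      exact ⟨z, hz, _, ⟨a, rfl⟩, rfl⟩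
  obtain ⟨n, hn, hnA, hnl⟩ := exists_mem_notMem_lie_mem h.nil Set.univ
    (A := acs g 1 ⊔ Submodule.span ℝ {X}) (B := centerHullAdjoin J X)
    (fun b hb y _ => h.lie_mem hb y) (by
      intro hle
      obtain ⟨z, hz, a, hza⟩ := hA.1 (hle map_self_mem)
      refine one_ne_zero (h.coeff_eq_zero_of_mem (a := -a) (b := (1 : ℝ)) ?_).2
      rw [hza]
      convert center_le_centerHull (J := J) hz using 1
      module)
  obtain ⟨w, hw, w', hw', a, b, rfl⟩ := mem_centerHullAdjoin.1 hn
  have key : ∀ y, ⁅J w', y⁆ + b • ⁅J X, y⁆ ∈ acs g 1 ⊔ Submodule.span ℝ {X} := by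
    intro y
    have h1 := hnl y trivial
    have h2 : a • ⁅X, y⁆ ∈ acs g 1 ⊔ Submodule.span ℝ {X} :=
      Submodule.smul_mem _ _ (Submodule.mem_sup_left (ComplexNilpotent.mem_acs_two.1 h.mem_acs_two y))
    have := sub_mem h1 h2
    convert this using 1
    simp only [add_lie, smul_lie, mem_acs_one.1 hw]
    module
  by_cases hb : b = 0
  · subst hb
    have hw0 : w' = 0 := by
      refine h.eq_zero_of_lie_mem_center hw' fun y => ?_
      have k1 := key y
      have k2 := key (J y)
      rw [zero_smul, add_zero] at k1 k2
      rw [h.lie_map_map hw'] at k2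
      obtain ⟨z, hz, c, hc⟩ := hA.1 k1
      obtain ⟨z', hz', c', hc'⟩ := hA.1 k2
      rw [hc, map_add, map_smul] at hc'
      have := h.coeff_eq_zero_of_mem (a := -c') (b := c) (mem_centerHull.2
        ⟨z', hz', -z, neg_mem hz, by rw [map_neg]; linear_combination (norm := module) hc'⟩)
      rw [hc, this.2, zero_smul, add_zero]
      exact hz
    subst hw0
    exact (hnA (hA.2 ⟨w, hw, a, by simp⟩)).elim
  · refine ⟨b⁻¹ • w', Submodule.smul_mem _ _ hw', ComplexNilpotent.mem_acs_two.2 ?_⟩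
    have hX' : X + b⁻¹ • w' ∈ acs g 2 := by
      refine ComplexNilpotent.mem_acs_two.2 fun y => ?_
      rw [add_lie, smul_lie, mem_acs_one.1 hw', smul_zero, add_zero]
      exact ComplexNilpotent.mem_acs_two.1 h.mem_acs_two y
    have hl : ∀ y, ⁅J (X + b⁻¹ • w'), y⁆ ∈ acs g 1 ⊔ Submodule.span ℝ {X} := by
      intro y
      convert Submodule.smul_mem _ b⁻¹ (key y) using 1
      rw [map_add, map_smul, add_lie, smul_lie, smul_add, smul_smul, inv_mul_cancel₀ hb, one_smul,
        add_comm]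
    intro y
    obtain ⟨z, hz, c, hc⟩ := hA.1 (hl y)
    obtain ⟨z', hz', c', hc'⟩ := hA.1 (hl (J y))
    have hnij := h.nijenhuis (X + b⁻¹ • w') y
    have m1 := ComplexNilpotent.mem_acs_two.1 hX' y
    have m2 := ComplexNilpotent.mem_acs_two.1 hX' (J y)
    rw [hc, hc', map_add, map_smul] at hnij
    have := h.coeff_eq_zero_of_mem (a := -c') (b := c) (mem_centerHull.2
      ⟨z' - ⁅X + b⁻¹ • w', y⁆, sub_mem hz' m1, -z - ⁅X + b⁻¹ • w', J y⁆,
        sub_mem (neg_mem hz) m2, by rw [map_sub, map_neg]; linear_combination (norm := module) hnij⟩)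
    rw [hc, this.2, zero_smul, add_zero]
    exact hz

lemma exists_lie_eq (h : IsAdapted J z₀ u X) (hJX : J X ∈ acs g 2) :
    ∃ z ∈ acs g 1, z ≠ 0 ∧ ∃ a b : ℝ, ⁅J z, u⁆ = a • X + b • J X := by
  have hA : ∀ {x}, x ∈ acs g 1 ⊔ Submodule.span ℝ {X, J X} ↔ ∃ z ∈ acs g 1, ∃ a b : ℝ,
      x = z + a • X + b • J X := by
    intro x
    simp only [Submodule.mem_sup, Submodule.mem_span_pair]
    constructor
    · rintro ⟨z, hz, _, ⟨a, b, rfl⟩, rfl⟩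
      exact ⟨z, hz, a, b, by abel⟩
    · rintro ⟨z, hz, a, b, rfl⟩
      exact ⟨z, hz, _, ⟨a, b, rfl⟩, by abel⟩
  obtain ⟨n, hn, hnA, hnl⟩ := exists_mem_notMem_lie_mem h.nil Set.univ
    (A := acs g 1 ⊔ Submodule.span ℝ {X, J X}) (B := centerHullAdjoin J X)
    (fun b hb y _ => h.lie_mem hb y) (by
      intro hle
      obtain ⟨z, hz, a, b, hzab⟩ := hA.1 (hle (map_mem h.base_mem))
      have hab := h.coeff_eq_zero_of_mem (a := a) (b := b) (mem_centerHull.2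
        ⟨-z, neg_mem hz, z₀, h.base_mem, by rw [hzab]; module⟩)
      refine h.base_ne_zero (h.eq_zero z₀ h.base_mem ?_)
      rw [hzab, hab.1, hab.2]
      simpa using hz)
  obtain ⟨w, hw, w', hw', a, b, rfl⟩ := mem_centerHullAdjoin.1 hn
  have key : ∀ y, ⁅J w', y⁆ ∈ acs g 1 ⊔ Submodule.span ℝ {X, J X} := by
    intro y
    have h1 := hnl y trivial
    have h2 : a • ⁅X, y⁆ + b • ⁅J X, y⁆ ∈ acs g 1 ⊔ Submodule.span ℝ {X, J X} :=
      Submodule.mem_sup_left (add_mem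
        (Submodule.smul_mem _ _ (ComplexNilpotent.mem_acs_two.1 h.mem_acs_two y))
        (Submodule.smul_mem _ _ (ComplexNilpotent.mem_acs_two.1 hJX y)))
    convert sub_mem h1 h2 using 1
    simp only [add_lie, smul_lie, mem_acs_one.1 hw]
    module
  refine ⟨w', hw', ?_, ?_⟩
  · rintro rfl
    exact hnA (hA.2 ⟨w, hw, a, b, by simp⟩)
  · obtain ⟨z, hz, c, d, hcd⟩ := hA.1 (key u)
    obtain ⟨z', hz', c', d', hcd'⟩ := hA.1 (key (J u))
    rw [h.lie_map_map hw', hcd] at hcd'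
    simp only [map_add, map_smul, h.sq] at hcd'
    have h0 := h.coeff_eq_zero_of_mem (a := -d - c') (b := c - d') (mem_centerHull.2
      ⟨z', hz', -z, neg_mem hz, by rw [map_neg]; linear_combination (norm := module) hcd'⟩)
    have h1 := h.eq_zero_of_add_map_eq_zero (neg_mem hz') hz (by
      have e1 : c' = -d := by linarith [h0.1]
      have e2 : d' = c := by linarith [h0.2]
      rw [e1, e2] at hcd'
      linear_combination (norm := module) hcd')
    exact ⟨c, d, by rw [hcd, h1.2, zero_add]⟩

lemma false_of_lie_eq (h : IsAdapted J z₀ u X) (hJX : J X ∈ acs g 2) {z z' : g}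
    (hz : z ∈ acs g 1) (hzX : ⁅J z, u⁆ = X) (hz' : z' ∈ acs g 1) (hzz' : ∀ c : ℝ, z' ≠ c • z) :
    False := by
  have hzX' : ⁅J z, J u⁆ = J X := by rw [h.lie_map_map hz, hzX]
  have hnij := h.nijenhuis X u
  have m1 := ComplexNilpotent.mem_acs_two.1 h.mem_acs_two
  have m2 := ComplexNilpotent.mem_acs_two.1 hJX
  have hn := h.eq_zero_of_add_map_eq_zero (sub_mem (m1 u) (m2 (J u)))
    (add_mem (m2 u) (m1 (J u))) (by rw [map_add]; linear_combination (norm := module) hnij)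
  have hc := h.lie_lie_comm (map_mem hz)
  rw [hzX, hzX'] at hc
  have hXJu : ⁅X, J u⁆ = 0 := by
    have h2 : (2 : ℝ) • ⁅X, J u⁆ = 0 := by linear_combination (norm := module) hn.2 + hc
    simpa using h2
  have hJXu : ⁅J X, u⁆ = 0 := by rw [← hc, hXJu]
  have hJXJu : ⁅J X, J u⁆ = ⁅X, u⁆ := (sub_eq_zero.1 hn.1).symm
  have hA : ∀ {x}, x ∈ acs g 1 ⊔ Submodule.span ℝ {X, J X, J z} ↔ ∃ w ∈ acs g 1, ∃ a b c : ℝ,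
      x = w + a • X + b • J X + c • J z := by
    intro x
    simp only [Submodule.mem_sup, Submodule.mem_span_triple]
    constructor
    · rintro ⟨w, hw, _, ⟨a, b, c, rfl⟩, rfl⟩
      exact ⟨w, hw, a, b, c, by abel⟩
    · rintro ⟨w, hw, a, b, c, rfl⟩
      exact ⟨w, hw, _, ⟨a, b, c, rfl⟩, by abel⟩
  obtain ⟨n, hn, hnA, hnl⟩ := exists_mem_notMem_lie_mem h.nil Set.univ
    (A := acs g 1 ⊔ Submodule.span ℝ {X, J X, J z}) (B := centerHullAdjoin J X)
    (fun b hb y _ => h.lie_mem hb y) (by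
      intro hle
      obtain ⟨w, hw, a, b, c, habc⟩ := hA.1 (hle (map_mem hz'))
      have hzc := sub_mem hz' (Submodule.smul_mem _ c hz)
      have hab := h.coeff_eq_zero_of_mem (a := a) (b := b) (mem_centerHull.2
        ⟨-w, neg_mem hw, z' - c • z, hzc, by rw [map_sub, map_smul, habc]; module⟩)
      refine hzz' c (sub_eq_zero.1 (h.eq_zero _ hzc ?_))
      rw [map_sub, map_smul, habc, hab.1, hab.2]
      simpa using hw)
  obtain ⟨w, hw, w', hw', a, b, rfl⟩ := mem_centerHullAdjoin.1 hn
  have key : ∀ y, ⁅J w', y⁆ ∈ acs g 1 ⊔ Submodule.span ℝ {X, J X, J z} := by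
    intro y
    have h1 := hnl y trivial
    have h2 : a • ⁅X, y⁆ + b • ⁅J X, y⁆ ∈ acs g 1 ⊔ Submodule.span ℝ {X, J X, J z} :=
      Submodule.mem_sup_left (add_mem (Submodule.smul_mem _ _ (m1 y))
        (Submodule.smul_mem _ _ (m2 y)))
    convert sub_mem h1 h2 using 1
    simp only [add_lie, smul_lie, mem_acs_one.1 hw]
    module
  obtain ⟨v, hv, r, s, e, hD⟩ := hA.1 (key u)
  obtain ⟨v', hv', r', s', d, hD'⟩ := hA.1 (key (J u))
  rw [h.lie_map_map hw', hD] at hD'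
  simp only [map_add, map_smul, h.sq] at hD'
  have hvd := sub_mem hv (Submodule.smul_mem _ d hz)
  have hve := add_mem hv' (Submodule.smul_mem _ e hz)
  have h0 := h.coeff_eq_zero_of_mem (a := -s - r') (b := r - s') (mem_centerHull.2
    ⟨v' + e • z, hve, -(v - d • z), neg_mem hvd, by
      rw [map_neg, map_sub, map_smul]; linear_combination (norm := module) hD'⟩)
  have hv0 := h.eq_zero_of_add_map_eq_zero (neg_mem hve) hvd (by
    have e1 : r' = -s := by linarith [h0.1]
    have e2 : s' = r := by linarith [h0.2]
    rw [e1, e2] at hD'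
    rw [map_sub, map_smul]
    linear_combination (norm := module) hD')
  have hvz : v = d • z := sub_eq_zero.1 hv0.2
  have hcomm := h.lie_lie_comm (map_mem hw')
  rw [h.lie_map_map hw', hD, hvz] at hcomm
  simp only [map_add, map_smul, h.sq, add_lie, smul_lie, neg_lie, mem_acs_one.1 hz, hzX, hzX',
    hXJu, hJXu, hJXJu] at hcomm
  have hde := h.coeff_eq_zero_of_mem (a := d) (b := -e) (center_le_centerHull (by
    convert Submodule.smul_mem _ (2 * s) (m1 u) using 1
    linear_combination (norm := module) -hcomm))
  have he : e = 0 := neg_eq_zero.1 hde.2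
  have hs : s • ⁅X, u⁆ = 0 := by
    rw [hde.1, he] at hcomm
    have h2 : (2 : ℝ) • s • ⁅X, u⁆ = 0 := by linear_combination (norm := module) hcomm
    simpa using h2
  have hXu : ⁅X, u⁆ ≠ 0 := fun h0 =>
    h.notMem_centerHull (center_le_centerHull (h.mem_center self_mem h0 hXJu))
  have hs0 : s = 0 := (smul_eq_zero.1 hs).resolve_right hXu
  have hwz : w' - r • z = 0 := h.eq_zero_of_lie_eq_zero
    (sub_mem hw' (Submodule.smul_mem _ r hz)) (by
      rw [map_sub, map_smul, sub_lie, smul_lie, hzX, hD, hvz, hde.1, he, hs0]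
      module)
  refine hnA (hA.2 ⟨w, hw, a, b, r, ?_⟩)
  rw [sub_eq_zero.1 hwz, map_smul]
  abel

end IsAdapted

lemma IsStronglyNonNilpotent.not_linearIndependent_center [FiniteDimensional ℝ g]
    (hdim : Module.finrank ℝ g = 8) (h : IsStronglyNonNilpotent J) {z₁ z₂ : g}
    (hz₁ : z₁ ∈ acs g 1) (hz₂ : z₂ ∈ acs g 1) : ¬ LinearIndependent ℝ ![z₁, z₂] := by
  intro hli
  obtain ⟨z₀, hz₀, u, hu⟩ := h.exists_lie_notMem_centerHull ⟨z₁, hz₁, by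
    simpa using hli.ne_zero 0⟩
  have adapted : ∀ X ∈ acs g 2, X ∉ centerHull J → IsAdapted J z₀ u X := fun X hX hXW =>
    { toIsStronglyNonNilpotent := h
      mem_acs_two := hX
      notMem_centerHull := hXW
      base_mem := hz₀
      lie_notMem := hu
      exists_eq := h.exists_decomposition hdim hz₁ hz₂ hli hXW fun hmem =>
        hu (h.lie_map_adjoin_mem hX hz₀ hmem) }
  obtain ⟨X, -, hX1, hXl⟩ := exists_mem_notMem_lie_mem h.nil Set.univ (A := acs g 1) (B := ⊤)
    (fun _ _ _ _ => trivial) (fun hle => hu (center_le_centerHull (hle trivial)))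
  have hX : X ∈ acs g 2 := mem_acs_two.2 fun y => hXl y trivial
  have hA := adapted X hX (h.notMem_centerHull hX hX1)
  obtain ⟨z, hz, hJ⟩ := hA.exists_map_add_mem
  have hXz : X + z ∈ acs g 2 := add_mem hX (mem_acs_two.2 fun y => by
    rw [mem_acs_one.1 hz]; exact zero_mem _)
  have hA' := adapted (X + z) hXz (by
    rw [Submodule.add_mem_iff_left _ (center_le_centerHull hz)]
    exact hA.notMem_centerHull)
  obtain ⟨w, hw, hw0, a, b, hab⟩ := hA'.exists_lie_eq hJ
  have hA'' := adapted ⁅J w, u⁆ (by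
    rw [hab]
    exact add_mem (Submodule.smul_mem _ _ hXz) (Submodule.smul_mem _ _ hJ)) (by
    intro hmem
    rw [hab] at hmem
    obtain ⟨rfl, rfl⟩ := hA'.coeff_eq_zero_of_mem hmem
    exact hw0 (hA'.eq_zero_of_lie_eq_zero hw (by simpa using hab)))
  have hJ'' : J ⁅J w, u⁆ ∈ acs g 2 := by
    rw [hab, map_add, map_smul, map_smul, h.sq]
    exact add_mem (Submodule.smul_mem _ _ hJ) (Submodule.smul_mem _ _ (neg_mem hXz))
  by_cases h1 : ∃ c : ℝ, z₁ = c • w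
  · by_cases h2 : ∃ c : ℝ, z₂ = c • w
    · obtain ⟨c₁, rfl⟩ := h1
      obtain ⟨c₂, rfl⟩ := h2
      have h0 := LinearIndependent.pair_iff.1 hli c₂ (-c₁) (by module)
      have hne := hli.ne_zero 1
      simp [h0.1] at hne
    · exact hA''.false_of_lie_eq hJ'' hw rfl hz₂ (not_exists.1 h2)
  · exact hA''.false_of_lie_eq hJ'' hw rfl hz₁ (not_exists.1 h1)

end ComplexNilpotent

/-- on an 8-dimensional nilpotent Lie algebra, a strongly
non-nilpotent complex structure `J` and a quasi-nilpotent complex structure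
`J'` cannot coexist. -/
theorem snn_and_quasinilpotent_cannot_coexist (g : Type*) [LieRing g]
    [LieAlgebra ℝ g] [FiniteDimensional ℝ g] (hdim : Module.finrank ℝ g = 8)
    (hnil : ∃ s : ℕ, acs g s = ⊤)
    (J J' : g →ₗ[ℝ] g)
    (hJ2 : ∀ X : g, J (J X) = -X)
    (hN : ∀ X Y : g, ⁅X, Y⁆ + J ⁅J X, Y⁆ + J ⁅X, J Y⁆ - ⁅J X, J Y⁆ = 0)
    (hJ'2 : ∀ X : g, J' (J' X) = -X)
    (hN' : ∀ X Y : g, ⁅X, Y⁆ + J' ⁅J' X, Y⁆ + J' ⁅X, J' Y⁆ - ⁅J' X, J' Y⁆ = 0) :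
    ¬ ((∀ X : g, (∀ Z : g, ⁅X, Z⁆ = 0 ∧ ⁅J X, Z⁆ = 0) → X = 0) ∧
       (∃ X : g, X ≠ 0 ∧ ∀ Z : g, ⁅X, Z⁆ = 0 ∧ ⁅J' X, Z⁆ = 0)) := by
  rintro ⟨hsnn, X, hX0, hX⟩
  have h : ComplexNilpotent.IsStronglyNonNilpotent J :=
    { nil := hnil
      sq := hJ2
      nijenhuis := hN
      eq_zero := fun Y h1 h2 => hsnn Y fun Z =>
        ⟨ComplexNilpotent.mem_acs_one.1 h1 Z, ComplexNilpotent.mem_acs_one.1 h2 Z⟩ }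
  refine h.not_linearIndependent_center hdim (z₁ := X) (z₂ := J' X)
    (ComplexNilpotent.mem_acs_one.2 fun Z => (hX Z).1)
    (ComplexNilpotent.mem_acs_one.2 fun Z => (hX Z).2)
    (LinearIndependent.pair_iff.2 fun a b hab => ?_)
  have hab' := congrArg J' hab
  simp only [map_add, map_smul, hJ'2, map_zero] at hab'
  have key : (a * a + b * b) • X = 0 := by
    linear_combination (norm := module) a • hab - b • hab'
  have h0 := (smul_eq_zero.1 key).resolve_right hX0
  exact ⟨by nlinarith [sq_nonneg a, sq_nonneg b], by nlinarith [sq_nonneg a, sq_nonneg b]⟩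
end

section
/- Let g be a real nilpotent Lie algebra of dimension 2n with n ≥ 4 that is isomorphic to a product (direct sum of Lie algebras) of n - 2 nonzero nilpotent Lie algebras h₁ × ... × h_{n-2}. Then every complex structure J on g is quasi-nilpotent, i.e., a₁(J) ≠ {0}. -/
section

variable {g : Type*} [LieRing g] [LieAlgebra ℝ g]

theorem mem_acs_succ {k : ℕ} {x : g} : x ∈ acs g (k + 1) ↔ ∀ y : g, ⁅x, y⁆ ∈ acs g k :=
  Iff.rfl

/-- In a nilpotent Lie algebra, an ideal `B` not contained in a subspace `A` contains an element
outside `A` all of whose brackets lie in `A`. -/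
theorem exists_notMem_forall_lie_mem (hnil : ∃ s : ℕ, acs g s = ⊤) (A B : Submodule ℝ g)
    (hB : ∀ x ∈ B, ∀ y : g, ⁅x, y⁆ ∈ B) (hBA : ¬ B ≤ A) :
    ∃ x ∈ B, x ∉ A ∧ ∀ y : g, ⁅x, y⁆ ∈ A := by
  obtain ⟨s, hs⟩ := hnil
  have key : ∀ k : ℕ, ∀ x ∈ acs g k, x ∈ B → x ∉ A →
      ∃ x ∈ B, x ∉ A ∧ ∀ y : g, ⁅x, y⁆ ∈ A := by
    intro k
    induction k with
    | zero =>
      intro x hx _ hxA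
      have hx0 : x = 0 := hx
      exact absurd (hx0 ▸ A.zero_mem) hxA
    | succ k ih =>
      intro x hx hxB hxA
      by_cases h : ∀ y : g, ⁅x, y⁆ ∈ A
      · exact ⟨x, hxB, hxA, h⟩
      · push Not at h
        obtain ⟨y, hy⟩ := h
        exact ih _ (mem_acs_succ.1 hx y) (hB x hxB y) hy
  obtain ⟨x, hxB, hxA⟩ := SetLike.not_le_iff_exists.1 hBA
  exact key s x (hs ▸ Submodule.mem_top) hxB hxA

/-- The center as a real subspace. -/
def centerSubmodule (g : Type*) [LieRing g] [LieAlgebra ℝ g] : Submodule ℝ g := acs g 1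

theorem mem_centerSubmodule {x : g} : x ∈ centerSubmodule g ↔ ∀ y : g, ⁅x, y⁆ = 0 :=
  Iff.rfl

theorem exists_ne_zero_mem_centerSubmodule [Nontrivial g] (hnil : ∃ s : ℕ, acs g s = ⊤) :
    ∃ x ∈ centerSubmodule g, x ≠ 0 := by
  obtain ⟨x, -, hx, h⟩ := exists_notMem_forall_lie_mem hnil ⊥ ⊤ (fun _ _ _ => trivial)
    (by simp)
  exact ⟨x, h, hx⟩

end

section

variable {E : Type*} [AddCommGroup E] [Module ℝ E]

/-- The span of a subspace `W`, a vector `x` and its image `J x`. -/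
def adjoinOrbit (J : E →ₗ[ℝ] E) (W : Submodule ℝ E) (x : E) : Submodule ℝ E :=
  (W ⊔ ℝ ∙ x) ⊔ ℝ ∙ (J x)

variable {J : E →ₗ[ℝ] E} {W : Submodule ℝ E} {x : E}

theorem mem_adjoinOrbit {y : E} :
    y ∈ adjoinOrbit J W x ↔ ∃ w ∈ W, ∃ a b : ℝ, y = w + a • x + b • J x := by
  simp only [adjoinOrbit, Submodule.mem_sup, Submodule.mem_span_singleton]
  constructor
  · rintro ⟨_, ⟨w, hw, _, ⟨a, rfl⟩, rfl⟩, _, ⟨b, rfl⟩, rfl⟩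
    exact ⟨w, hw, a, b, rfl⟩
  · rintro ⟨w, hw, a, b, rfl⟩
    exact ⟨_, ⟨w, hw, _, ⟨a, rfl⟩, rfl⟩, _, ⟨b, rfl⟩, rfl⟩

theorem le_adjoinOrbit : W ≤ adjoinOrbit J W x :=
  le_sup_left.trans le_sup_left

theorem self_mem_adjoinOrbit : x ∈ adjoinOrbit J W x :=
  mem_adjoinOrbit.2 ⟨0, W.zero_mem, 1, 0, by module⟩

theorem map_self_mem_adjoinOrbit : J x ∈ adjoinOrbit J W x :=
  mem_adjoinOrbit.2 ⟨0, W.zero_mem, 0, 1, by module⟩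

theorem map_mem_adjoinOrbit (hJ2 : ∀ x, J (J x) = -x) (hW : ∀ w ∈ W, J w ∈ W) {y : E}
    (hy : y ∈ adjoinOrbit J W x) : J y ∈ adjoinOrbit J W x := by
  obtain ⟨w, hw, a, b, rfl⟩ := mem_adjoinOrbit.1 hy
  refine mem_adjoinOrbit.2 ⟨J w, hW w hw, -b, a, ?_⟩
  simp only [map_add, map_smul, hJ2]
  module

theorem eq_zero_of_smul_add_smul_mem_s15 (hJ2 : ∀ x, J (J x) = -x) (hW : ∀ w ∈ W, J w ∈ W)
    (hx : x ∉ W) {a b : ℝ} (h : a • x + b • J x ∈ W) : a = 0 ∧ b = 0 := by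
  have h2 : (a * a + b * b) • x ∈ W := by
    have := W.sub_mem (W.smul_mem a h) (W.smul_mem b (hW _ h))
    convert this using 1
    simp only [map_add, map_smul, hJ2]
    module
  have h3 : a * a + b * b = 0 := by
    by_contra hne
    exact hx ((W.smul_mem_iff hne).1 h2)
  constructor <;> nlinarith [mul_self_nonneg a, mul_self_nonneg b]

theorem finrank_add_two_le_adjoinOrbit [FiniteDimensional ℝ E] (hJ2 : ∀ x, J (J x) = -x)
    (hW : ∀ w ∈ W, J w ∈ W) (hx : x ∉ W) :
    Module.finrank ℝ W + 2 ≤ Module.finrank ℝ (adjoinOrbit J W x) := by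
  have h1 : W < W ⊔ ℝ ∙ x := by
    refine lt_of_le_of_ne le_sup_left fun h => hx ?_
    rw [h]
    exact Submodule.mem_sup_right (Submodule.mem_span_singleton_self x)
  have h2 : W ⊔ ℝ ∙ x < adjoinOrbit J W x := by
    refine lt_of_le_of_ne le_sup_left fun h => ?_
    have hm : J x ∈ W ⊔ ℝ ∙ x := h ▸ map_self_mem_adjoinOrbit
    obtain ⟨w, hw, _, hs, he⟩ := Submodule.mem_sup.1 hm
    obtain ⟨a, rfl⟩ := Submodule.mem_span_singleton.1 hs
    have := eq_zero_of_smul_add_smul_mem_s15 (a := -a) (b := 1) hJ2 hW hx (by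
      rw [← he]
      convert hw using 1
      module)
    exact one_ne_zero this.2
  have := Submodule.finrank_lt_finrank_of_lt h1
  have := Submodule.finrank_lt_finrank_of_lt h2
  omega

end

section

variable {g : Type*} [LieRing g] [LieAlgebra ℝ g] {J : g →ₗ[ℝ] g}

/-- The sum of the center and its image under `J`. -/
def centerHull (J : g →ₗ[ℝ] g) : Submodule ℝ g :=
  centerSubmodule g ⊔ (centerSubmodule g).map J

theorem mem_centerHull {y : g} : y ∈ centerHull J ↔
    ∃ z ∈ centerSubmodule g, ∃ x ∈ centerSubmodule g, y = z + J x := by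
  simp only [centerHull, Submodule.mem_sup, Submodule.mem_map]
  constructor
  · rintro ⟨z, hz, _, ⟨x, hx, rfl⟩, rfl⟩
    exact ⟨z, hz, x, hx, rfl⟩
  · rintro ⟨z, hz, x, hx, rfl⟩
    exact ⟨z, hz, _, ⟨x, hx, rfl⟩, rfl⟩

theorem mem_centerHull_of_mem {z : g} (hz : z ∈ centerSubmodule g) : z ∈ centerHull J :=
  mem_centerHull.2 ⟨z, hz, 0, zero_mem _, by simp⟩

theorem map_mem_centerHull_of_mem {z : g} (hz : z ∈ centerSubmodule g) : J z ∈ centerHull J :=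
  mem_centerHull.2 ⟨0, zero_mem _, z, hz, by simp⟩

theorem map_mem_centerHull (hJ2 : ∀ X : g, J (J X) = -X) :
    ∀ y ∈ centerHull J, J y ∈ centerHull J := by
  intro y hy
  obtain ⟨z, hz, x, hx, rfl⟩ := mem_centerHull.1 hy
  refine mem_centerHull.2 ⟨-x, neg_mem hx, z, hz, ?_⟩
  rw [map_add, hJ2]
  abel

theorem lie_eq_zero_of_mem_center {z : g} (hz : z ∈ centerSubmodule g) (y : g) : ⁅z, y⁆ = 0 :=
  mem_centerSubmodule.1 hz y

theorem lie_eq_zero_of_mem_center_right {z : g} (hz : z ∈ centerSubmodule g) (y : g) :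
    ⁅y, z⁆ = 0 := by
  rw [← lie_skew, lie_eq_zero_of_mem_center hz, neg_zero]

theorem lie_map_center_map
    (hN : ∀ X Y : g, ⁅X, Y⁆ + J ⁅J X, Y⁆ + J ⁅X, J Y⁆ - ⁅J X, J Y⁆ = 0)
    {x : g} (hx : x ∈ centerSubmodule g) (y : g) : ⁅J x, J y⁆ = J ⁅J x, y⁆ := by
  have h := hN x y
  rw [lie_eq_zero_of_mem_center hx, lie_eq_zero_of_mem_center hx, map_zero, zero_add, add_zero,
    sub_eq_zero] at h
  exact h.symm

theorem lie_map_center_centerHull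
    (hN : ∀ X Y : g, ⁅X, Y⁆ + J ⁅J X, Y⁆ + J ⁅X, J Y⁆ - ⁅J X, J Y⁆ = 0)
    {x v : g} (hx : x ∈ centerSubmodule g) (hv : v ∈ centerHull J) : ⁅J x, v⁆ = 0 := by
  obtain ⟨z, hz, w, hw, rfl⟩ := mem_centerHull.1 hv
  rw [lie_add, lie_map_center_map hN hx, lie_eq_zero_of_mem_center_right hz,
    lie_eq_zero_of_mem_center_right hw, map_zero, add_zero]

theorem finrank_centerHull [FiniteDimensional ℝ g] (hJ2 : ∀ X : g, J (J X) = -X)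
    (hdisj : ∀ x ∈ centerSubmodule g, J x ∈ centerSubmodule g → x = 0) :
    Module.finrank ℝ (centerHull J) = 2 * Module.finrank ℝ (centerSubmodule g) := by
  have hinj : Function.Injective J := by
    intro x y hxy
    have := congrArg J hxy
    simpa [hJ2] using this
  have h1 := Submodule.finrank_sup_add_finrank_inf_eq (centerSubmodule g)
    ((centerSubmodule g).map J)
  have h2 : centerSubmodule g ⊓ (centerSubmodule g).map J = ⊥ := by
    rw [eq_bot_iff]
    rintro _ ⟨hy, x, hx, rfl⟩
    have := hdisj x hx hy
    simp [this]
  have h3 : Module.finrank ℝ ((centerSubmodule g).map J) =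
      Module.finrank ℝ (centerSubmodule g) :=
    (Submodule.equivMapOfInjective J hinj _).finrank_eq.symm
  rw [h2, finrank_bot, h3] at h1
  rw [centerHull]
  omega

/-- If `[J x, g]` is central for a central `x`, then `x = 0`. -/
theorem eq_zero_of_forall_lie_mem_center
    (hN : ∀ X Y : g, ⁅X, Y⁆ + J ⁅J X, Y⁆ + J ⁅X, J Y⁆ - ⁅J X, J Y⁆ = 0)
    (hdisj : ∀ x ∈ centerSubmodule g, J x ∈ centerSubmodule g → x = 0)
    {x : g} (hx : x ∈ centerSubmodule g) (h : ∀ y, ⁅J x, y⁆ ∈ centerSubmodule g) : x = 0 := by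
  refine hdisj x hx (mem_centerSubmodule.2 fun y => hdisj _ (h y) ?_)
  rw [← lie_map_center_map hN hx]
  exact h _

/-- The center and `T` span a totally real subspace. -/
theorem eq_zero_of_mem_of_map_mem (hJ2 : ∀ X : g, J (J X) = -X)
    (hdisj : ∀ x ∈ centerSubmodule g, J x ∈ centerSubmodule g → x = 0)
    {T : g} (hT : T ∉ centerHull J) {v : g} (hv : v ∈ centerSubmodule g ⊔ ℝ ∙ T)
    (hJv : J v ∈ centerSubmodule g ⊔ ℝ ∙ T) : v = 0 := by
  simp only [Submodule.mem_sup, Submodule.mem_span_singleton] at hv hJv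
  obtain ⟨z, hz, _, ⟨a, rfl⟩, rfl⟩ := hv
  obtain ⟨w, hw, _, ⟨b, rfl⟩, h⟩ := hJv
  rw [map_add, map_smul] at h
  obtain ⟨hb, ha⟩ := eq_zero_of_smul_add_smul_mem_s15 (a := -b) (b := a) hJ2
    (map_mem_centerHull hJ2) hT
    (by
      refine mem_centerHull.2 ⟨w, hw, -z, neg_mem hz, ?_⟩
      rw [map_neg]
      linear_combination (norm := module) -h)
  obtain rfl : b = 0 := by linarith
  subst ha
  have : z = 0 := hdisj z hz (by
    have hwz : w = J z := by simpa using h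
    exact hwz ▸ hw)
  simp [this]

theorem exists_notMem_centerHull (hnil : ∃ s : ℕ, acs g s = ⊤) [Nontrivial g]
    (hN : ∀ X Y : g, ⁅X, Y⁆ + J ⁅J X, Y⁆ + J ⁅X, J Y⁆ - ⁅J X, J Y⁆ = 0)
    (hdisj : ∀ x ∈ centerSubmodule g, J x ∈ centerSubmodule g → x = 0) :
    ∃ T ∉ centerHull J, ∀ y, ⁅T, y⁆ ∈ centerSubmodule g := by
  obtain ⟨T, -, hT, hTy⟩ := exists_notMem_forall_lie_mem hnil (centerSubmodule g) ⊤
    (fun _ _ _ => trivial) (by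
      intro h
      obtain ⟨x, hx⟩ := exists_ne (0 : g)
      exact hx (hdisj x (h trivial) (h trivial)))
  refine ⟨T, fun hmem => hT ?_, hTy⟩
  obtain ⟨z, hz, x, hx, rfl⟩ := mem_centerHull.1 hmem
  obtain rfl : x = 0 := eq_zero_of_forall_lie_mem_center hN hdisj hx fun y => by
    simpa [lie_eq_zero_of_mem_center hz] using hTy y
  simpa using hz

/-- The hull of the center is never an ideal. -/
theorem not_forall_lie_map_mem_centerHull (hnil : ∃ s : ℕ, acs g s = ⊤) [Nontrivial g]
    (hN : ∀ X Y : g, ⁅X, Y⁆ + J ⁅J X, Y⁆ + J ⁅X, J Y⁆ - ⁅J X, J Y⁆ = 0)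
    (hdisj : ∀ x ∈ centerSubmodule g, J x ∈ centerSubmodule g → x = 0) :
    ¬ ∀ x ∈ centerSubmodule g, ∀ y, ⁅J x, y⁆ ∈ centerHull J := by
  intro hideal
  obtain ⟨v, hv, hvZ, hvy⟩ := exists_notMem_forall_lie_mem hnil (centerSubmodule g)
    (centerHull J) (by
      intro v hv y
      obtain ⟨z, hz, x, hx, rfl⟩ := mem_centerHull.1 hv
      rw [add_lie, lie_eq_zero_of_mem_center hz, zero_add]
      exact hideal x hx y) (by
      intro h
      obtain ⟨x, hx, hx0⟩ := exists_ne_zero_mem_centerSubmodule hnil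
      exact hx0 (hdisj x hx (h (map_mem_centerHull_of_mem hx))))
  obtain ⟨z, hz, x, hx, rfl⟩ := mem_centerHull.1 hv
  obtain rfl : x = 0 := eq_zero_of_forall_lie_mem_center hN hdisj hx fun y => by
    simpa [lie_eq_zero_of_mem_center hz] using hvy y
  exact hvZ (by simpa using hz)

theorem lie_map_center_mem_centerHull (hJ2 : ∀ X : g, J (J X) = -X)
    (hN : ∀ X Y : g, ⁅X, Y⁆ + J ⁅J X, Y⁆ + J ⁅X, J Y⁆ - ⁅J X, J Y⁆ = 0)
    {T : g} (hTy : ∀ y, ⁅T, y⁆ ∈ centerSubmodule g) {x v : g} (hx : x ∈ centerSubmodule g)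
    (hv : v ∈ adjoinOrbit J (centerHull J) T) : ⁅J x, v⁆ ∈ centerHull J := by
  obtain ⟨w, hw, a, b, rfl⟩ := mem_adjoinOrbit.1 hv
  have hT : ⁅J x, T⁆ ∈ centerHull J := by
    rw [← lie_skew]
    exact neg_mem (mem_centerHull_of_mem (hTy _))
  rw [lie_add, lie_add, lie_smul, lie_smul, lie_map_center_centerHull hN hx hw, zero_add,
    lie_map_center_map hN hx]
  exact add_mem (Submodule.smul_mem _ _ hT)
    (Submodule.smul_mem _ _ (map_mem_centerHull hJ2 _ hT))

/-- When the center is large, all brackets lie in the complex span of the center and `T`, and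
this span has complex codimension one. -/
theorem exists_adjoinOrbit_eq_top (hnil : ∃ s : ℕ, acs g s = ⊤) [Nontrivial g]
    [FiniteDimensional ℝ g] (hJ2 : ∀ X : g, J (J X) = -X)
    (hN : ∀ X Y : g, ⁅X, Y⁆ + J ⁅J X, Y⁆ + J ⁅X, J Y⁆ - ⁅J X, J Y⁆ = 0)
    (hdisj : ∀ x ∈ centerSubmodule g, J x ∈ centerSubmodule g → x = 0)
    (hdim : Module.finrank ℝ g ≤ 2 * Module.finrank ℝ (centerSubmodule g) + 4)
    {T : g} (hT : T ∉ centerHull J) (hTy : ∀ y, ⁅T, y⁆ ∈ centerSubmodule g) :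
    (∃ u, adjoinOrbit J (adjoinOrbit J (centerHull J) T) u = ⊤) ∧
      ∀ x y : g, ⁅x, y⁆ ∈ adjoinOrbit J (centerHull J) T := by
  have hV := map_mem_centerHull hJ2
  set V := centerHull J with hVdef
  set V₁ := adjoinOrbit J V T with hV₁def
  have hV₁ : ∀ w ∈ V₁, J w ∈ V₁ := fun w hw => map_mem_adjoinOrbit hJ2 hV hw
  obtain ⟨u, -, hu, huy⟩ := exists_notMem_forall_lie_mem hnil V₁ ⊤ (fun _ _ _ => trivial)
    (by
      intro h
      exact not_forall_lie_map_mem_centerHull hnil hN hdisj fun x hx y =>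
        lie_map_center_mem_centerHull hJ2 hN hTy hx (h trivial))
  have htop : adjoinOrbit J V₁ u = ⊤ := by
    apply Submodule.eq_top_of_finrank_eq
    have h1 := finrank_centerHull hJ2 hdisj
    have h2 := finrank_add_two_le_adjoinOrbit hJ2 hV hT
    have h3 := finrank_add_two_le_adjoinOrbit hJ2 hV₁ hu
    have h4 := Submodule.finrank_le (adjoinOrbit J V₁ u)
    rw [← hVdef] at h1
    rw [← hV₁def] at h2
    omega
  have hZ : ∀ z ∈ centerSubmodule g, z ∈ V₁ := fun z hz =>
    le_adjoinOrbit (mem_centerHull_of_mem hz)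
  have hyu : ∀ y, ⁅y, u⁆ ∈ V₁ := fun y => by
    rw [← lie_skew]
    exact neg_mem (huy y)
  have hideal : ∀ v ∈ V₁, ∀ y, ⁅v, y⁆ ∈ V₁ := by
    have hx : ∀ x ∈ centerSubmodule g, ∀ y, ⁅J x, y⁆ ∈ V₁ := by
      intro x hx y
      obtain ⟨w, hw, a, b, rfl⟩ := mem_adjoinOrbit.1 (htop ▸ Submodule.mem_top : y ∈ _)
      rw [lie_add, lie_add, lie_smul, lie_smul, lie_map_center_map hN hx]
      exact add_mem (add_mem (le_adjoinOrbit (lie_map_center_mem_centerHull hJ2 hN hTy hx hw))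
        (Submodule.smul_mem _ _ (hyu _))) (Submodule.smul_mem _ _ (hV₁ _ (hyu _)))
    have hJT : ∀ y, ⁅J T, y⁆ ∈ V₁ := by
      intro y
      obtain ⟨w, hw, a, b, rfl⟩ := mem_adjoinOrbit.1 (htop ▸ Submodule.mem_top : y ∈ _)
      have h1 : ⁅J T, w⁆ ∈ V₁ := by
        obtain ⟨v, hv, c, d, rfl⟩ := mem_adjoinOrbit.1 hw
        obtain ⟨z, hz, x, hxZ, rfl⟩ := mem_centerHull.1 hv
        simp only [lie_add, lie_smul, lie_self, smul_zero, add_zero,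
          lie_eq_zero_of_mem_center_right hz, zero_add]
        refine add_mem ?_ (Submodule.smul_mem _ _ ?_)
        · rw [← lie_skew]
          exact neg_mem (hx x hxZ _)
        · rw [← lie_skew]
          exact neg_mem (hZ _ (hTy _))
      have h2 : ⁅J T, J u⁆ ∈ V₁ := by
        have h : ⁅J T, J u⁆ = ⁅T, u⁆ + J ⁅J T, u⁆ + J ⁅T, J u⁆ := (sub_eq_zero.1 (hN T u)).symm
        rw [h]
        exact add_mem (add_mem (hyu _) (hV₁ _ (hyu _))) (hV₁ _ (hZ _ (hTy _)))
      rw [lie_add, lie_add, lie_smul, lie_smul]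
      exact add_mem (add_mem h1 (Submodule.smul_mem _ _ (hyu _))) (Submodule.smul_mem _ _ h2)
    intro v hv y
    obtain ⟨w, hw, a, b, rfl⟩ := mem_adjoinOrbit.1 hv
    obtain ⟨z, hz, x, hxZ, rfl⟩ := mem_centerHull.1 hw
    simp only [add_lie, smul_lie, lie_eq_zero_of_mem_center hz, zero_add]
    exact add_mem (add_mem (hx x hxZ y) (Submodule.smul_mem _ _ (hZ _ (hTy _))))
      (Submodule.smul_mem _ _ (hJT y))
  refine ⟨⟨u, htop⟩, fun x y => ?_⟩
  have hyV : ∀ w ∈ V₁, ∀ y : g, ⁅y, w⁆ ∈ V₁ := fun w hw y => by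
    rw [← lie_skew]
    exact neg_mem (hideal w hw y)
  have hJu : ∀ y : g, ⁅y, J u⁆ ∈ V₁ := by
    intro y
    obtain ⟨w, hw, a, b, rfl⟩ := mem_adjoinOrbit.1 (htop ▸ Submodule.mem_top : y ∈ _)
    simp only [add_lie, smul_lie, lie_self, smul_zero, add_zero]
    exact add_mem (hideal w hw _) (Submodule.smul_mem _ _ (huy _))
  obtain ⟨w, hw, a, b, rfl⟩ := mem_adjoinOrbit.1 (htop ▸ Submodule.mem_top : y ∈ _)
  rw [lie_add, lie_add, lie_smul, lie_smul]
  exact add_mem (add_mem (hyV w hw x) (Submodule.smul_mem _ _ (hyu x)))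
    (Submodule.smul_mem _ _ (hJu x))

/-- `T` can be corrected by a central element so that `ad (J T) = - ad T ∘ J`. -/
theorem exists_lie_map_eq_neg (hnil : ∃ s : ℕ, acs g s = ⊤)
    (hJ2 : ∀ X : g, J (J X) = -X)
    (hN : ∀ X Y : g, ⁅X, Y⁆ + J ⁅J X, Y⁆ + J ⁅X, J Y⁆ - ⁅J X, J Y⁆ = 0)
    (hdisj : ∀ x ∈ centerSubmodule g, J x ∈ centerSubmodule g → x = 0)
    {T : g} (hT : T ∉ centerHull J) (hTy : ∀ y, ⁅T, y⁆ ∈ centerSubmodule g)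
    (hideal : ∀ x y : g, ⁅x, y⁆ ∈ adjoinOrbit J (centerHull J) T) :
    ∃ x ∈ centerSubmodule g, ∀ y, ⁅J (T + x), y⁆ = -⁅T, J y⁆ := by
  set R : Submodule ℝ g := centerSubmodule g ⊔ ℝ ∙ T with hR
  have hZR : ∀ z ∈ centerSubmodule g, z ∈ R := fun z hz => Submodule.mem_sup_left hz
  have hTR : T ∈ R := Submodule.mem_sup_right (Submodule.mem_span_singleton_self T)
  have hTne : T ≠ 0 := fun h => hT (h ▸ zero_mem _)
  obtain ⟨e, he, heR, hey⟩ := exists_notMem_forall_lie_mem hnil R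
    (adjoinOrbit J (centerHull J) T) (fun x _ y => hideal x y) (fun h =>
      hTne (eq_zero_of_mem_of_map_mem hJ2 hdisj hT hTR (h map_self_mem_adjoinOrbit)))
  obtain ⟨w, hw, a, b, rfl⟩ := mem_adjoinOrbit.1 he
  obtain ⟨z, hz, x, hx, rfl⟩ := mem_centerHull.1 hw
  have hxy : ∀ y, ⁅J x, y⁆ + b • ⁅J T, y⁆ ∈ R := by
    intro y
    have := sub_mem (hey y) (hZR _ (Submodule.smul_mem _ a (hTy y)))
    simp only [add_lie, smul_lie, lie_eq_zero_of_mem_center hz] at this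
    convert this using 1
    abel
  have hb : b ≠ 0 := by
    rintro rfl
    have hx0 : x = 0 := by
      refine hdisj x hx (mem_centerSubmodule.2 fun y => ?_)
      refine eq_zero_of_mem_of_map_mem hJ2 hdisj hT (by simpa using hxy y) ?_
      rw [← lie_map_center_map hN hx]
      simpa using hxy (J y)
    apply heR
    simp only [hx0, map_zero, add_zero, zero_smul]
    exact add_mem (hZR z hz) (Submodule.smul_mem _ _ hTR)
  have hx' : b⁻¹ • x ∈ centerSubmodule g := Submodule.smul_mem _ _ hx
  refine ⟨b⁻¹ • x, hx', fun y => ?_⟩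
  have hS : ∀ y, ⁅J (T + b⁻¹ • x), y⁆ ∈ R := by
    intro y
    have := Submodule.smul_mem _ b⁻¹ (hxy y)
    rw [smul_add, smul_smul, inv_mul_cancel₀ hb, one_smul] at this
    rw [map_add, map_smul, add_lie, smul_lie, add_comm]
    exact this
  have hlie : ∀ y : g, ⁅T + b⁻¹ • x, y⁆ = ⁅T, y⁆ := fun y => by
    rw [add_lie, lie_eq_zero_of_mem_center hx', add_zero]
  have hn := hN (T + b⁻¹ • x) y
  rw [hlie, hlie] at hn
  refine eq_neg_of_add_eq_zero_left (eq_zero_of_mem_of_map_mem hJ2 hdisj hT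
    (add_mem (hS y) (hZR _ (hTy _))) ?_)
  have : J (⁅J (T + b⁻¹ • x), y⁆ + ⁅T, J y⁆) = ⁅J (T + b⁻¹ • x), J y⁆ - ⁅T, y⁆ := by
    rw [map_add]
    linear_combination (norm := module) hn
  rw [this]
  exact sub_mem (hS _) (hZR _ (hTy _))

/-- For central `p` not spanning the center there is a further central `x` such that
`[J x, u]` lies in the complex span of `p` and `T`. -/
theorem exists_lie_map_eq_combination (hnil : ∃ s : ℕ, acs g s = ⊤)
    (hJ2 : ∀ X : g, J (J X) = -X)
    (hN : ∀ X Y : g, ⁅X, Y⁆ + J ⁅J X, Y⁆ + J ⁅X, J Y⁆ - ⁅J X, J Y⁆ = 0)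
    (hdisj : ∀ x ∈ centerSubmodule g, J x ∈ centerSubmodule g → x = 0)
    {T : g} (hT : T ∉ centerHull J) (hTy : ∀ y, ⁅T, y⁆ ∈ centerSubmodule g)
    (hJTy : ∀ y, ⁅J T, y⁆ ∈ centerSubmodule g)
    (hideal : ∀ x y : g, ⁅x, y⁆ ∈ adjoinOrbit J (centerHull J) T)
    {p : g} (hp : p ∈ centerSubmodule g) (hZp : ¬ centerSubmodule g ≤ ℝ ∙ p) (u : g) :
    ∃ x ∈ centerSubmodule g, x ∉ ℝ ∙ p ∧ ∃ a b c d : ℝ,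
      ⁅J x, u⁆ = a • T + b • J T + c • p + d • J p := by
  have hV := map_mem_centerHull hJ2
  set A : Submodule ℝ g := adjoinOrbit J (centerSubmodule g) T ⊔ ℝ ∙ (J p) with hA
  have hmem : ∀ y, y ∈ A ↔ ∃ z ∈ centerSubmodule g, ∃ a b c : ℝ,
      y = z + a • T + b • J T + c • J p := by
    intro y
    simp only [hA, Submodule.mem_sup, mem_adjoinOrbit, Submodule.mem_span_singleton]
    constructor
    · rintro ⟨_, ⟨z, hz, a, b, rfl⟩, _, ⟨c, rfl⟩, rfl⟩
      exact ⟨z, hz, a, b, c, rfl⟩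
    · rintro ⟨z, hz, a, b, c, rfl⟩
      exact ⟨_, ⟨z, hz, a, b, rfl⟩, _, ⟨c, rfl⟩, rfl⟩
  have hZA : ∀ z ∈ centerSubmodule g, z ∈ A := fun z hz =>
    Submodule.mem_sup_left (le_adjoinOrbit hz)
  obtain ⟨e, he, heA, hey⟩ := exists_notMem_forall_lie_mem hnil A
    (adjoinOrbit J (centerHull J) T) (fun x _ y => hideal x y) (by
      intro h
      obtain ⟨q, hq, hqp⟩ := SetLike.not_le_iff_exists.1 hZp
      obtain ⟨z, hz, a, b, c, hJq⟩ := (hmem _).1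
        (h (le_adjoinOrbit (map_mem_centerHull_of_mem hq)))
      obtain ⟨rfl, rfl⟩ := eq_zero_of_smul_add_smul_mem_s15 (a := a) (b := b) hJ2 hV hT (by
        refine mem_centerHull.2 ⟨-z, neg_mem hz, q - c • p,
          sub_mem hq (Submodule.smul_mem _ _ hp), ?_⟩
        rw [map_sub, map_smul, hJq]
        module)
      have : q - c • p = 0 := by
        refine hdisj _ (sub_mem hq (Submodule.smul_mem _ _ hp)) ?_
        rw [map_sub, map_smul, hJq]
        convert hz using 1
        module
      exact hqp (Submodule.mem_span_singleton.2 ⟨c, (sub_eq_zero.1 this).symm⟩))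
  obtain ⟨w, hw, a, b, rfl⟩ := mem_adjoinOrbit.1 he
  obtain ⟨z, hz, x, hx, rfl⟩ := mem_centerHull.1 hw
  have hxA : ∀ y, ⁅J x, y⁆ ∈ A := by
    intro y
    have := sub_mem (hey y) (hZA _ (add_mem (Submodule.smul_mem _ a (hTy y))
      (Submodule.smul_mem _ b (hJTy y))))
    simp only [add_lie, smul_lie, lie_eq_zero_of_mem_center hz] at this
    convert this using 1
    abel
  refine ⟨x, hx, fun hxp => heA ?_, ?_⟩
  · obtain ⟨c, rfl⟩ := Submodule.mem_span_singleton.1 hxp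
    refine (hmem _).2 ⟨z, hz, a, b, c, ?_⟩
    rw [map_smul]
    abel
  · obtain ⟨z₁, hz₁, a₁, b₁, c₁, h₁⟩ := (hmem _).1 (hxA u)
    obtain ⟨z₂, hz₂, a₂, b₂, c₂, h₂⟩ := (hmem _).1 (hxA (J u))
    rw [lie_map_center_map hN hx, h₁] at h₂
    simp only [map_add, map_smul, hJ2] at h₂
    obtain ⟨h3, h4⟩ := eq_zero_of_smul_add_smul_mem_s15 (a := -b₁ - a₂) (b := a₁ - b₂) hJ2 hV hT (by
      refine mem_centerHull.2 ⟨z₂ + c₁ • p, add_mem hz₂ (Submodule.smul_mem _ _ hp),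
        c₂ • p - z₁, sub_mem (Submodule.smul_mem _ _ hp) hz₁, ?_⟩
      rw [map_sub, map_smul]
      linear_combination (norm := module) h₂)
    have h5 : z₁ - c₂ • p = 0 := by
      refine hdisj _ (sub_mem hz₁ (Submodule.smul_mem _ _ hp)) ?_
      have : J (z₁ - c₂ • p) = z₂ + c₁ • p := by
        rw [map_sub, map_smul]
        linear_combination (norm := module) h₂ - h3 • T - h4 • J T
      rw [this]
      exact add_mem hz₂ (Submodule.smul_mem _ _ hp)
    refine ⟨a₁, b₁, c₂, c₁, ?_⟩
    rw [h₁]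
    linear_combination (norm := module) h5

/-- A complex structure on a nilpotent Lie algebra of dimension at most `2 dim Z + 4`, with center
`Z` of dimension at least two, has a nonzero `J`-invariant subspace in the center. -/
theorem exists_ne_zero_mem_center_map_mem_center (hnil : ∃ s : ℕ, acs g s = ⊤)
    [FiniteDimensional ℝ g] (hJ2 : ∀ X : g, J (J X) = -X)
    (hN : ∀ X Y : g, ⁅X, Y⁆ + J ⁅J X, Y⁆ + J ⁅X, J Y⁆ - ⁅J X, J Y⁆ = 0)
    (hdim : Module.finrank ℝ g ≤ 2 * Module.finrank ℝ (centerSubmodule g) + 4)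
    (hcenter : 2 ≤ Module.finrank ℝ (centerSubmodule g)) :
    ∃ x ∈ centerSubmodule g, J x ∈ centerSubmodule g ∧ x ≠ 0 := by
  by_contra! hdisj
  have hnt : Nontrivial g := Module.nontrivial_of_finrank_pos (R := ℝ)
    (by have := Submodule.finrank_le (centerSubmodule g); omega)
  obtain ⟨T₀, hT₀, hT₀y⟩ := exists_notMem_centerHull hnil hN hdisj
  obtain ⟨-, hideal₀⟩ :=
    exists_adjoinOrbit_eq_top hnil hJ2 hN hdisj hdim hT₀ hT₀y
  obtain ⟨x, hx, hJT₀⟩ := exists_lie_map_eq_neg hnil hJ2 hN hdisj hT₀ hT₀y hideal₀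
  set T := T₀ + x with hTdef
  have hlie : ∀ y : g, ⁅T, y⁆ = ⁅T₀, y⁆ := fun y => by
    rw [hTdef, add_lie, lie_eq_zero_of_mem_center hx, add_zero]
  have hJT : ∀ y, ⁅J T, y⁆ = -⁅T, J y⁆ := fun y => by rw [hJT₀, hlie]
  have hTy : ∀ y, ⁅T, y⁆ ∈ centerSubmodule g := fun y => hlie y ▸ hT₀y y
  have hT : T ∉ centerHull J := fun h =>
    hT₀ (((centerHull J).add_mem_iff_left (mem_centerHull_of_mem hx)).1 h)
  clear_value T
  obtain ⟨⟨u, htop⟩, hideal⟩ := exists_adjoinOrbit_eq_top hnil hJ2 hN hdisj hdim hT hTy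
  have hV := map_mem_centerHull hJ2
  have hJTy : ∀ y, ⁅J T, y⁆ ∈ centerSubmodule g := fun y => by
    rw [hJT]
    exact neg_mem (hTy _)
  have hTZ : ∀ z ∈ centerSubmodule g, ⁅J z, T⁆ = 0 ∧ ⁅J z, J T⁆ = 0 := by
    intro z hz
    have h1 : ⁅J z, T⁆ = 0 := by
      rw [← lie_skew, ← hJT, lie_eq_zero_of_mem_center_right hz]
    exact ⟨h1, by rw [lie_map_center_map hN hz, h1, map_zero]⟩
  have hkill : ∀ z ∈ centerSubmodule g, ∀ v ∈ adjoinOrbit J (centerHull J) T, ⁅J z, v⁆ = 0 := by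
    intro z hz v hv
    obtain ⟨w, hw, a, b, rfl⟩ := mem_adjoinOrbit.1 hv
    simp [lie_map_center_centerHull hN hz hw, hTZ z hz]
  have hzero : ∀ z ∈ centerSubmodule g, ⁅J z, u⁆ = 0 → z = 0 := by
    intro z hz h
    refine hdisj z hz (mem_centerSubmodule.2 fun y => ?_)
    obtain ⟨w, hw, a, b, rfl⟩ := mem_adjoinOrbit.1 (htop ▸ Submodule.mem_top : y ∈ _)
    simp [hkill z hz w hw, lie_map_center_map hN hz, h]
  have hder : ∀ z ∈ centerSubmodule g, ∀ y y' : g, ⁅⁅J z, y⁆, y'⁆ + ⁅y, ⁅J z, y'⁆⁆ = 0 := by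
    intro z hz y y'
    rw [← leibniz_lie]
    exact hkill z hz _ (hideal _ _)
  have hrel : ∀ z ∈ centerSubmodule g, ∀ p ∈ centerSubmodule g, ∀ a b c d : ℝ,
      ⁅J z, u⁆ = a • T + b • J T + c • p + d • J p →
      (2 * a) • ⁅T, J u⁆ + (2 * b) • ⁅T, u⁆ - c • ⁅J p, u⁆ + d • J ⁅J p, u⁆ = 0 := by
    intro z hz p hp a b c d h
    have h1 := hder z hz u (J u)
    have h2 : ⁅J T, J u⁆ = ⁅T, u⁆ := by rw [hJT, hJ2, lie_neg, neg_neg]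
    rw [lie_map_center_map hN hz, h] at h1
    simp only [map_add, map_smul, hJ2, add_lie, smul_lie, lie_add, lie_smul, h2, lie_neg,
      lie_eq_zero_of_mem_center hp, lie_eq_zero_of_mem_center_right hp,
      lie_map_center_map hN hp] at h1
    rw [← lie_skew u (J T), ← lie_skew u T, ← lie_skew u (J p), hJT] at h1
    linear_combination (norm := module) h1
  have hspan : ∀ p, ¬ centerSubmodule g ≤ ℝ ∙ p := by
    intro p h
    have h1 := Submodule.finrank_mono h
    have h2 := finrank_span_le_card (R := ℝ) ({p} : Set g)
    rw [Set.toFinset_singleton, Finset.card_singleton] at h2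
    omega
  obtain ⟨x₀, hx₀, hx₀p, a, b, c, d, h₀⟩ := exists_lie_map_eq_combination hnil hJ2 hN hdisj hT
    hTy hJTy hideal (zero_mem _) (hspan 0) u
  have hx₀ne : x₀ ≠ 0 := fun h => hx₀p (by
    rw [h]
    exact zero_mem _)
  obtain ⟨x₁, hx₁, hx₁p, a', b', c', d', h₁⟩ := exists_lie_map_eq_combination hnil hJ2 hN hdisj
    hT hTy hJTy hideal hx₀ (hspan x₀) u
  have hr₀ := hrel x₀ hx₀ 0 (zero_mem _) a b c d h₀
  have hr₁ := hrel x₁ hx₁ x₀ hx₀ a' b' c' d' h₁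
  simp only [map_zero, smul_zero, add_zero, zero_lie, sub_zero] at h₀ hr₀
  have hab : ¬ (a = 0 ∧ b = 0) := by
    rintro ⟨rfl, rfl⟩
    exact hx₀ne (hzero x₀ hx₀ (by simp [h₀]))
  have hcd : c' = 0 ∧ d' = 0 := by
    rw [h₀] at hr₁
    simp only [map_add, map_smul, hJ2] at hr₁
    obtain ⟨h3, h4⟩ := eq_zero_of_smul_add_smul_mem_s15 (a := c' * a + d' * b)
      (b := c' * b - d' * a) hJ2 hV hT (by
        have : (c' * a + d' * b) • T + (c' * b - d' * a) • J T =
            (2 * a') • ⁅T, J u⁆ + (2 * b') • ⁅T, u⁆ := by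
          linear_combination (norm := module) -hr₁
        rw [this]
        exact mem_centerHull_of_mem (add_mem (Submodule.smul_mem _ _ (hTy _))
          (Submodule.smul_mem _ _ (hTy _))))
    have hpos : a * a + b * b ≠ 0 := by
      intro h
      exact hab ⟨by nlinarith [mul_self_nonneg a, mul_self_nonneg b],
        by nlinarith [mul_self_nonneg a, mul_self_nonneg b]⟩
    constructor
    · apply (mul_eq_zero.1 _).resolve_right hpos
      linear_combination a * h3 + b * h4
    · apply (mul_eq_zero.1 _).resolve_right hpos
      linear_combination b * h3 - a * h4
  obtain ⟨rfl, rfl⟩ := hcd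
  simp only [zero_smul, add_zero, sub_zero] at h₁ hr₁
  have hdet : a * b' - a' * b ≠ 0 := by
    intro hdet
    have hcomb : ∀ r s : ℝ, r * a + s * a' = 0 → r * b + s * b' = 0 → s = 0 := by
      intro r s ha hb
      have h3 : r • x₀ + s • x₁ = 0 := by
        refine hzero _ (add_mem (Submodule.smul_mem _ _ hx₀) (Submodule.smul_mem _ _ hx₁)) ?_
        rw [map_add, map_smul, map_smul, add_lie, smul_lie, smul_lie, h₀, h₁]
        linear_combination (norm := module) ha • T + hb • J T
      by_contra hs
      refine hx₁p (Submodule.mem_span_singleton.2 ⟨-(s⁻¹ * r), ?_⟩)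
      have := congrArg (s⁻¹ • ·) h3
      simp only [smul_add, smul_smul, inv_mul_cancel₀ hs, one_smul, smul_zero] at this
      linear_combination (norm := module) -this
    exact hab ⟨neg_eq_zero.1 (hcomb a' (-a) (by ring) (by linear_combination -hdet)),
      neg_eq_zero.1 (hcomb b' (-b) (by linear_combination hdet) (by ring))⟩
  have hTJu : ⁅T, J u⁆ = 0 := by
    apply (smul_eq_zero.1 _).resolve_left hdet
    linear_combination (norm := module) (b' / 2) • hr₀ - (b / 2) • hr₁
  have hTu : ⁅T, u⁆ = 0 := by
    apply (smul_eq_zero.1 _).resolve_left hdet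
    linear_combination (norm := module) (a / 2) • hr₁ - (a' / 2) • hr₀
  have hTJT : ⁅T, J T⁆ = 0 := by
    have h3 := hder x₀ hx₀ u T
    have h4 := hder x₀ hx₀ u (J T)
    simp only [h₀, hTZ x₀ hx₀, add_lie, smul_lie, lie_self, lie_zero, smul_zero, add_zero,
      zero_add] at h3 h4
    rw [← lie_skew, smul_neg, neg_eq_zero] at h3
    by_contra h
    exact hab ⟨(smul_eq_zero.1 h4).resolve_right h, (smul_eq_zero.1 h3).resolve_right h⟩
  refine hT (mem_centerHull_of_mem (mem_centerSubmodule.2 fun y => ?_))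
  obtain ⟨w, hw, r, s, rfl⟩ := mem_adjoinOrbit.1 (htop ▸ Submodule.mem_top : y ∈ _)
  obtain ⟨v, hv, r', s', rfl⟩ := mem_adjoinOrbit.1 hw
  obtain ⟨z, hz, z', hz', rfl⟩ := mem_centerHull.1 hv
  have hz'T : ⁅T, J z'⁆ = 0 := by rw [← lie_skew, (hTZ z' hz').1, neg_zero]
  simp [hTJu, hTu, hTJT, hz'T, lie_eq_zero_of_mem_center_right hz]

/-- The center of a direct sum of `ι` many nonzero nilpotent Lie algebras has dimension at least
the cardinality of `ι`. -/
theorem card_le_finrank_centerSubmodule [FiniteDimensional ℝ g] {ι : Type*} [Fintype ι]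
    [DecidableEq ι] {h : ι → Type*} [∀ i, LieRing (h i)] [∀ i, LieAlgebra ℝ (h i)]
    [∀ i, Nontrivial (h i)] (hfac : ∀ i, ∃ s : ℕ, acs (h i) s = ⊤)
    (e : g ≃ₗ⁅ℝ⁆ DirectSum ι h) :
    Fintype.card ι ≤ Module.finrank ℝ (centerSubmodule g) := by
  choose c hc hc0 using fun i => exists_ne_zero_mem_centerSubmodule (hfac i)
  have hmem : ∀ i, e.symm (DirectSum.of h i (c i)) ∈ centerSubmodule g := by
    intro i
    refine mem_centerSubmodule.2 fun y => e.injective (Eq.trans ?_ (map_zero e).symm)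
    change e ⁅_, _⁆ = 0
    rw [LieEquiv.map_lie, LieEquiv.apply_symm_apply]
    ext j
    rw [DirectSum.bracket_apply]
    by_cases hij : i = j
    · subst hij
      simpa using lie_eq_zero_of_mem_center (hc i) _
    · simp [DirectSum.of_eq_of_ne _ _ _ (Ne.symm hij)]
  have hli : LinearIndependent ℝ fun i => (⟨_, hmem i⟩ : centerSubmodule g) := by
    rw [Fintype.linearIndependent_iff]
    intro r hr j
    have h1 := congrArg (fun x : centerSubmodule g => e (x : g) j) hr
    simp only [AddSubmonoidClass.coe_finsetSum, SetLike.val_smul, map_sum, map_smul,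
      LieEquiv.apply_symm_apply, DirectSum.sum_apply, DirectSum.smul_apply, ZeroMemClass.coe_zero,
      map_zero, DirectSum.zero_apply] at h1
    rw [Finset.sum_eq_single j (fun i _ hij => by
      rw [DirectSum.of_eq_of_ne _ _ _ hij.symm, smul_zero]) (by simp),
      DirectSum.of_eq_same] at h1
    exact (smul_eq_zero.1 h1).resolve_right (hc0 j)
  exact hli.fintype_card_le_finrank

end

/-- if a `2n`-dimensional nilpotent Lie algebra with `n ≥ 4` is
isomorphic to a product of `n - 2` nonzero (nilpotent) Lie algebras, then every
complex structure on it is quasi-nilpotent, i.e. `a₁(J) ≠ 0`. -/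
theorem product_complex_structure_quasinilpotent (g : Type*) [LieRing g]
    [LieAlgebra ℝ g] [FiniteDimensional ℝ g] (n : ℕ) (hn : 4 ≤ n)
    (hdim : Module.finrank ℝ g = 2 * n)
    (hnil : ∃ s : ℕ, acs g s = ⊤)
    (h : Fin (n - 2) → Type*) [∀ i, LieRing (h i)] [∀ i, LieAlgebra ℝ (h i)]
    [∀ i, Nontrivial (h i)]
    (hfac : ∀ i, ∃ s : ℕ, acs (h i) s = ⊤)
    (e : g ≃ₗ⁅ℝ⁆ DirectSum (Fin (n - 2)) h)
    (J : g →ₗ[ℝ] g) (hJ2 : ∀ X : g, J (J X) = -X)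
    (hN : ∀ X Y : g, ⁅X, Y⁆ + J ⁅J X, Y⁆ + J ⁅X, J Y⁆ - ⁅J X, J Y⁆ = 0) :
    ∃ X : g, X ≠ 0 ∧ ∀ Z : g, ⁅X, Z⁆ = 0 ∧ ⁅J X, Z⁆ = 0 := by
  have hcard := card_le_finrank_centerSubmodule hfac e
  rw [Fintype.card_fin] at hcard
  obtain ⟨x, hx, hJx, hx0⟩ := exists_ne_zero_mem_center_map_mem_center hnil hJ2 hN
    (by omega) (by omega)
  exact ⟨x, hx0, fun Z => ⟨mem_centerSubmodule.1 hx Z, mem_centerSubmodule.1 hJx Z⟩⟩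
end
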